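/- arXiv:2408.13837 — 3 statements merged into one kernel-verified Lean document; each statement's English description precedes it below -/
import Mathlib

section
/- Let X be a Banach space, J a connected topological space, and for each s ∈ J let (Y₁(s);M(s),N(s);Y₂(s)) be a semi-Fredholm tetrad of closed linear subspaces of X, such that each of the maps s ↦ Y₁(s), s ↦ M(s), s ↦ N(s), s ↦ Y₂(s) is continuous with respect to the gap topology on the set of closed linear subspaces of X (the topology defined by δ̂). Then the function s ↦ Index(Y₁(s);M(s),N(s);Y₂(s)), with values in ℤ∪{+∞,−∞}, is constant on J. -/
open scoped Classical

/-- The gap `δ(M,N)` between two linear subspaces of a normed space: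
`δ(M,N) = sup_{u ∈ M, ‖u‖ = 1} dist(u, N)` (and `0` if `M = {0}`,
since the supremum of the empty set of reals is `0`). -/
noncomputable def gapSub {X : Type*} [NormedAddCommGroup X] [NormedSpace ℂ X]
    (M N : Submodule ℂ X) : ℝ :=
  sSup ((fun u => Metric.infDist u (N : Set X)) '' {u : X | u ∈ M ∧ ‖u‖ = 1})

/-- The symmetric gap `δ̂(M,N) = max (δ(M,N), δ(N,M))`. -/
noncomputable def hatGap {X : Type*} [NormedAddCommGroup X] [NormedSpace ℂ X]
    (M N : Submodule ℂ X) : ℝ :=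
  max (gapSub M N) (gapSub N M)

/-- The minimum gap `γ(M,N)`: the infimum of `dist(u,N)/dist(u, M ⊓ N)` over
`u ∈ M \ N`, and `1` if `M ⊆ N`. -/
noncomputable def minGap {X : Type*} [NormedAddCommGroup X] [NormedSpace ℂ X]
    (M N : Submodule ℂ X) : ℝ :=
  if M ≤ N then 1
  else sInf ((fun u => Metric.infDist u (N : Set X) /
      Metric.infDist u ((M ⊓ N : Submodule ℂ X) : Set X)) '' {u : X | u ∈ M ∧ u ∉ N})

/-- The rank (dimension, as a cardinal) of the quotient `B / A` for submodules
`A ≤ B` of `X`. -/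
noncomputable def quotRank {X : Type*} [NormedAddCommGroup X] [NormedSpace ℂ X]
    (A B : Submodule ℂ X) : Cardinal :=
  Module.rank ℂ (↥B ⧸ A.comap B.subtype)

/-- The quotient `B / A` is finite dimensional. -/
def QuotFin {X : Type*} [NormedAddCommGroup X] [NormedSpace ℂ X]
    (A B : Submodule ℂ X) : Prop :=
  FiniteDimensional ℂ (↥B ⧸ A.comap B.subtype)

/-- The finite dimension of the quotient `B / A`. -/
noncomputable def quotFinrank {X : Type*} [NormedAddCommGroup X] [NormedSpace ℂ X]
    (A B : Submodule ℂ X) : ℕ :=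
  Module.finrank ℂ (↥B ⧸ A.comap B.subtype)

/-- The dimension of the quotient `B / A` as an extended real:
the finrank if finite dimensional, `+∞` otherwise. -/
noncomputable def eQuotDim {X : Type*} [NormedAddCommGroup X] [NormedSpace ℂ X]
    (A B : Submodule ℂ X) : EReal :=
  if QuotFin A B then ((quotFinrank A B : ℝ) : EReal) else ⊤

/-- The index of a tetrad `(Y₁; M, N; Y₂)`:
`Index(Y₁; M, N; Y₂) = dim((M ∩ N)/Y₁) − dim(Y₂/(M + N))`, valued in `ℤ ∪ {±∞}`. -/
noncomputable def tetradIndex {X : Type*} [NormedAddCommGroup X] [NormedSpace ℂ X]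
    (Y₁ M N Y₂ : Submodule ℂ X) : EReal :=
  eQuotDim Y₁ (M ⊓ N) - eQuotDim (M ⊔ N) Y₂

/-- Continuity of a family of (closed) subspaces with respect to the gap
topology defined by `δ̂`: near each point of the parameter space, the gap to
the subspace at that point is eventually arbitrarily small. -/
def GapContinuous {J : Type*} [TopologicalSpace J] {X : Type*} [NormedAddCommGroup X]
    [NormedSpace ℂ X] (F : J → Submodule ℂ X) : Prop :=
  ∀ s₀ : J, ∀ ε : ℝ, 0 < ε → ∀ᶠ s in nhds s₀, hatGap (F s) (F s₀) < ε

open Filter Topology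

namespace TetradAux

/-! ### Algebra: dimensions of quotients in `ℕ∞` -/

/-- dimension of `B / A` in `ℕ∞`. -/
noncomputable def edim {X : Type*} [NormedAddCommGroup X] [NormedSpace ℂ X]
    (A B : Submodule ℂ X) : ℕ∞ :=
  Cardinal.toENat (quotRank A B)

section algebra
variable {X : Type*} [NormedAddCommGroup X] [NormedSpace ℂ X]

theorem edim_lt_top_iff (A B : Submodule ℂ X) : edim A B < ⊤ ↔ QuotFin A B := by
  unfold edim QuotFin quotRank
  rw [Cardinal.toENat_lt_top]
  exact Module.rank_lt_aleph0_iff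

theorem eQuotDim_eq (A B : Submodule ℂ X) : eQuotDim A B = ((edim A B : ENNReal) : EReal) := by
  unfold eQuotDim
  split_ifs with h
  · have h' : Module.Finite ℂ (↥B ⧸ A.comap B.subtype) := h
    unfold edim quotRank quotFinrank
    have e : Module.rank ℂ (↥B ⧸ A.comap B.subtype)
        = ((Module.finrank ℂ (↥B ⧸ A.comap B.subtype) : ℕ) : Cardinal) :=
      (Module.finrank_eq_rank ℂ _).symm
    rw [e, Cardinal.toENat_nat, ENat.toENNReal_coe, ← ENNReal.ofReal_natCast, EReal.coe_ennreal_ofReal,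
      max_eq_left (Nat.cast_nonneg _)]
  · rw [← edim_lt_top_iff, not_lt_top_iff] at h
    rw [h]; simp

theorem edim_sup (A B : Submodule ℂ X) : edim (A ⊓ B) A = edim B (A ⊔ B) := by
  unfold edim quotRank
  have e := (LinearMap.quotientInfEquivSupQuotient A B).rank_eq
  rw [← Submodule.comap_inf] at e
  rw [e]

theorem edim_add {A B C : Submodule ℂ X} (hAB : A ≤ B) (hBC : B ≤ C) :
    edim A C = edim A B + edim B C := by
  unfold edim quotRank
  rw [← map_add]
  congr 1
  have hle : A.comap C.subtype ≤ B.comap C.subtype := Submodule.comap_mono hAB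
  have h1 := Submodule.rank_quotient_add_rank
    ((B.comap C.subtype).map (A.comap C.subtype).mkQ)
  rw [(Submodule.quotientQuotientEquivQuotient _ _ hle).rank_eq] at h1
  rw [← h1, add_comm]
  congr 1
  -- map from B to C/A
  let g : ↥B →ₗ[ℂ] (↥C ⧸ A.comap C.subtype) :=
    (A.comap C.subtype).mkQ.comp (Submodule.inclusion hBC)
  have hk : LinearMap.ker g = A.comap B.subtype := by
    ext x
    simp [g, LinearMap.mem_ker, Submodule.Quotient.mk_eq_zero]
  have hr : LinearMap.range g = (B.comap C.subtype).map (A.comap C.subtype).mkQ := by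
    rw [LinearMap.range_comp, Submodule.range_inclusion]
  rw [← hr, ← hk]
  exact (g.quotKerEquivRange).rank_eq.symm

theorem edim_self (A : Submodule ℂ X) : edim A A = 0 := by
  unfold edim quotRank
  simp

theorem eq_of_edim_zero {A B : Submodule ℂ X} (hAB : A ≤ B) (h : edim A B = 0) : A = B := by
  unfold edim quotRank at h
  rw [Cardinal.toENat_eq_zero, rank_zero_iff, Submodule.Quotient.subsingleton_iff,
    Submodule.comap_subtype_eq_top] at h
  exact le_antisymm hAB h

theorem edim_span {A : Submodule ℂ X} {f : X} (hf : f ∉ A) :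
    edim A (A ⊔ Submodule.span ℂ {f}) = 1 := by
  rw [sup_comm, ← edim_sup]
  have h0 : f ≠ 0 := fun h => hf (h ▸ A.zero_mem)
  have : Submodule.span ℂ {f} ⊓ A = ⊥ := by
    rw [eq_bot_iff]
    rintro x ⟨hx, hxA⟩
    obtain ⟨c, rfl⟩ := Submodule.mem_span_singleton.1 hx
    by_cases hc : c = 0
    · simp [hc]
    · exact absurd ((A.smul_mem_iff hc).1 hxA) hf
  rw [this]
  unfold edim quotRank
  rw [Submodule.comap_bot, Submodule.ker_subtype, (Submodule.quotEquivOfEqBot ⊥ rfl).rank_eq]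
  rw [← Module.finrank_eq_rank, finrank_span_singleton h0]
  simp

/-- Changing `N` to `N₁ ≥ N`: the change of dimensions adds up. -/
theorem edim_change {M N N₁ : Submodule ℂ X} (h : N ≤ N₁) :
    edim (M ⊓ N) (M ⊓ N₁) + edim (M ⊔ N) (M ⊔ N₁) = edim N N₁ := by
  have e1 : edim (M ⊓ N) (M ⊓ N₁) = edim N ((M ⊓ N₁) ⊔ N) := by
    rw [← edim_sup, inf_assoc, inf_eq_right.2 h]
  have e2 : edim (M ⊔ N) (M ⊔ N₁) = edim ((M ⊓ N₁) ⊔ N) N₁ := by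
    have : M ⊔ N₁ = N₁ ⊔ (M ⊔ N) := by
      rw [sup_comm M N₁, sup_comm M N, ← sup_assoc, sup_eq_left.2 h]
    rw [this, ← edim_sup]
    congr 1
    rw [sup_comm M N, inf_comm, sup_inf_assoc_of_le _ h, sup_comm]
  rw [e1, e2]
  exact (edim_add le_sup_right (sup_le inf_le_right h)).symm

end algebra

/-! ### Quantitative nearness of subspaces -/

section near
variable {X : Type*} [NormedAddCommGroup X] [NormedSpace ℂ X]

/-- every vector of `A` is within `ε‖u‖` of `B`. -/
def Near (ε : ℝ) (A B : Submodule ℂ X) : Prop :=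
  ∀ u ∈ A, ∃ v ∈ B, ‖u - v‖ ≤ ε * ‖u‖

/-- every vector of `M + N` can be split with a bound. -/
def Split (K : ℝ) (M N : Submodule ℂ X) : Prop :=
  ∀ w ∈ M ⊔ N, ∃ m ∈ M, ∃ n ∈ N, m + n = w ∧ ‖m‖ ≤ K * ‖w‖ ∧ ‖n‖ ≤ K * ‖w‖

theorem near_of_gap {A B : Submodule ℂ X} {ε : ℝ} (h : gapSub A B < ε) : Near ε A B := by
  intro u hu
  by_cases h0 : u = 0
  · exact ⟨0, B.zero_mem, by simp [h0]⟩
  have hpos : 0 < ‖u‖ := norm_pos_iff.2 h0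
  have hbdd : BddAbove ((fun u => Metric.infDist u (B : Set X)) '' {u : X | u ∈ A ∧ ‖u‖ = 1}) := by
    refine ⟨1, ?_⟩
    rintro _ ⟨v, ⟨_, hv⟩, rfl⟩
    have := Metric.infDist_le_dist_of_mem (x := v) (show (0 : X) ∈ (B : Set X) from B.zero_mem)
    rw [dist_zero_right, hv] at this
    exact this
  set c : ℂ := ((‖u‖ : ℝ) : ℂ) with hc
  have hcn : ‖c‖ = ‖u‖ := by rw [hc, Complex.norm_real, norm_norm]
  have hc0 : c ≠ 0 := by
    rw [← norm_pos_iff, hcn]; exact hpos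
  have hlt : Metric.infDist (c⁻¹ • u) (B : Set X) < ε := by
    refine lt_of_le_of_lt (le_csSup hbdd ⟨c⁻¹ • u, ⟨A.smul_mem _ hu, ?_⟩, rfl⟩) h
    rw [norm_smul, norm_inv, hcn, inv_mul_cancel₀ hpos.ne']
  obtain ⟨v, hv, hd⟩ := (Metric.infDist_lt_iff ⟨0, B.zero_mem⟩).1 hlt
  refine ⟨c • v, B.smul_mem _ hv, ?_⟩
  have : u - c • v = c • (c⁻¹ • u - v) := by
    rw [smul_sub, smul_inv_smul₀ hc0]
  rw [this, norm_smul, hcn, mul_comm]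
  rw [dist_eq_norm] at hd
  exact mul_le_mul_of_nonneg_right hd.le hpos.le

theorem Near.mono {ε ε' : ℝ} {A B : Submodule ℂ X} (h : Near ε A B) (hε : ε ≤ ε') :
    Near ε' A B := fun u hu => by
  obtain ⟨v, hv, hd⟩ := h u hu
  exact ⟨v, hv, hd.trans (mul_le_mul_of_nonneg_right hε (norm_nonneg _))⟩

theorem Near.trans {ε δ : ℝ} {A B C : Submodule ℂ X} (hδ : 0 ≤ δ)
    (h : Near ε A B) (h' : Near δ B C) : Near (ε + δ * (1 + ε)) A C := fun u hu => by
  obtain ⟨v, hv, hd⟩ := h u hu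
  obtain ⟨w, hw, hd'⟩ := h' v hv
  refine ⟨w, hw, ?_⟩
  have h1 : ‖v‖ ≤ ‖u‖ + ‖u - v‖ := by
    rw [norm_sub_rev]; exact norm_le_insert' v u
  have h2 : ‖u - w‖ ≤ ‖u - v‖ + ‖v - w‖ := norm_sub_le_norm_sub_add_norm_sub u v w
  nlinarith [mul_le_mul_of_nonneg_left h1 hδ, mul_le_mul_of_nonneg_left hd hδ]

/-- a closed subspace `B ≤ A` with `A` half-near to `B` is all of `A`. -/
theorem eq_of_near {A B : Submodule ℂ X} (hB : IsClosed (B : Set X)) (hBA : B ≤ A)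
    (h : Near (1 / 2) A B) : A = B := by
  refine le_antisymm (fun u hu => ?_) hBA
  have key : ∀ k : ℕ, ∃ v ∈ B, ‖u - v‖ ≤ ‖u‖ / 2 ^ k := by
    intro k
    induction k with
    | zero => exact ⟨0, B.zero_mem, by simp⟩
    | succ k ih =>
      obtain ⟨v, hv, hd⟩ := ih
      obtain ⟨w, hw, hd'⟩ := h (u - v) (A.sub_mem hu (hBA hv))
      refine ⟨v + w, B.add_mem hv hw, ?_⟩
      rw [← sub_sub, pow_succ, ← div_div]
      linarith
  have : u ∈ closure (B : Set X) := by
    rw [Metric.mem_closure_iff]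
    intro ε hε
    obtain ⟨k, hk⟩ := exists_pow_lt_of_lt_one (show 0 < ε / (‖u‖ + 1) by positivity)
      (show (1 / 2 : ℝ) < 1 by norm_num)
    obtain ⟨v, hv, hd⟩ := key k
    refine ⟨v, hv, ?_⟩
    rw [dist_eq_norm]
    rw [lt_div_iff₀ (by positivity)] at hk
    have e : ‖u‖ / 2 ^ k = (1 / 2 : ℝ) ^ k * ‖u‖ := by
      rw [one_div, inv_pow]; field_simp
    have : (0 : ℝ) < (1 / 2) ^ k := by positivity
    rw [e] at hd
    nlinarith
  rwa [hB.closure_eq] at this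

theorem near_inf {M N M₁ N₁ : Submodule ℂ X} {ε K : ℝ} (hK : 0 ≤ K) (hs : Split K M₁ N₁)
    (hM : Near ε M M₁) (hN : Near ε N N₁) : Near ((1 + 2 * K) * ε) (M ⊓ N) (M₁ ⊓ N₁) := by
  rintro u ⟨huM, huN⟩
  obtain ⟨m, hm, hdm⟩ := hM u huM
  obtain ⟨n, hn, hdn⟩ := hN u huN
  obtain ⟨a, ha, b, hb, hab, hna, -⟩ := hs (m - n)
    (Submodule.sub_mem _ (Submodule.mem_sup_left hm) (Submodule.mem_sup_right hn))
  refine ⟨m - a, ⟨M₁.sub_mem hm ha, ?_⟩, ?_⟩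
  · have : m - a = n + b := by
      rw [sub_eq_iff_eq_add, add_assoc, add_comm b a, hab]; abel
    rw [this]
    exact N₁.add_mem hn hb
  · have h1 : ‖m - n‖ ≤ ‖u - m‖ + ‖u - n‖ := by
      have : m - n = (u - n) - (u - m) := by abel
      rw [this, add_comm]; exact norm_sub_le _ _
    have h2 : ‖u - (m - a)‖ ≤ ‖u - m‖ + ‖a‖ := by
      rw [← sub_add]; exact norm_add_le _ _
    nlinarith [mul_le_mul_of_nonneg_left h1 hK]

theorem near_sup {M N M₁ N₁ : Submodule ℂ X} {ε K : ℝ} (hε : 0 ≤ ε) (hs : Split K M N)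
    (hM : Near ε M M₁) (hN : Near ε N N₁) : Near (2 * K * ε) (M ⊔ N) (M₁ ⊔ N₁) := by
  intro w hw
  obtain ⟨m, hm, n, hn, rfl, hbm, hbn⟩ := hs w hw
  obtain ⟨m', hm', hdm⟩ := hM m hm
  obtain ⟨n', hn', hdn⟩ := hN n hn
  refine ⟨m' + n', Submodule.add_mem_sup hm' hn', ?_⟩
  have : m + n - (m' + n') = (m - m') + (n - n') := by abel
  have h1 := norm_add_le (m - m') (n - n')
  rw [this]
  nlinarith [mul_le_mul_of_nonneg_left hbm hε, mul_le_mul_of_nonneg_left hbn hε]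

theorem split_of_closed [CompleteSpace X] {M N : Submodule ℂ X} (hM : IsClosed (M : Set X))
    (hN : IsClosed (N : Set X)) (hMN : IsClosed ((M ⊔ N : Submodule ℂ X) : Set X)) :
    ∃ K > 0, Split K M N := by
  have : CompleteSpace M := hM.completeSpace_coe
  have : CompleteSpace N := hN.completeSpace_coe
  have : CompleteSpace (M ⊔ N : Submodule ℂ X) := hMN.completeSpace_coe
  let T : (M × N) →L[ℂ] (M ⊔ N : Submodule ℂ X) :=
    (M.subtypeL.coprod N.subtypeL).codRestrict (M ⊔ N)
      (fun p => Submodule.add_mem_sup p.1.2 p.2.2)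
  have hT : Function.Surjective T := by
    rintro ⟨w, hw⟩
    obtain ⟨m, hm, n, hn, rfl⟩ := Submodule.mem_sup.1 hw
    exact ⟨(⟨m, hm⟩, ⟨n, hn⟩), rfl⟩
  obtain ⟨C, hC, h⟩ := T.exists_preimage_norm_le hT
  refine ⟨C, hC, fun w hw => ?_⟩
  obtain ⟨⟨m, n⟩, hmn, hn⟩ := h ⟨w, hw⟩
  refine ⟨m, m.2, n, n.2, congrArg Subtype.val hmn, ?_, ?_⟩
  · exact (norm_fst_le (m, n)).trans hn
  · exact (norm_snd_le (m, n)).trans hn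

/-- Successive approximation. -/
theorem split_of_approx [CompleteSpace X] {M N Y : Submodule ℂ X} (hM : IsClosed (M : Set X))
    (hN : IsClosed (N : Set X)) {C : ℝ}
    (hMY : M ⊔ N ≤ Y)
    (h : ∀ y ∈ Y, ∃ m ∈ M, ∃ n ∈ N, ‖m‖ ≤ C * ‖y‖ ∧ ‖n‖ ≤ C * ‖y‖ ∧
      ‖y - (m + n)‖ ≤ 1 / 2 * ‖y‖) :
    M ⊔ N = Y ∧ Split (2 * C) M N := by
  suffices H : ∀ y ∈ Y, ∃ m ∈ M, ∃ n ∈ N, m + n = y ∧ ‖m‖ ≤ 2 * C * ‖y‖ ∧ ‖n‖ ≤ 2 * C * ‖y‖ by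
    refine ⟨le_antisymm hMY fun y hy => ?_, fun w hw => H w (hMY hw)⟩
    obtain ⟨m, hm, n, hn, rfl, -⟩ := H y hy
    exact Submodule.add_mem_sup hm hn
  choose! f hf g hg hfb hgb hd using h
  intro y hy
  let r : ℕ → X := fun k => (fun z => z - (f z + g z))^[k] y
  have hr0 : r 0 = y := rfl
  have hrs : ∀ k, r (k + 1) = r k - (f (r k) + g (r k)) := fun k => by
    simp only [r, Function.iterate_succ_apply']
  have hrY : ∀ k, r k ∈ Y := by
    intro k
    induction k with
    | zero => exact hy
    | succ k ih =>
      rw [hrs]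
      exact Y.sub_mem ih (hMY (Submodule.add_mem_sup (hf _ ih) (hg _ ih)))
  have hrb : ∀ k, ‖r k‖ ≤ ‖y‖ * (1 / 2) ^ k := by
    intro k
    induction k with
    | zero => simp [hr0]
    | succ k ih =>
      rw [hrs, pow_succ]
      linarith [hd _ (hrY k)]
  by_cases hC : C < 0
  · have h1 := hfb y hy
    have : ‖y‖ = 0 := by
      by_contra h0
      have : 0 < ‖y‖ := lt_of_le_of_ne (norm_nonneg _) (Ne.symm h0)
      nlinarith [norm_nonneg (f y)]
    refine ⟨0, M.zero_mem, 0, N.zero_mem, ?_, ?_, ?_⟩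
    · rw [norm_eq_zero] at this; simp [this]
    · simp [this]
    · simp [this]
  push Not at hC
  have hgeo : HasSum (fun k : ℕ => C * ‖y‖ * (1 / 2 : ℝ) ^ k) (2 * C * ‖y‖) := by
    have := hasSum_geometric_two.mul_left (C * ‖y‖)
    have e : 2 * C * ‖y‖ = C * ‖y‖ * 2 := by ring
    rw [e]; exact this
  have bf : ∀ k, ‖f (r k)‖ ≤ C * ‖y‖ * (1 / 2 : ℝ) ^ k := fun k => by
    have := mul_le_mul_of_nonneg_left (hrb k) hC
    linarith [hfb _ (hrY k)]
  have bg : ∀ k, ‖g (r k)‖ ≤ C * ‖y‖ * (1 / 2 : ℝ) ^ k := fun k => by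
    have := mul_le_mul_of_nonneg_left (hrb k) hC
    linarith [hgb _ (hrY k)]
  have sf : Summable (fun k => f (r k)) := Summable.of_norm_bounded hgeo.summable bf
  have sg : Summable (fun k => g (r k)) := Summable.of_norm_bounded hgeo.summable bg
  refine ⟨∑' k, f (r k), ?_, ∑' k, g (r k), ?_, ?_, tsum_of_norm_bounded hgeo bf,
    tsum_of_norm_bounded hgeo bg⟩
  · exact hM.mem_of_tendsto sf.hasSum.tendsto_sum_nat
      (Eventually.of_forall fun n => M.sum_mem fun k _ => hf _ (hrY k))
  · exact hN.mem_of_tendsto sg.hasSum.tendsto_sum_nat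
      (Eventually.of_forall fun n => N.sum_mem fun k _ => hg _ (hrY k))
  · rw [← sf.tsum_add sg]
    have t1 := (sf.add sg).hasSum.tendsto_sum_nat
    have t2 : Tendsto (fun n => ∑ k ∈ Finset.range n, (f (r k) + g (r k))) atTop (𝓝 (y - 0)) := by
      have e : ∀ n, ∑ k ∈ Finset.range n, (f (r k) + g (r k)) = y - r n := by
        intro n
        induction n with
        | zero => simp [hr0]
        | succ n ih => rw [Finset.sum_range_succ, ih, hrs]; abel
      simp only [e]
      refine tendsto_const_nhds.sub ?_
      refine squeeze_zero_norm hrb ?_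
      have := (tendsto_pow_atTop_nhds_zero_of_lt_one (show (0 : ℝ) ≤ 1 / 2 by norm_num)
        (by norm_num)).const_mul ‖y‖
      simpa using this
    rw [sub_zero] at t2
    exact tendsto_nhds_unique t1 t2

/-- openness of surjectivity of `M × N → Y` -/
theorem split_perturb_sup [CompleteSpace X] {M N Y M₁ N₁ Y₁ : Submodule ℂ X} {K ε : ℝ}
    (hK : 0 < K) (hs : Split K M N) (hY : M ⊔ N = Y)
    (hM₁ : IsClosed (M₁ : Set X)) (hN₁ : IsClosed (N₁ : Set X)) (hle : M₁ ⊔ N₁ ≤ Y₁)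
    (hε : 0 ≤ ε) (hε1 : ε ≤ 1) (hεK : (1 + 4 * K) * ε ≤ 1 / 2)
    (nM : Near ε M M₁) (nN : Near ε N N₁) (nY : Near ε Y₁ Y) :
    M₁ ⊔ N₁ = Y₁ ∧ Split (8 * K) M₁ N₁ := by
  have := split_of_approx (C := 4 * K) hM₁ hN₁ hle ?_
  · rw [show 2 * (4 * K) = 8 * K by ring] at this
    exact this
  intro y hy
  obtain ⟨z, hz, hd⟩ := nY y hy
  obtain ⟨m, hm, n, hn, hmn, hmb, hnb⟩ := hs z (hY ▸ hz)
  obtain ⟨m', hm', hdm⟩ := nM m hm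
  obtain ⟨n', hn', hdn⟩ := nN n hn
  have y0 := norm_nonneg y
  have hzn : ‖z‖ ≤ 2 * ‖y‖ := by
    have : ‖z‖ ≤ ‖y‖ + ‖y - z‖ := by rw [norm_sub_rev]; exact norm_le_insert' z y
    nlinarith
  have hKz : K * ‖z‖ ≤ 2 * K * ‖y‖ := by nlinarith
  have bm : ‖m'‖ ≤ ‖m‖ + ‖m - m'‖ := by rw [norm_sub_rev]; exact norm_le_insert' m' m
  have bn : ‖n'‖ ≤ ‖n‖ + ‖n - n'‖ := by rw [norm_sub_rev]; exact norm_le_insert' n' n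
  have em : ε * ‖m‖ ≤ ε * (2 * K * ‖y‖) := mul_le_mul_of_nonneg_left (hmb.trans hKz) hε
  have en : ε * ‖n‖ ≤ ε * (2 * K * ‖y‖) := mul_le_mul_of_nonneg_left (hnb.trans hKz) hε
  have eK : ε * (2 * K * ‖y‖) ≤ 2 * K * ‖y‖ := by
    have : 0 ≤ 2 * K * ‖y‖ := by positivity
    nlinarith
  refine ⟨m', hm', n', hn', by linarith, by linarith, ?_⟩
  have e : y - (m' + n') = (y - z) + ((m - m') + (n - n')) := by rw [← hmn]; abel
  have h1 := norm_add_le (y - z) ((m - m') + (n - n'))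
  have h2 := norm_add_le (m - m') (n - n')
  rw [e]
  nlinarith [mul_le_mul_of_nonneg_right hεK y0]

/-- uniform splitting when the limit intersection is exactly the limit of common subspaces -/
theorem split_perturb_inf {M N Y M₁ N₁ Y₁ : Submodule ℂ X} {K ε : ℝ}
    (hK : 0 < K) (hs : Split K M N) (hY : M ⊓ N = Y) (hle : Y₁ ≤ M₁ ⊓ N₁)
    (hε : 0 ≤ ε) (hε1 : ε ≤ 1) (hεK : (8 + 8 * K) * ε ≤ 1 / 2)
    (nM : Near ε M₁ M) (nN : Near ε N₁ N) (nY : Near ε Y Y₁) :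
    Split (8 * K + 1) M₁ N₁ := by
  intro w hw
  by_cases hw0 : w = 0
  · exact ⟨0, M₁.zero_mem, 0, N₁.zero_mem, by simp [hw0], by simp [hw0], by simp [hw0]⟩
  have step : ∀ m ∈ M₁, ∀ n ∈ N₁, m + n = w → ∃ m' ∈ M₁, ∃ n' ∈ N₁, m' + n' = w ∧
      ‖m'‖ + ‖n'‖ ≤ 4 * K * ‖w‖ + 1 / 2 * (‖m‖ + ‖n‖) := by
    intro m hm n hn hmn
    obtain ⟨a, ha, hda⟩ := nM m hm
    obtain ⟨b, hb, hdb⟩ := nN n hn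
    obtain ⟨c, hc, d, hd, hcd, hcb, hdb'⟩ := hs (a + b) (Submodule.add_mem_sup ha hb)
    have hy : a - c ∈ Y := by
      rw [← hY]
      refine ⟨M.sub_mem ha hc, ?_⟩
      have : a - c = d - b := by rw [sub_eq_sub_iff_add_eq_add, ← hcd, add_comm]
      rw [this]
      exact N.sub_mem hd hb
    obtain ⟨y, hyY, hdy⟩ := nY _ hy
    obtain ⟨hyM, hyN⟩ := hle hyY
    refine ⟨m - y, M₁.sub_mem hm hyM, n + y, N₁.add_mem hn hyN, by rw [← hmn]; abel, ?_⟩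
    have h1 : ‖m - y‖ ≤ ‖m - a‖ + ‖c‖ + ‖a - c - y‖ := by
      have : m - y = (m - a) + c + (a - c - y) := by abel
      rw [this]; exact norm_add₃_le
    have h2 : ‖n + y‖ ≤ ‖n - b‖ + ‖d‖ + ‖a - c - y‖ := by
      have : n + y = (n - b) + d - (a - c - y) := by
        have : d = a + b - c := by rw [← hcd]; abel
        rw [this]; abel
      rw [this]
      exact (norm_sub_le _ _).trans (add_le_add_left (norm_add_le _ _) _)
    have h3 : ‖a + b‖ ≤ ‖w‖ + ‖m - a‖ + ‖n - b‖ := by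
      have : a + b = w - (m - a) - (n - b) := by rw [← hmn]; abel
      rw [this]
      exact (norm_sub_le _ _).trans (add_le_add_left (norm_sub_le _ _) _)
    have h4 : ‖a - c‖ ≤ ‖m‖ + ‖m - a‖ + ‖c‖ := by
      have : a - c = m - (m - a) - c := by abel
      rw [this]
      exact (norm_sub_le _ _).trans (add_le_add_left (norm_sub_le _ _) _)
    set S := ‖m‖ + ‖n‖ with hS
    have m0 := norm_nonneg m
    have n0 := norm_nonneg n
    have w0 := norm_nonneg w
    have hma : ‖m - a‖ ≤ ε * S := hda.trans (mul_le_mul_of_nonneg_left (by linarith) hε)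
    have hsum : ‖m - a‖ + ‖n - b‖ ≤ ε * S := by rw [hS, mul_add]; linarith
    have hKab : K * ‖a + b‖ ≤ K * ‖w‖ + K * (ε * S) := by nlinarith
    have hS0 : 0 ≤ S := by positivity
    have hεS : ε * S ≤ S := by nlinarith
    have h5 : ‖a - c‖ ≤ 2 * S + K * ‖w‖ + K * (ε * S) := by linarith
    have h6 : ε * ‖a - c‖ ≤ ε * (2 * S) + K * ‖w‖ + K * (ε * S) := by
      have := mul_le_mul_of_nonneg_left h5 hε
      have q : 0 ≤ K * ‖w‖ + K * (ε * S) := by positivity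
      nlinarith
    have h7 : ((8 + 8 * K) * ε) * S ≤ 1 / 2 * S := mul_le_mul_of_nonneg_right hεK hS0
    have h8 : 0 ≤ ε * S := by positivity
    have h9 : 0 ≤ K * (ε * S) := by positivity
    nlinarith
  obtain ⟨m, hm, n, hn, hmn⟩ := Submodule.mem_sup.1 hw
  have iter : ∀ k : ℕ, ∃ m' ∈ M₁, ∃ n' ∈ N₁, m' + n' = w ∧
      ‖m'‖ + ‖n'‖ ≤ 8 * K * ‖w‖ + (1 / 2) ^ k * (‖m‖ + ‖n‖) := by
    intro k
    induction k with
    | zero =>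
      refine ⟨m, hm, n, hn, hmn, ?_⟩
      have : 0 ≤ 8 * K * ‖w‖ := by positivity
      simp only [pow_zero, one_mul]; linarith
    | succ k ih =>
      obtain ⟨m1, hm1, n1, hn1, e1, b1⟩ := ih
      obtain ⟨m2, hm2, n2, hn2, e2, b2⟩ := step m1 hm1 n1 hn1 e1
      refine ⟨m2, hm2, n2, hn2, e2, ?_⟩
      rw [pow_succ]
      linarith
  have hwp : 0 < ‖w‖ := norm_pos_iff.2 hw0
  obtain ⟨k, hk⟩ := exists_pow_lt_of_lt_one (show 0 < ‖w‖ / (‖m‖ + ‖n‖ + 1) by positivity)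
      (show (1 / 2 : ℝ) < 1 by norm_num)
  obtain ⟨m', hm', n', hn', e', b'⟩ := iter k
  rw [lt_div_iff₀ (by positivity)] at hk
  have hp : (0 : ℝ) < (1 / 2) ^ k := by positivity
  have : ‖m'‖ + ‖n'‖ ≤ (8 * K + 1) * ‖w‖ := by nlinarith
  exact ⟨m', hm', n', hn', e', by linarith [norm_nonneg n'], by linarith [norm_nonneg m']⟩

theorem closed_of_split [CompleteSpace X] {M N : Submodule ℂ X} (hM : IsClosed (M : Set X))
    (hN : IsClosed (N : Set X)) {K : ℝ} (hK : 0 < K) (hs : Split K M N) :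
    IsClosed ((M ⊔ N : Submodule ℂ X) : Set X) := by
  have := split_of_approx (C := 2 * K) hM hN (Y := (M ⊔ N).topologicalClosure)
    (Submodule.le_topologicalClosure _) ?_
  · rw [this.1]; exact Submodule.isClosed_topologicalClosure _
  intro y hy
  by_cases hy0 : y = 0
  · exact ⟨0, M.zero_mem, 0, N.zero_mem, by simp [hy0], by simp [hy0], by simp [hy0]⟩
  have hyp : 0 < ‖y‖ := norm_pos_iff.2 hy0
  have hy' : y ∈ closure ((M ⊔ N : Submodule ℂ X) : Set X) := hy
  obtain ⟨w, hw, hd⟩ := Metric.mem_closure_iff.1 hy' (1 / 2 * ‖y‖) (by positivity)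
  rw [dist_eq_norm] at hd
  obtain ⟨m, hm, n, hn, hmn, hmb, hnb⟩ := hs w hw
  have hwn : ‖w‖ ≤ 2 * ‖y‖ := by
    have : ‖w‖ ≤ ‖y‖ + ‖y - w‖ := by rw [norm_sub_rev]; exact norm_le_insert' w y
    linarith
  have : K * ‖w‖ ≤ 2 * K * ‖y‖ := by nlinarith
  exact ⟨m, hm, n, hn, by linarith, by linarith, by rw [hmn]; exact hd.le⟩

end near

/-! ### Convergence of families of subspaces -/

section families
variable {J : Type*} {X : Type*} [NormedAddCommGroup X] [NormedSpace ℂ X]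

/-- gap convergence along a filter -/
def GT (l : Filter J) (F : J → Submodule ℂ X) (F₀ : Submodule ℂ X) : Prop :=
  ∀ ε : ℝ, 0 < ε → ∀ᶠ s in l, Near ε (F s) F₀ ∧ Near ε F₀ (F s)

theorem GT.const (l : Filter J) (F₀ : Submodule ℂ X) : GT l (fun _ => F₀) F₀ := by
  intro ε hε
  refine Eventually.of_forall fun s => ⟨?_, ?_⟩ <;>
  exact fun u hu => ⟨u, hu, by simp only [sub_self, norm_zero]; positivity⟩

theorem GT.exists_tendsto {l : Filter J} {F : J → Submodule ℂ X} {F₀ : Submodule ℂ X}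
    (h : GT l F F₀) (hc : ∀ s, IsClosed (F s : Set X)) {f : X} (hf : f ∈ F₀) :
    ∃ g : J → X, (∀ s, g s ∈ F s) ∧ Tendsto g l (𝓝 f) := by
  have key : ∀ s, ∃ v ∈ F s, dist f v ≤ 2 * Metric.infDist f (F s : Set X) := by
    intro s
    have hne : (F s : Set X).Nonempty := ⟨0, (F s).zero_mem⟩
    rcases (Metric.infDist_nonneg (x := f) (s := (F s : Set X))).eq_or_lt with h0 | h0
    · refine ⟨f, ?_, by simp [← h0]⟩
      exact ((hc s).mem_iff_infDist_zero hne).2 h0.symm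
    · obtain ⟨v, hv, hd⟩ := (Metric.infDist_lt_iff hne).1
        (show Metric.infDist f (F s : Set X) < 2 * Metric.infDist f (F s : Set X) by linarith)
      exact ⟨v, hv, hd.le⟩
  choose g hg hd using key
  refine ⟨g, hg, ?_⟩
  rw [Metric.tendsto_nhds]
  intro ε hε
  have hp : 0 < ε / (2 * (‖f‖ + 1)) := by positivity
  filter_upwards [h _ hp] with s hs
  obtain ⟨v, hv, hdv⟩ := hs.2 f hf
  have h1 := Metric.infDist_le_dist_of_mem (x := f) (show v ∈ (F s : Set X) from hv)
  rw [dist_eq_norm] at h1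
  have h2 : ε / (2 * (‖f‖ + 1)) * ‖f‖ < ε / 2 := by
    rw [div_mul_eq_mul_div, div_lt_div_iff₀ (by positivity) (by positivity)]
    nlinarith [norm_nonneg f]
  rw [dist_comm]
  linarith [hd s]

theorem GT.span {l : Filter J} {f : X} (hf : f ≠ 0) {g : J → X} (hg : Tendsto g l (𝓝 f)) :
    GT l (fun s => Submodule.span ℂ {g s}) (Submodule.span ℂ {f}) := by
  intro ε hε
  have hfp : 0 < ‖f‖ := norm_pos_iff.2 hf
  have e1 : ∀ᶠ s in l, dist (g s) f < min (‖f‖ / 2) (ε * (‖f‖ / 2)) :=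
    Metric.tendsto_nhds.1 hg _ (by positivity)
  filter_upwards [e1] with s hs
  rw [dist_eq_norm, lt_min_iff] at hs
  obtain ⟨h1, h2⟩ := hs
  have h3 : ‖f‖ / 2 ≤ ‖g s‖ := by
    have := norm_sub_norm_le f (g s)
    rw [norm_sub_rev] at this
    linarith
  constructor
  · intro u hu
    obtain ⟨c, rfl⟩ := Submodule.mem_span_singleton.1 hu
    refine ⟨c • f, Submodule.smul_mem _ _ (Submodule.mem_span_singleton_self f), ?_⟩
    rw [← smul_sub, norm_smul, norm_smul]
    have : ‖g s - f‖ ≤ ε * ‖g s‖ := by nlinarith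
    nlinarith [mul_le_mul_of_nonneg_left this (norm_nonneg c)]
  · intro u hu
    obtain ⟨c, rfl⟩ := Submodule.mem_span_singleton.1 hu
    refine ⟨c • g s, Submodule.smul_mem _ _ (Submodule.mem_span_singleton_self _), ?_⟩
    rw [← smul_sub, norm_smul, norm_smul, norm_sub_rev]
    have : ‖g s - f‖ ≤ ε * ‖f‖ := by nlinarith
    nlinarith [mul_le_mul_of_nonneg_left this (norm_nonneg c)]

theorem GT.ker {l : Filter J} {φ : X →L[ℂ] ℂ} {f : X} (hf : φ f = 1)
    {ψ : J → X →L[ℂ] ℂ} (hψ : Tendsto ψ l (𝓝 φ)) :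
    GT l (fun s => LinearMap.ker (ψ s : X →ₗ[ℂ] ℂ)) (LinearMap.ker (φ : X →ₗ[ℂ] ℂ)) := by
  intro ε hε
  have e1 : ∀ᶠ s in l, dist (ψ s) φ < min (1 / (2 * (‖f‖ + 1))) (ε / (2 * (‖f‖ + 1))) :=
    Metric.tendsto_nhds.1 hψ _ (by positivity)
  filter_upwards [e1] with s hs
  rw [dist_eq_norm, lt_min_iff] at hs
  obtain ⟨h1, h2⟩ := hs
  rw [lt_div_iff₀ (by positivity)] at h1 h2
  have f0 := norm_nonneg f
  have d0 := norm_nonneg (ψ s - φ)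
  have hsub : ∀ u, ‖ψ s u - φ u‖ ≤ ‖ψ s - φ‖ * ‖u‖ := fun u => (ψ s - φ).le_opNorm u
  have hψf : 1 / 2 ≤ ‖ψ s f‖ := by
    have a := hsub f
    rw [hf] at a
    have b := norm_sub_norm_le (1 : ℂ) (ψ s f)
    rw [norm_sub_rev, norm_one] at b
    nlinarith
  have hψf0 : ψ s f ≠ 0 := by
    intro h; rw [h, norm_zero] at hψf; linarith
  constructor
  · intro u hu
    have hu' : ψ s u = 0 := hu
    refine ⟨u - φ u • f, ?_, ?_⟩
    · simp [LinearMap.mem_ker, hf]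
    · have a := hsub u
      rw [hu', zero_sub, norm_neg] at a
      have : u - (u - φ u • f) = φ u • f := by abel
      rw [this, norm_smul]
      have b := mul_le_mul_of_nonneg_right a f0
      have c := mul_le_mul_of_nonneg_right h2.le (norm_nonneg u)
      have := mul_nonneg (mul_nonneg d0 (norm_nonneg u)) f0
      nlinarith [mul_nonneg d0 (norm_nonneg u)]
  · intro u hu
    have hu' : φ u = 0 := hu
    refine ⟨u - (ψ s u / ψ s f) • f, ?_, ?_⟩
    · simp [LinearMap.mem_ker, hψf0]
    · have a := hsub u
      rw [hu', sub_zero] at a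
      have : u - (u - (ψ s u / ψ s f) • f) = (ψ s u / ψ s f) • f := by abel
      rw [this, norm_smul, norm_div]
      have q : ‖ψ s u‖ / ‖ψ s f‖ ≤ 2 * (‖ψ s - φ‖ * ‖u‖) := by
        rw [div_le_iff₀ (by linarith)]
        have := mul_nonneg d0 (norm_nonneg u)
        nlinarith
      have b := mul_le_mul_of_nonneg_right q f0
      have c := mul_le_mul_of_nonneg_right h2.le (norm_nonneg u)
      nlinarith [mul_nonneg d0 (norm_nonneg u)]

theorem GT.exists_functional {l : Filter J} {F : J → Submodule ℂ X} {F₀ : Submodule ℂ X}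
    (h : GT l F F₀) {φ : X →L[ℂ] ℂ} (hφ : ∀ u ∈ F₀, φ u = 0) :
    ∃ ψ : J → X →L[ℂ] ℂ, (∀ s, ∀ u ∈ F s, ψ s u = 0) ∧ Tendsto ψ l (𝓝 φ) := by
  have key : ∀ s, ∃ g : X →L[ℂ] ℂ, (∀ x : F s, g x = φ x) ∧
      ‖g‖ = ‖φ.comp (F s).subtypeL‖ := fun s =>
    exists_extension_norm_eq (F s) (φ.comp (F s).subtypeL)
  choose g hg hgn using key
  refine ⟨fun s => φ - g s, fun s u hu => ?_, ?_⟩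
  · have := hg s ⟨u, hu⟩
    simp [this]
  · have : Tendsto g l (𝓝 0) := by
      rw [Metric.tendsto_nhds]
      intro ε hε
      have hp : 0 < ε / (2 * (‖φ‖ + 1)) := by positivity
      filter_upwards [h _ hp] with s hs
      rw [dist_zero_right, hgn]
      refine lt_of_le_of_lt (ContinuousLinearMap.opNorm_le_bound _ (half_pos hε).le ?_)
        (half_lt_self hε)
      rintro ⟨u, hu⟩
      obtain ⟨v, hv, hd⟩ := hs.1 u hu
      have e : φ u = φ (u - v) := by rw [map_sub, hφ v hv, sub_zero]
      change ‖φ u‖ ≤ ε / 2 * ‖u‖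
      rw [e]
      refine (φ.le_opNorm _).trans ?_
      have a := mul_le_mul_of_nonneg_left hd (norm_nonneg φ)
      have b : ‖φ‖ * (ε / (2 * (‖φ‖ + 1))) ≤ ε / 2 := by
        rw [mul_div_assoc', div_le_div_iff₀ (by positivity) (by positivity)]
        nlinarith [norm_nonneg φ]
      have c := mul_le_mul_of_nonneg_right b (norm_nonneg u)
      linarith
    simpa using tendsto_const_nhds.sub this

/-- intersections converge if the sums are the given convergent family -/
theorem GT.inf [CompleteSpace X] {l : Filter J} {M N Y : J → Submodule ℂ X}
    {M₀ N₀ Y₀ : Submodule ℂ X} (hM : GT l M M₀) (hN : GT l N N₀) (hY : GT l Y Y₀)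
    (cM : ∀ s, IsClosed (M s : Set X)) (cN : ∀ s, IsClosed (N s : Set X))
    (cM₀ : IsClosed (M₀ : Set X)) (cN₀ : IsClosed (N₀ : Set X)) (cY₀ : IsClosed (Y₀ : Set X))
    (hle : ∀ s, M s ⊔ N s ≤ Y s) (heq : M₀ ⊔ N₀ = Y₀) :
    (∀ᶠ s in l, M s ⊔ N s = Y s) ∧ GT l (fun s => M s ⊓ N s) (M₀ ⊓ N₀) := by
  obtain ⟨K, hK, hs⟩ := split_of_closed cM₀ cN₀ (heq ▸ cY₀)
  have main : ∀ ε : ℝ, 0 < ε → ∀ᶠ s in l, M s ⊔ N s = Y s ∧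
      Near ε (M s ⊓ N s) (M₀ ⊓ N₀) ∧ Near ε (M₀ ⊓ N₀) (M s ⊓ N s) := by
    intro ε hε
    set η := min 1 (min (1 / (2 * (1 + 4 * K))) (ε / (1 + 16 * K))) with hη
    have hηp : 0 < η := by positivity
    have h1 : η ≤ 1 := min_le_left _ _
    have h2 : η ≤ 1 / (2 * (1 + 4 * K)) := (min_le_right _ _).trans (min_le_left _ _)
    have h3 : η ≤ ε / (1 + 16 * K) := (min_le_right _ _).trans (min_le_right _ _)
    rw [le_div_iff₀ (by positivity)] at h2 h3
    filter_upwards [hM η hηp, hN η hηp, hY η hηp] with s a b c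
    obtain ⟨e, sp⟩ := split_perturb_sup hK hs heq (cM s) (cN s) (hle s) hηp.le h1
      (by linarith) a.2 b.2 c.1
    refine ⟨e, (near_inf hK.le hs a.1 b.1).mono ?_, (near_inf (by positivity) sp a.2 b.2).mono ?_⟩
    · nlinarith
    · nlinarith
  refine ⟨(main 1 one_pos).mono fun s h => h.1, fun ε hε => (main ε hε).mono fun s h => h.2⟩

/-- sums converge if the intersections are the given convergent family -/
theorem GT.sup [CompleteSpace X] {l : Filter J} {M N Y : J → Submodule ℂ X}
    {M₀ N₀ Y₀ : Submodule ℂ X} (hM : GT l M M₀) (hN : GT l N N₀) (hY : GT l Y Y₀)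
    (cM : ∀ᶠ s in l, IsClosed (M s : Set X)) (cN : ∀ᶠ s in l, IsClosed (N s : Set X))
    (cY : ∀ s, IsClosed (Y s : Set X))
    (cM₀ : IsClosed (M₀ : Set X)) (cN₀ : IsClosed (N₀ : Set X))
    (cMN₀ : IsClosed ((M₀ ⊔ N₀ : Submodule ℂ X) : Set X))
    (hle : ∀ s, Y s ≤ M s ⊓ N s) (heq : M₀ ⊓ N₀ = Y₀) :
    (∀ᶠ s in l, M s ⊓ N s = Y s ∧ IsClosed ((M s ⊔ N s : Submodule ℂ X) : Set X)) ∧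
      GT l (fun s => M s ⊔ N s) (M₀ ⊔ N₀) := by
  obtain ⟨K, hK, hs⟩ := split_of_closed cM₀ cN₀ cMN₀
  have main : ∀ ε : ℝ, 0 < ε → ∀ᶠ s in l,
      (M s ⊓ N s = Y s ∧ IsClosed ((M s ⊔ N s : Submodule ℂ X) : Set X)) ∧
      Near ε (M s ⊔ N s) (M₀ ⊔ N₀) ∧ Near ε (M₀ ⊔ N₀) (M s ⊔ N s) := by
    intro ε hε
    set η := min 1 (min (1 / (2 * (8 + 8 * K))) (ε / (2 * (8 * K + 1)))) with hη
    have hηp : 0 < η := by positivity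
    have h1 : η ≤ 1 := min_le_left _ _
    have h2 : η ≤ 1 / (2 * (8 + 8 * K)) := (min_le_right _ _).trans (min_le_left _ _)
    have h3 : η ≤ ε / (2 * (8 * K + 1)) := (min_le_right _ _).trans (min_le_right _ _)
    rw [le_div_iff₀ (by positivity)] at h2 h3
    filter_upwards [hM η hηp, hN η hηp, hY η hηp, cM, cN] with s a b c cM' cN'
    have sp := split_perturb_inf hK hs heq (hle s) hηp.le h1 (by linarith) a.1 b.1 c.2
    refine ⟨⟨?_, closed_of_split cM' cN' (by positivity) sp⟩,
      (near_sup hηp.le sp a.1 b.1).mono ?_, (near_sup hηp.le hs a.2 b.2).mono ?_⟩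
    · refine eq_of_near (cY s) (hle s) ?_
      have n1 := near_inf hK.le hs a.1 b.1
      rw [heq] at n1
      refine (n1.trans hηp.le c.2).mono ?_
      have q : (1 + 2 * K) * η ≤ 1 := by nlinarith
      nlinarith
    · nlinarith
    · nlinarith
  refine ⟨(main 1 one_pos).mono fun s h => h.1, fun ε hε => (main ε hε).mono fun s h => h.2⟩

/-- adding a vector -/
theorem GT.add_vector [CompleteSpace X] {l : Filter J} {N : J → Submodule ℂ X}
    {N₀ : Submodule ℂ X} (hN : GT l N N₀) (cN : ∀ᶠ s in l, IsClosed (N s : Set X))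
    (cN₀ : IsClosed (N₀ : Set X)) {f : X} (hf : f ∉ N₀) {g : J → X} (hg : Tendsto g l (𝓝 f)) :
    (∀ᶠ s in l, g s ∉ N s) ∧
    GT l (fun s => N s ⊔ Submodule.span ℂ {g s}) (N₀ ⊔ Submodule.span ℂ {f}) := by
  have hf0 : f ≠ 0 := fun h => hf (h ▸ N₀.zero_mem)
  have inf0 : N₀ ⊓ Submodule.span ℂ {f} = ⊥ := by
    rw [eq_bot_iff]
    rintro x ⟨hxA, hx⟩
    obtain ⟨c, rfl⟩ := Submodule.mem_span_singleton.1 hx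
    by_cases hc : c = 0
    · simp [hc]
    · exact absurd ((N₀.smul_mem_iff hc).1 hxA) hf
  have := GT.sup hN (GT.span hf0 hg) (GT.const l (⊥ : Submodule ℂ X)) cN
    (Eventually.of_forall fun s => Submodule.closed_of_finiteDimensional _)
    (fun s => Submodule.closed_of_finiteDimensional _) cN₀
    (Submodule.closed_of_finiteDimensional _)
    (Submodule.isClosed_sup_finiteDimensional _ _ cN₀)
    (fun s => bot_le) inf0
  refine ⟨?_, this.2⟩
  filter_upwards [this.1, hg.eventually_ne hf0] with s hs hne hmem
  have : g s ∈ N s ⊓ Submodule.span ℂ {g s} := ⟨hmem, Submodule.mem_span_singleton_self _⟩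
  rw [hs.1] at this
  exact hne ((Submodule.mem_bot ℂ).1 this)

end families

section dims
variable {J : Type*} {X : Type*} [NormedAddCommGroup X] [NormedSpace ℂ X]

theorem quotFin_of_near {Y Z Y₁ Z₁ : Submodule ℂ X} (hYZ : Y ≤ Z) (cY : IsClosed (Y : Set X))
    (cY₁ : IsClosed (Y₁ : Set X)) (hZ : Near (1 / 100) Z Z₁) (hY : Near (1 / 100) Y₁ Y)
    (hfin : QuotFin Y₁ Z₁) : QuotFin Y Z := by
  by_contra hinf
  have i1 : IsClosed ((Y.comap Z.subtype : Submodule ℂ Z) : Set Z) :=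
    cY.preimage continuous_subtype_val
  have i2 : IsClosed ((Y₁.comap Z₁.subtype : Submodule ℂ Z₁) : Set Z₁) :=
    cY₁.preimage continuous_subtype_val
  have i3 : FiniteDimensional ℂ (↥Z₁ ⧸ Y₁.comap Z₁.subtype) := hfin
  have i4 : ProperSpace (↥Z₁ ⧸ Y₁.comap Z₁.subtype) := FiniteDimensional.proper ℂ _
  obtain ⟨x, hxb, hxs⟩ := exists_seq_norm_le_one_le_norm_sub' (𝕜 := ℂ)
    (E := ↥Z ⧸ Y.comap Z.subtype) (c := 2) (by simp) (R := 3) (by norm_num) hinf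
  have hl : ∀ n, ∃ z : Z, Submodule.Quotient.mk z = x n ∧ ‖z‖ < ‖x n‖ + 1 := fun n =>
    Submodule.Quotient.norm_mk_lt (x n) one_pos
  choose z hz hzb using hl
  have hz4 : ∀ n, ‖(z n : X)‖ ≤ 4 := fun n => by
    have a := hzb n
    have b := hxb n
    rw [Submodule.coe_norm] at a
    linarith
  have hw : ∀ n, ∃ w : Z₁, ‖(z n : X) - w‖ ≤ 1 / 25 := fun n => by
    obtain ⟨w, hw, hd⟩ := hZ (z n) (z n).2
    exact ⟨⟨w, hw⟩, hd.trans (by linarith [hz4 n])⟩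
  choose w hw using hw
  have hw5 : ∀ n, ‖(w n : X)‖ ≤ 5 := fun n => by
    have := norm_le_insert' (w n : X) (z n : X)
    rw [norm_sub_rev] at this
    linarith [hw n, hz4 n]
  have hmem : ∀ n, (Submodule.Quotient.mk (w n) : ↥Z₁ ⧸ Y₁.comap Z₁.subtype) ∈
      Metric.closedBall (0 : ↥Z₁ ⧸ Y₁.comap Z₁.subtype) 5 := fun n => by
    rw [mem_closedBall_zero_iff]
    exact (Submodule.Quotient.norm_mk_le _ _).trans (hw5 n)
  obtain ⟨a, -, σ, hσ, hlim⟩ := (isCompact_closedBall _ _).tendsto_subseq hmem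
  obtain ⟨n, hn⟩ := Metric.cauchySeq_iff'.1 hlim.cauchySeq (1 / 4) (by norm_num)
  have h1 := hn (n + 1) (Nat.le_succ n)
  have hne : σ (n + 1) ≠ σ n := (hσ (Nat.lt_succ_self n)).ne'
  set i := σ (n + 1)
  set j := σ n
  rw [dist_eq_norm] at h1
  simp only [Function.comp_apply] at h1
  change ‖(Submodule.Quotient.mk (w i) - Submodule.Quotient.mk (w j) :
    ↥Z₁ ⧸ Y₁.comap Z₁.subtype)‖ < 1 / 4 at h1
  rw [← Submodule.Quotient.mk_sub] at h1
  obtain ⟨t, ht, htb⟩ := Submodule.Quotient.norm_mk_lt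
    (Submodule.Quotient.mk (w i - w j) : ↥Z₁ ⧸ Y₁.comap Z₁.subtype)
    (ε := 1 / 4) (by norm_num)
  have hty : ((w i - w j - t : Z₁) : X) ∈ Y₁ := by
    have := (Submodule.Quotient.eq _).1 ht.symm
    exact this
  have htn : ‖(t : X)‖ ≤ 1 / 2 := by
    rw [Submodule.coe_norm] at htb
    linarith
  set y₁ : X := ((w i - w j - t : Z₁) : X) with hy₁
  have hy₁e : y₁ = (w i : X) - w j - t := by simp [hy₁]
  obtain ⟨y, hy, hyd⟩ := hY y₁ hty
  have hy₁b : ‖y₁‖ ≤ 11 := by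
    rw [hy₁e]
    have a := norm_sub_le ((w i : X) - w j) t
    have b := norm_sub_le (w i : X) (w j)
    linarith [hw5 i, hw5 j]
  have hbig : 1 ≤ ‖x i - x j‖ := hxs hne
  have hfin' : ‖(z i : X) - z j - y‖ < 1 := by
    have e : (z i : X) - z j - y = ((z i : X) - w i) - ((z j : X) - w j) + t + (y₁ - y) := by
      rw [hy₁e]; abel
    rw [e]
    have a := norm_add_le (((z i : X) - w i) - ((z j : X) - w j) + t) (y₁ - y)
    have b := norm_add_le (((z i : X) - w i) - ((z j : X) - w j)) (t : X)
    have c := norm_sub_le ((z i : X) - w i) ((z j : X) - w j)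
    linarith [hw i, hw j]
  have hq : x i - x j = Submodule.Quotient.mk (z i - z j - ⟨y, hYZ hy⟩) := by
    rw [← hz i, ← hz j, ← Submodule.Quotient.mk_sub, Submodule.Quotient.eq]
    simpa using hy
  rw [hq] at hbig
  have := hbig.trans (Submodule.Quotient.norm_mk_le _ _)
  rw [Submodule.coe_norm] at this
  simp only [Submodule.coe_sub] at this
  linarith

theorem ENat_add_right_cancel {a b : ℕ∞} (h : a + 1 = b + 1) : a = b :=
  WithTop.add_right_cancel ENat.one_ne_top h

theorem ENat_add_left_cancel {a b : ℕ∞} (h : 1 + a = 1 + b) : a = b :=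
  WithTop.add_left_cancel ENat.one_ne_top h

theorem exists_notMem_of_edim {A B : Submodule ℂ X} (h : edim A B ≠ 0) : ∃ f ∈ B, f ∉ A := by
  by_contra hc
  push Not at hc
  apply h
  unfold edim quotRank
  rw [Cardinal.toENat_eq_zero, rank_zero_iff, Submodule.Quotient.subsingleton_iff,
    Submodule.comap_subtype_eq_top]
  exact hc

theorem isClosed_add_vector {N : Submodule ℂ X} (h : IsClosed (N : Set X)) (f : X) :
    IsClosed ((N ⊔ Submodule.span ℂ {f} : Submodule ℂ X) : Set X) :=
  Submodule.isClosed_sup_finiteDimensional _ _ h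

theorem span_le_of_mem {f : X} {A : Submodule ℂ X} (h : f ∈ A) : Submodule.span ℂ {f} ≤ A :=
  (Submodule.span_singleton_le_iff_mem f A).2 h

theorem edim_eventually_fin [CompleteSpace X] {l : Filter J} {Z : J → Submodule ℂ X}
    {Z₀ : Submodule ℂ X} (hZ : GT l Z Z₀) (cZ : ∀ s, IsClosed (Z s : Set X)) (n : ℕ) :
    ∀ (Y : J → Submodule ℂ X) (Y₀ : Submodule ℂ X), GT l Y Y₀ →
    (∀ᶠ s in l, IsClosed (Y s : Set X)) → IsClosed (Y₀ : Set X) →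
    (∀ s, Y s ≤ Z s) → Y₀ ≤ Z₀ → edim Y₀ Z₀ = n → ∀ᶠ s in l, edim (Y s) (Z s) = n := by
  induction n with
  | zero =>
    intro Y Y₀ hY cY cY₀ hle hle₀ hd
    have e := eq_of_edim_zero hle₀ (by simpa using hd)
    filter_upwards [hY (1 / 10) (by norm_num), hZ (1 / 10) (by norm_num), cY] with s a b c
    have n1 := b.1
    rw [← e] at n1
    have := eq_of_near c (hle s) ((n1.trans (by norm_num) a.2).mono (by norm_num))
    rw [this, edim_self]; simp
  | succ n ih =>
    intro Y Y₀ hY cY cY₀ hle hle₀ hd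
    obtain ⟨f, hfZ, hfY⟩ := exists_notMem_of_edim (A := Y₀) (B := Z₀) (by rw [hd]; simp)
    obtain ⟨g, hgZ, hg⟩ := hZ.exists_tendsto cZ hfZ
    obtain ⟨h1, h2⟩ := hY.add_vector cY cY₀ hfY hg
    have hd' : edim (Y₀ ⊔ Submodule.span ℂ {f}) Z₀ = n := by
      have := edim_add (A := Y₀) (B := Y₀ ⊔ Submodule.span ℂ {f}) (C := Z₀) le_sup_left
        (sup_le hle₀ (span_le_of_mem hfZ))
      rw [edim_span hfY, hd, Nat.cast_add, Nat.cast_one, add_comm] at this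
      exact (ENat_add_left_cancel this).symm
    have := ih _ _ h2 (cY.mono fun s hs => isClosed_add_vector hs _)
      (isClosed_add_vector cY₀ f) (fun s => sup_le (hle s) (span_le_of_mem (hgZ s)))
      (sup_le hle₀ (span_le_of_mem hfZ)) hd'
    filter_upwards [this, h1] with s a b
    rw [edim_add (A := Y s) (B := Y s ⊔ Submodule.span ℂ {g s}) (C := Z s) le_sup_left
        (sup_le (hle s) (span_le_of_mem (hgZ s))), a, edim_span b, add_comm]
    simp

theorem edim_eventually [CompleteSpace X] {l : Filter J} {Y Z : J → Submodule ℂ X}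
    {Y₀ Z₀ : Submodule ℂ X} (hY : GT l Y Y₀) (hZ : GT l Z Z₀)
    (cY : ∀ᶠ s in l, IsClosed (Y s : Set X)) (cZ : ∀ s, IsClosed (Z s : Set X))
    (cY₀ : IsClosed (Y₀ : Set X)) (hle : ∀ s, Y s ≤ Z s) (hle₀ : Y₀ ≤ Z₀) :
    ∀ᶠ s in l, edim (Y s) (Z s) = edim Y₀ Z₀ := by
  rcases eq_or_ne (edim Y₀ Z₀) ⊤ with h | h
  · filter_upwards [hY (1 / 100) (by norm_num), hZ (1 / 100) (by norm_num), cY] with s a b c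
    rw [h]
    by_contra hne
    have hf := (edim_lt_top_iff _ _).1 (lt_top_iff_ne_top.2 hne)
    have := quotFin_of_near hle₀ cY₀ c b.2 a.1 hf
    rw [← edim_lt_top_iff, h] at this
    exact lt_irrefl _ this
  · obtain ⟨n, hn⟩ := ENat.ne_top_iff_exists.1 h
    rw [← hn]
    exact edim_eventually_fin hZ cZ n Y Y₀ hY cY cY₀ hle hle₀ hn.symm

theorem caseA [CompleteSpace X] {l : Filter J} {Y₁ M Y₂ : J → Submodule ℂ X}
    {Y₁₀ M₀ Y₂₀ : Submodule ℂ X} (hY₁ : GT l Y₁ Y₁₀) (hM : GT l M M₀) (hY₂ : GT l Y₂ Y₂₀)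
    (cY₁ : ∀ s, IsClosed (Y₁ s : Set X)) (cM : ∀ s, IsClosed (M s : Set X))
    (cY₂ : ∀ s, IsClosed (Y₂ s : Set X))
    (cY₁₀ : IsClosed (Y₁₀ : Set X)) (cM₀ : IsClosed (M₀ : Set X))
    (cY₂₀ : IsClosed (Y₂₀ : Set X)) (n : ℕ) :
    ∀ (N : J → Submodule ℂ X) (N₀ : Submodule ℂ X), GT l N N₀ →
    (∀ s, IsClosed (N s : Set X)) → IsClosed (N₀ : Set X) →
    (∀ s, Y₁ s ≤ M s ⊓ N s) → (∀ s, M s ⊔ N s ≤ Y₂ s) → Y₁₀ ≤ M₀ ⊓ N₀ → M₀ ⊔ N₀ ≤ Y₂₀ →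
    edim (M₀ ⊔ N₀) Y₂₀ = n →
    ∀ᶠ s in l, edim (M s ⊔ N s) (Y₂ s) < ⊤ ∧
      edim (Y₁ s) (M s ⊓ N s) + n = edim Y₁₀ (M₀ ⊓ N₀) + edim (M s ⊔ N s) (Y₂ s) := by
  induction n with
  | zero =>
    intro N N₀ hN cN cN₀ h1 h2 h1₀ h2₀ hd
    have e := eq_of_edim_zero h2₀ (by simpa using hd)
    obtain ⟨r1, r2⟩ := GT.inf hM hN hY₂ cM cN cM₀ cN₀ cY₂₀ h2 e
    have r3 := edim_eventually hY₁ r2 (Eventually.of_forall cY₁)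
      (fun s => (cM s).inter (cN s)) cY₁₀ h1 h1₀
    filter_upwards [r1, r3] with s a b
    rw [a, b, edim_self]
    simp
  | succ n ih =>
    intro N N₀ hN cN cN₀ h1 h2 h1₀ h2₀ hd
    obtain ⟨f, hfY, hfMN⟩ := exists_notMem_of_edim (A := M₀ ⊔ N₀) (B := Y₂₀) (by rw [hd]; simp)
    have hfN : f ∉ N₀ := fun h => hfMN (Submodule.mem_sup_right h)
    obtain ⟨g, hgY, hg⟩ := hY₂.exists_tendsto cY₂ hfY
    obtain ⟨k1, k2⟩ := hN.add_vector (Eventually.of_forall cN) cN₀ hfN hg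
    have le₀ : M₀ ⊔ (N₀ ⊔ Submodule.span ℂ {f}) ≤ Y₂₀ := by
      rw [← sup_assoc]; exact sup_le h2₀ (span_le_of_mem hfY)
    have les : ∀ s, M s ⊔ (N s ⊔ Submodule.span ℂ {g s}) ≤ Y₂ s := fun s => by
      rw [← sup_assoc]; exact sup_le (h2 s) (span_le_of_mem (hgY s))
    have y₀ : edim (M₀ ⊔ N₀) (M₀ ⊔ (N₀ ⊔ Submodule.span ℂ {f})) = 1 := by
      rw [← sup_assoc]; exact edim_span hfMN
    have x₀ : edim (M₀ ⊓ N₀) (M₀ ⊓ (N₀ ⊔ Submodule.span ℂ {f})) = 0 := by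
      have := edim_change (M := M₀) (le_sup_left (a := N₀) (b := Submodule.span ℂ {f}))
      rw [y₀, edim_span hfN] at this
      exact ENat_add_right_cancel (this.trans (zero_add 1).symm)
    have hd' : edim (M₀ ⊔ (N₀ ⊔ Submodule.span ℂ {f})) Y₂₀ = n := by
      have := edim_add (sup_le_sup_left (le_sup_left (a := N₀) (b := Submodule.span ℂ {f})) M₀) le₀
      rw [y₀, hd, Nat.cast_add, Nat.cast_one, add_comm] at this
      exact (ENat_add_left_cancel this).symm
    have := ih _ _ k2 (fun s => isClosed_add_vector (cN s) _) (isClosed_add_vector cN₀ f)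
      (fun s => (h1 s).trans (inf_le_inf_left _ le_sup_left)) les
      (h1₀.trans (inf_le_inf_left _ le_sup_left)) le₀ hd'
    have ha₀ := edim_add h1₀ (inf_le_inf_left M₀ (le_sup_left (a := N₀) (b := Submodule.span ℂ {f})))
    rw [x₀, add_zero] at ha₀
    filter_upwards [this, k1] with s a b
    obtain ⟨a1, a2⟩ := a
    have ch := edim_change (M := M s) (le_sup_left (a := N s) (b := Submodule.span ℂ {g s}))
    rw [edim_span b] at ch
    have ea := edim_add (h1 s)
      (inf_le_inf_left (M s) (le_sup_left (a := N s) (b := Submodule.span ℂ {g s})))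
    have ed := edim_add
      (sup_le_sup_left (le_sup_left (a := N s) (b := Submodule.span ℂ {g s})) (M s)) (les s)
    rw [ea, ha₀] at a2
    rw [ed]
    constructor
    · have hb : edim (M s ⊔ N s) (M s ⊔ (N s ⊔ Submodule.span ℂ {g s})) ≤ 1 :=
        le_add_self.trans ch.le
      exact WithTop.add_lt_top.2 ⟨lt_of_le_of_lt hb (ENat.natCast_lt_top 1), a1⟩
    · rw [Nat.cast_add, Nat.cast_one, ← ch]
      rw [add_left_comm (edim Y₁₀ (M₀ ⊓ N₀)), ← a2]
      ring

theorem exists_functional {Y : Submodule ℂ X} (cY : IsClosed (Y : Set X)) {f : X} (hf : f ∉ Y) :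
    ∃ φ : X →L[ℂ] ℂ, (∀ u ∈ Y, φ u = 0) ∧ φ f = 1 := by
  have i1 : IsClosed (Y : Set X) := cY
  have hne : (Submodule.Quotient.mk f : X ⧸ Y) ≠ 0 := by
    rwa [Ne, Submodule.Quotient.mk_eq_zero]
  obtain ⟨ξ, hξ⟩ := SeparatingDual.exists_eq_one (R := ℂ) hne
  refine ⟨ξ.comp Y.mkQL, fun u hu => ?_, hξ⟩
  have : Y.mkQL u = 0 := (Submodule.Quotient.mk_eq_zero Y).2 hu
  simp [this]

theorem edim_ker {φ : X →L[ℂ] ℂ} {f : X} (hf : φ f ≠ 0) :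
    LinearMap.ker (φ : X →ₗ[ℂ] ℂ) ⊔ Submodule.span ℂ {f} = ⊤ ∧
    edim (LinearMap.ker (φ : X →ₗ[ℂ] ℂ)) ⊤ = 1 := by
  have e : LinearMap.ker (φ : X →ₗ[ℂ] ℂ) ⊔ Submodule.span ℂ {f} = ⊤ := by
    rw [eq_top_iff]
    intro x _
    have : x = (x - (φ x / φ f) • f) + (φ x / φ f) • f := by abel
    rw [this]
    refine Submodule.add_mem_sup ?_ (Submodule.smul_mem _ _ (Submodule.mem_span_singleton_self f))
    simp [LinearMap.mem_ker, hf]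
  refine ⟨e, ?_⟩
  rw [← e]
  exact edim_span (fun h => hf h)

theorem edim_inf_ker {φ : X →L[ℂ] ℂ} {f : X} (hf : φ f ≠ 0) {N : Submodule ℂ X}
    (h : N ⊔ LinearMap.ker (φ : X →ₗ[ℂ] ℂ) = ⊤) :
    edim (N ⊓ LinearMap.ker (φ : X →ₗ[ℂ] ℂ)) N = 1 := by
  rw [edim_sup, h]
  exact (edim_ker hf).2

theorem caseB [CompleteSpace X] {l : Filter J} {Y₁ M Y₂ : J → Submodule ℂ X}
    {Y₁₀ M₀ Y₂₀ : Submodule ℂ X} (hY₁ : GT l Y₁ Y₁₀) (hM : GT l M M₀) (hY₂ : GT l Y₂ Y₂₀)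
    (cY₁ : ∀ s, IsClosed (Y₁ s : Set X)) (cM : ∀ s, IsClosed (M s : Set X))
    (cY₂ : ∀ s, IsClosed (Y₂ s : Set X))
    (cY₁₀ : IsClosed (Y₁₀ : Set X)) (cM₀ : IsClosed (M₀ : Set X)) (n : ℕ) :
    ∀ (N : J → Submodule ℂ X) (N₀ : Submodule ℂ X), GT l N N₀ →
    (∀ s, IsClosed (N s : Set X)) → IsClosed (N₀ : Set X) →
    IsClosed ((M₀ ⊔ N₀ : Submodule ℂ X) : Set X) →
    (∀ s, Y₁ s ≤ M s ⊓ N s) → (∀ s, M s ⊔ N s ≤ Y₂ s) → Y₁₀ ≤ M₀ ⊓ N₀ → M₀ ⊔ N₀ ≤ Y₂₀ →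
    edim Y₁₀ (M₀ ⊓ N₀) = n →
    ∀ᶠ s in l, edim (Y₁ s) (M s ⊓ N s) < ⊤ ∧
      edim (Y₁ s) (M s ⊓ N s) + edim (M₀ ⊔ N₀) Y₂₀ = n + edim (M s ⊔ N s) (Y₂ s) := by
  induction n with
  | zero =>
    intro N N₀ hN cN cN₀ cMN₀ h1 h2 h1₀ h2₀ hd
    have e := eq_of_edim_zero h1₀ (by simpa using hd)
    obtain ⟨r1, r2⟩ := GT.sup hM hN hY₁ (Eventually.of_forall cM) (Eventually.of_forall cN)
      cY₁ cM₀ cN₀ cMN₀ h1 e.symm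
    have r3 := edim_eventually r2 hY₂ (r1.mono fun s h => h.2) cY₂ cMN₀ h2 h2₀
    filter_upwards [r1, r3] with s a b
    rw [a.1, b, edim_self]
    simp
  | succ n ih =>
    intro N N₀ hN cN cN₀ cMN₀ h1 h2 h1₀ h2₀ hd
    obtain ⟨f, ⟨hfM, hfN⟩, hfY⟩ := exists_notMem_of_edim (A := Y₁₀) (B := M₀ ⊓ N₀)
      (by rw [hd]; simp)
    obtain ⟨φ, hφY, hφf⟩ := exists_functional cY₁₀ hfY
    obtain ⟨ψ, hψY, hψ⟩ := hY₁.exists_functional hφY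
    have hφf0 : φ f ≠ 0 := by rw [hφf]; exact one_ne_zero
    have cker : ∀ χ : X →L[ℂ] ℂ, IsClosed ((LinearMap.ker (χ : X →ₗ[ℂ] ℂ)) : Set X) :=
      fun χ => χ.isClosed_ker
    have top₀ : N₀ ⊔ LinearMap.ker (φ : X →ₗ[ℂ] ℂ) = ⊤ := by
      rw [eq_top_iff, ← (edim_ker hφf0).1, sup_comm]
      exact sup_le_sup_right (span_le_of_mem hfN) _
    obtain ⟨k1, k2⟩ := GT.inf hN (GT.ker hφf hψ) (GT.const l (⊤ : Submodule ℂ X)) cN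
      (fun s => cker _) cN₀ (cker _) isClosed_univ (fun s => le_top) top₀
    have hψf : ∀ᶠ s in l, ψ s f ≠ 0 := by
      have : Tendsto (fun s => ψ s f) l (𝓝 (φ f)) :=
        ((ContinuousLinearMap.apply ℂ ℂ f).continuous.tendsto φ).comp hψ
      exact this.eventually_ne hφf0
    have sup₀ : M₀ ⊔ (N₀ ⊓ LinearMap.ker (φ : X →ₗ[ℂ] ℂ)) = M₀ ⊔ N₀ := by
      refine le_antisymm (sup_le_sup_left inf_le_left _) (sup_le le_sup_left ?_)
      intro x hx
      have : x = φ x • f + (x - φ x • f) := by abel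
      rw [this]
      refine Submodule.add_mem_sup (M₀.smul_mem _ hfM)
        ⟨N₀.sub_mem hx (N₀.smul_mem _ hfN), ?_⟩
      simp [hφf]
    have x₀ : edim (M₀ ⊓ (N₀ ⊓ LinearMap.ker (φ : X →ₗ[ℂ] ℂ))) (M₀ ⊓ N₀) = 1 := by
      have := edim_change (M := M₀) (N := N₀ ⊓ LinearMap.ker (φ : X →ₗ[ℂ] ℂ)) (N₁ := N₀) inf_le_left
      rw [sup₀, edim_self, add_zero, edim_inf_ker hφf0 top₀] at this
      exact this
    have le₀ : Y₁₀ ≤ M₀ ⊓ (N₀ ⊓ LinearMap.ker (φ : X →ₗ[ℂ] ℂ)) :=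
      le_inf (h1₀.trans inf_le_left) (le_inf (h1₀.trans inf_le_right) hφY)
    have les : ∀ s, Y₁ s ≤ M s ⊓ (N s ⊓ LinearMap.ker (ψ s : X →ₗ[ℂ] ℂ)) := fun s =>
      le_inf ((h1 s).trans inf_le_left) (le_inf ((h1 s).trans inf_le_right) (hψY s))
    have hd' : edim Y₁₀ (M₀ ⊓ (N₀ ⊓ LinearMap.ker (φ : X →ₗ[ℂ] ℂ))) = n := by
      have := edim_add le₀ (inf_le_inf_left M₀ (inf_le_left (a := N₀)))
      rw [x₀, hd, Nat.cast_add, Nat.cast_one] at this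
      exact (ENat_add_right_cancel this).symm
    have := ih _ _ k2 (fun s => (cN s).inter (cker _)) (cN₀.inter (cker _)) (sup₀ ▸ cMN₀) les
      (fun s => (sup_le_sup_left inf_le_left _).trans (h2 s)) le₀ (sup₀ ▸ h2₀) hd'
    filter_upwards [this, k1, hψf] with s a b c
    obtain ⟨a1, a2⟩ := a
    have ch := edim_change (M := M s) (N := N s ⊓ LinearMap.ker (ψ s : X →ₗ[ℂ] ℂ)) (N₁ := N s)
      inf_le_left
    rw [edim_inf_ker c b] at ch
    have ea := edim_add (les s) (inf_le_inf_left (M s) (inf_le_left (a := N s)))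
    have ed := edim_add
      (sup_le_sup_left (inf_le_left (a := N s) (b := LinearMap.ker (ψ s : X →ₗ[ℂ] ℂ))) (M s)) (h2 s)
    rw [sup₀, ed] at a2
    rw [ea]
    constructor
    · have hb : edim (M s ⊓ (N s ⊓ LinearMap.ker (ψ s : X →ₗ[ℂ] ℂ))) (M s ⊓ N s) ≤ 1 :=
        le_self_add.trans ch.le
      exact WithTop.add_lt_top.2 ⟨a1, lt_of_le_of_lt hb (ENat.natCast_lt_top 1)⟩
    · rw [Nat.cast_add, Nat.cast_one, ← ch, add_right_comm, a2]
      ring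

end dims

theorem ereal_sub_eq {a d a' d' : ℕ∞} (h : (d < ⊤ ∧ d' < ⊤) ∨ (a < ⊤ ∧ a' < ⊤))
    (e : a' + d = a + d') :
    ((a' : ENNReal) : EReal) - ((d' : ENNReal) : EReal)
      = ((a : ENNReal) : EReal) - ((d : ENNReal) : EReal) := by
  have cast : ∀ n : ℕ, ((((n : ℕ∞) : ENNReal)) : EReal) = ((n : ℝ) : EReal) := fun n => by
    rw [ENat.toENNReal_coe, ← ENNReal.ofReal_natCast, EReal.coe_ennreal_ofReal,
      max_eq_left (Nat.cast_nonneg _)]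
  rcases h with ⟨h1, h2⟩ | ⟨h1, h2⟩
  · obtain ⟨d, rfl⟩ := ENat.ne_top_iff_exists.1 h1.ne
    obtain ⟨d', rfl⟩ := ENat.ne_top_iff_exists.1 h2.ne
    induction a using ENat.recTopCoe with
    | top =>
      have ha : a' = ⊤ := by
        rw [top_add] at e
        by_contra hne
        exact (WithTop.add_lt_top.2 ⟨lt_top_iff_ne_top.2 hne, h1⟩).ne e
      rw [ha, cast, cast, ENat.toENNReal_top, EReal.coe_ennreal_top, EReal.top_sub_coe,
        EReal.top_sub_coe]
    | coe a =>
      have ha : a' ≠ ⊤ := by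
        rintro rfl
        rw [top_add] at e
        exact (ENat.natCast_ne_top (a + d')) (by rw [e]; push_cast; rfl)
      obtain ⟨a', rfl⟩ := ENat.ne_top_iff_exists.1 ha
      have e' : a' + d = a + d' := by exact_mod_cast e
      have e'' : (a' : ℝ) + d = a + d' := by exact_mod_cast e'
      rw [cast, cast, cast, cast, ← EReal.coe_sub, ← EReal.coe_sub, EReal.coe_eq_coe_iff]
      linarith
  · obtain ⟨a, rfl⟩ := ENat.ne_top_iff_exists.1 h1.ne
    obtain ⟨a', rfl⟩ := ENat.ne_top_iff_exists.1 h2.ne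
    induction d using ENat.recTopCoe with
    | top =>
      have ha : d' = ⊤ := by
        rw [add_top] at e
        by_contra hne
        exact (WithTop.add_lt_top.2 ⟨h1, lt_top_iff_ne_top.2 hne⟩).ne e.symm
      rw [ha, cast, cast]
      simp
    | coe d =>
      have ha : d' ≠ ⊤ := by
        rintro rfl
        rw [add_top] at e
        exact (ENat.natCast_ne_top (a' + d)) (by rw [← e]; push_cast; rfl)
      obtain ⟨d', rfl⟩ := ENat.ne_top_iff_exists.1 ha
      have e' : a' + d = a + d' := by exact_mod_cast e
      have e'' : (a' : ℝ) + d = a + d' := by exact_mod_cast e'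
      rw [cast, cast, cast, cast, ← EReal.coe_sub, ← EReal.coe_sub, EReal.coe_eq_coe_iff]
      linarith

theorem gt_of_gapContinuous {J : Type*} [TopologicalSpace J] {X : Type*} [NormedAddCommGroup X]
    [NormedSpace ℂ X] {F : J → Submodule ℂ X} (h : GapContinuous F) (s₀ : J) :
    GT (𝓝 s₀) F (F s₀) := by
  intro ε hε
  filter_upwards [h s₀ ε hε] with s hs
  unfold hatGap at hs
  rw [max_lt_iff] at hs
  exact ⟨near_of_gap hs.1, near_of_gap hs.2⟩

end TetradAux

/-- A gap-continuous family of semi-Fredholm tetrads over a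
connected parameter space has constant index. -/
theorem tetrad_index_constant {J : Type*} [TopologicalSpace J] [ConnectedSpace J]
    {X : Type*} [NormedAddCommGroup X] [NormedSpace ℂ X] [CompleteSpace X]
    (Y₁ M N Y₂ : J → Submodule ℂ X)
    (hY₁c : ∀ s, IsClosed (Y₁ s : Set X)) (hMc : ∀ s, IsClosed (M s : Set X))
    (hNc : ∀ s, IsClosed (N s : Set X)) (hY₂c : ∀ s, IsClosed (Y₂ s : Set X))
    (hMNc : ∀ s, IsClosed ((M s ⊔ N s : Submodule ℂ X) : Set X))
    (h₁ : ∀ s, Y₁ s ≤ M s ⊓ N s) (h₂ : ∀ s, M s ⊔ N s ≤ Y₂ s)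
    (hsf : ∀ s, QuotFin (Y₁ s) (M s ⊓ N s) ∨ QuotFin (M s ⊔ N s) (Y₂ s))
    (hY₁cont : GapContinuous Y₁) (hMcont : GapContinuous M)
    (hNcont : GapContinuous N) (hY₂cont : GapContinuous Y₂) :
    ∀ s t : J, tetradIndex (Y₁ s) (M s) (N s) (Y₂ s)
      = tetradIndex (Y₁ t) (M t) (N t) (Y₂ t) := by
  refine fun s t => IsLocallyConstant.apply_eq_of_preconnectedSpace
    (f := fun s => tetradIndex (Y₁ s) (M s) (N s) (Y₂ s))
    ((IsLocallyConstant.iff_eventually_eq _).2 fun s₀ => ?_) s t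
  have g1 := TetradAux.gt_of_gapContinuous hY₁cont s₀
  have g2 := TetradAux.gt_of_gapContinuous hMcont s₀
  have g3 := TetradAux.gt_of_gapContinuous hNcont s₀
  have g4 := TetradAux.gt_of_gapContinuous hY₂cont s₀
  rcases hsf s₀ with h | h
  · have h' := (TetradAux.edim_lt_top_iff _ _).2 h
    obtain ⟨n, hn⟩ := ENat.ne_top_iff_exists.1 h'.ne
    have := TetradAux.caseB g1 g2 g4 hY₁c hMc hY₂c (hY₁c s₀) (hMc s₀) n N (N s₀) g3 hNc (hNc s₀)
      (hMNc s₀) h₁ h₂ (h₁ s₀) (h₂ s₀) hn.symm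
    filter_upwards [this] with s hs
    unfold tetradIndex
    simp only [TetradAux.eQuotDim_eq]
    rw [hn] at hs
    exact TetradAux.ereal_sub_eq (Or.inr ⟨h', hs.1⟩) hs.2
  · have h' := (TetradAux.edim_lt_top_iff _ _).2 h
    obtain ⟨n, hn⟩ := ENat.ne_top_iff_exists.1 h'.ne
    have := TetradAux.caseA g1 g2 g4 hY₁c hMc hY₂c (hY₁c s₀) (hMc s₀) (hY₂c s₀) n N (N s₀) g3 hNc
      (hNc s₀) h₁ h₂ (h₁ s₀) (h₂ s₀) hn.symm
    filter_upwards [this] with s hs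
    unfold tetradIndex
    simp only [TetradAux.eQuotDim_eq]
    rw [hn] at hs
    exact TetradAux.ereal_sub_eq (Or.inl ⟨h', hs.1⟩) hs.2
end

section
/- Let X be a Banach space with four closed linear subspaces M, N, L, S such that M = L ⊕ S and dim S = n < +∞. Let a ∈ (0, √2 − 1). For a nonnegative integer i set a_i := a^i / (i(1+a)^{i−1}) for i ≥ 1, a₀ := 1, and δ_i := min{δ(N,M)(1+a_i)/a_i, 1} for i ≥ 1, δ₀ := δ(N,M). Assume (1 + δ_{n+1})(1 + δ(L,N)·γ(L,S)^{-1}) < 2. Then there exist an integer k with 0 ≤ k ≤ n and a linear subspace V_k of M such that dim V_k = k, N ∩ V_k = {0}, γ(V_k, N) ≥ a_k, δ(M, N+V_k) ≤ a, and δ(N+V_k, M) ≤ δ_k. -/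
open scoped Classical

/-! ### Mod 2 cochains on lists of points -/

/-- Evaluation of a cochain on the (augmented, mod 2) boundary of a list. -/
def bdEval {E : Type*} : List E → (List E → ZMod 2) → ZMod 2
  | [], _ => 0
  | x :: l, φ => φ l + bdEval l (fun t => φ (x :: t))

lemma bdEval_add {E : Type*} (l : List E) (φ ψ : List E → ZMod 2) :
    bdEval l (fun t => φ t + ψ t) = bdEval l φ + bdEval l ψ := by
  induction l generalizing φ ψ with
  | nil => simp [bdEval]
  | cons x l ih => simp only [bdEval, ih]; ring

lemma bdEval_mul {E : Type*} (l : List E) (c : ZMod 2) (φ : List E → ZMod 2) :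
    bdEval l (fun t => c * φ t) = c * bdEval l φ := by
  induction l generalizing φ with
  | nil => simp [bdEval]
  | cons x l ih => simp only [bdEval, ih]; ring

lemma bdEval_congr {E : Type*} (l : List E) (φ ψ : List E → ZMod 2)
    (h : ∀ t, t.Sublist l → t.length + 1 = l.length → φ t = ψ t) :
    bdEval l φ = bdEval l ψ := by
  induction l generalizing φ ψ with
  | nil => simp [bdEval]
  | cons x l ih =>
    simp only [bdEval]
    rw [h l (List.sublist_cons_self x l) (by simp)]
    congr 1
    apply ih
    intro t ht hl
    exact h _ (ht.cons_cons x) (by simp [hl])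

lemma zmod2_add_self (x : ZMod 2) : x + x = 0 := CharTwo.add_self_eq_zero x

lemma bdEval_bdEval {E : Type*} (l : List E) (φ : List E → ZMod 2) :
    bdEval l (fun t => bdEval t φ) = 0 := by
  induction l generalizing φ with
  | nil => simp [bdEval]
  | cons x l ih =>
    simp only [bdEval]
    rw [bdEval_add, ih, add_zero, zmod2_add_self]

lemma bdEval_map {E F : Type*} (g : E → F) (l : List E) (φ : List F → ZMod 2) :
    bdEval (l.map g) φ = bdEval l (fun t => φ (t.map g)) := by
  induction l generalizing φ with
  | nil => simp [bdEval]
  | cons x l ih => simp only [bdEval, List.map_cons, ih]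

/-- Cup product of the coboundaries of the given bit functions. -/
def cupC {E : Type*} : List (E → ZMod 2) → List E → ZMod 2
  | [], _ => 1
  | _ :: _, [] => 0
  | _ :: _, [_] => 0
  | s :: ss, x :: y :: l => (s x + s y) * cupC ss (y :: l)

lemma cupC_cocycle {E : Type*} (ss : List (E → ZMod 2)) (l : List E)
    (hl : l.length = ss.length + 2) : bdEval l (cupC ss) = 0 := by
  induction ss generalizing l with
  | nil =>
    match l, hl with
    | [x, y], _ => simp [bdEval, cupC, zmod2_add_self]
  | cons s ss ih =>
    match l, hl with
    | x :: y :: z :: l, hl =>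
      have h1 := ih (y :: z :: l) (by simpa using hl)
      rw [bdEval] at h1
      have h3 := CharTwo.add_eq_zero.1 h1
      have h4 : bdEval (z :: l) (fun t => cupC (s :: ss) (x :: y :: t))
          = (s x + s y) * bdEval (z :: l) (fun t => cupC ss (y :: t)) := by
        rw [← bdEval_mul]; rfl
      have h5 : bdEval (x :: y :: z :: l) (cupC (s :: ss)) = cupC (s :: ss) (y :: z :: l) +
          (cupC (s :: ss) (x :: z :: l) +
            bdEval (z :: l) (fun t => cupC (s :: ss) (x :: y :: t))) := rfl
      rw [h5, h4, ← h3]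
      simp only [cupC]
      linear_combination (zmod2_add_self (s x) + zmod2_add_self (s y) + zmod2_add_self (s z)) *
        cupC ss (z :: l)

/-- The primitive of `cupC (s :: ss)`. -/
def cupP {E : Type*} (s : E → ZMod 2) (ss : List (E → ZMod 2)) : List E → ZMod 2
  | [] => 0
  | x :: l => s x * cupC ss (x :: l)

lemma cupP_bd {E : Type*} (s : E → ZMod 2) (ss : List (E → ZMod 2)) (l : List E)
    (hl : l.length = ss.length + 2) : bdEval l (cupP s ss) = cupC (s :: ss) l := by
  match l, hl with
  | x :: y :: l, hl =>
    have h1 := cupC_cocycle ss (x :: y :: l) hl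
    rw [bdEval] at h1 ⊢
    have h2 : bdEval (y :: l) (fun t => cupP s ss (x :: t))
        = s x * bdEval (y :: l) (fun t => cupC ss (x :: t)) := by
      rw [← bdEval_mul]; rfl
    have h3 := CharTwo.add_eq_zero.1 h1
    rw [h2, ← h3]
    simp only [cupP, cupC]; ring

/-! ### Subdivision -/

noncomputable def bary {E : Type*} [AddCommGroup E] [Module ℝ E] (l : List E) : E :=
  ((l.length : ℝ)⁻¹) • l.sum

noncomputable def sdE {E : Type*} [AddCommGroup E] [Module ℝ E] :
    ℕ → (List E → ZMod 2) → (List E → ZMod 2)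
  | 0, φ => φ
  | k + 1, φ => fun l => bdEval l (sdE k (fun t => φ (bary l :: t)))

section sd
variable {E : Type*} [AddCommGroup E] [Module ℝ E]

lemma sdE_add (k : ℕ) (φ ψ : List E → ZMod 2) :
    sdE k (fun t => φ t + ψ t) = fun l => sdE k φ l + sdE k ψ l := by
  induction k generalizing φ ψ with
  | zero => rfl
  | succ k ih =>
    funext l
    simp only [sdE]
    rw [ih, bdEval_add]

lemma sdE_bd (k : ℕ) (φ : List E → ZMod 2) (l : List E) (hl : l.length = k + 1) :
    sdE (k + 1) (fun t => bdEval t φ) l = bdEval l (sdE k φ) := by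
  induction k generalizing φ l with
  | zero =>
    match l, hl with
    | [x], _ => simp [sdE, bdEval]
  | succ k ih =>
    rw [sdE]
    simp only [bdEval]
    rw [sdE_add, bdEval_add]
    have : bdEval l (sdE (k + 1) (fun t => bdEval t (fun t => φ (bary l :: t)))) = 0 := by
      rw [bdEval_congr l _ (fun t => bdEval t (sdE k (fun t => φ (bary l :: t)))), bdEval_bdEval]
      intro t _ ht
      exact ih _ _ (by omega)
    rw [this, add_zero]

lemma bary_neg (l : List E) : bary (l.map Neg.neg) = - bary l := by
  have : (l.map Neg.neg).sum = - l.sum := by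
    induction l with
    | nil => simp
    | cons x l ih => simp only [List.map_cons, List.sum_cons, ih]; abel
  simp [bary, this]

lemma sdE_neg (k : ℕ) (φ : List E → ZMod 2) (l : List E) :
    sdE k (fun t => φ (t.map Neg.neg)) l = sdE k φ (l.map Neg.neg) := by
  induction k generalizing φ l with
  | zero => rfl
  | succ k ih =>
    simp only [sdE]
    rw [bdEval_map, bary_neg]
    apply bdEval_congr
    intro t _ _
    rw [← ih]
    simp

end sd

lemma bary_dist {E : Type*} [NormedAddCommGroup E] [NormedSpace ℝ E] (l : List E) (d : ℝ)
    (hd : ∀ x ∈ l, ∀ y ∈ l, dist x y ≤ d) (x : E) (hx : x ∈ l) (m : ℕ) (hm : l.length ≤ m + 1) :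
    dist x (bary l) ≤ (m / (m + 1) : ℝ) * d := by
  have hd0 : 0 ≤ d := by simpa using hd x hx x hx
  have key : ∀ l' : List E, (∀ y ∈ l', dist x y ≤ d) →
      ‖(l'.length : ℝ) • x - l'.sum‖ ≤ l'.length * d := by
    intro l' h
    induction l' with
    | nil => simp
    | cons y l' ih =>
      have h1 := ih (fun z hz => h z (List.mem_cons_of_mem _ hz))
      have h2 := h y (List.mem_cons_self)
      have : ((y :: l').length : ℝ) • x - (y :: l').sum
          = (x - y) + ((l'.length : ℝ) • x - l'.sum) := by
        simp only [List.length_cons, List.sum_cons]; push_cast; rw [add_smul, one_smul]; abel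
      rw [this]
      refine (norm_add_le _ _).trans ?_
      rw [dist_eq_norm] at h2
      simp only [List.length_cons]; push_cast; linarith
  obtain ⟨p, hp⟩ : ∃ p, l.length = p + 1 := by
    have := List.length_pos_of_mem hx
    exact ⟨l.length - 1, by omega⟩
  have hperm := List.perm_cons_erase hx
  have hsum : l.sum = x + (l.erase x).sum := by rw [hperm.sum_eq]; simp
  have hlen : (l.erase x).length = p := by rw [List.length_erase_of_mem hx, hp]; rfl
  have h1 := key (l.erase x) (fun y hy => hd x hx y (List.mem_of_mem_erase hy))
  rw [hlen] at h1
  have hp1 : (0 : ℝ) < p + 1 := by positivity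
  have : x - bary l = ((p : ℝ) + 1)⁻¹ • ((p : ℝ) • x - (l.erase x).sum) := by
    rw [bary, hp, hsum, eq_inv_smul_iff₀ hp1.ne', smul_sub]
    push_cast
    rw [smul_inv_smul₀ hp1.ne', add_smul, one_smul]; abel
  rw [dist_eq_norm, this, norm_smul, norm_inv, Real.norm_of_nonneg hp1.le]
  have hpm : (p : ℝ) ≤ m := by exact_mod_cast (by omega : p ≤ m)
  have h3 : (p : ℝ) / (p + 1) ≤ m / (m + 1) := by
    rw [div_le_div_iff₀ hp1 (by positivity)]; nlinarith
  calc ((p : ℝ) + 1)⁻¹ * ‖(p : ℝ) • x - (l.erase x).sum‖ ≤ ((p : ℝ) + 1)⁻¹ * (p * d) := by gcongr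
    _ = (p : ℝ) / (p + 1) * d := by ring
    _ ≤ _ := by gcongr

lemma bary_mem {E : Type*} [NormedAddCommGroup E] [NormedSpace ℝ E] (l : List E)
    (hl : l ≠ []) : bary l ∈ convexHull ℝ {x | x ∈ l} := by
  have key : ∀ l' : List E, ∀ W : Set E, Convex ℝ W → (∀ x ∈ l', x ∈ W) → l' ≠ [] → bary l' ∈ W := by
    intro l' W hW h hn
    induction l' with
    | nil => exact absurd rfl hn
    | cons y l' ih =>
      by_cases hl' : l' = []
      · subst hl'; simpa [bary] using h y (List.mem_cons_self)
      · have h1 := ih (fun z hz => h z (List.mem_cons_of_mem _ hz)) hl'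
        have h2 := h y (List.mem_cons_self)
        have hpos : (0 : ℝ) < l'.length := by exact_mod_cast List.length_pos_iff.2 hl'
        have : bary (y :: l') = ((l'.length : ℝ) + 1)⁻¹ • y +
            ((l'.length : ℝ) / ((l'.length : ℝ) + 1)) • bary l' := by
          simp only [bary, List.length_cons, List.sum_cons, smul_smul, smul_add]
          push_cast
          congr 2
          field_simp
        rw [this]
        exact hW h2 h1 (by positivity) (by positivity) (by field_simp; ring)
  exact key l _ (convex_convexHull ℝ _) (fun x hx => subset_convexHull ℝ _ hx) hl

lemma sdE_local {E : Type*} [NormedAddCommGroup E] [NormedSpace ℝ E] (m k : ℕ) (hk : k ≤ m + 1)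
    (l : List E) (hl : l.length = k) (d : ℝ) (hd : ∀ x ∈ l, ∀ y ∈ l, dist x y ≤ d) (hd0 : 0 ≤ d)
    (φ ψ : List E → ZMod 2)
    (h : ∀ t : List E, t.length = k → (∀ x ∈ t, x ∈ convexHull ℝ {x | x ∈ l}) →
      (∀ x ∈ t, ∀ y ∈ t, dist x y ≤ (m / (m + 1) : ℝ) * d) → φ t = ψ t) :
    sdE k φ l = sdE k ψ l := by
  induction k generalizing l φ ψ with
  | zero =>
    have : l = [] := List.length_eq_zero_iff.1 hl
    subst this
    exact h [] rfl (by simp) (by simp)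
  | succ k ih =>
    have hne : l ≠ [] := by rintro rfl; simp at hl
    have hr : 0 ≤ (m / (m + 1) : ℝ) * d := by positivity
    have hball : convexHull ℝ {x | x ∈ l} ⊆ Metric.closedBall (bary l) ((m / (m + 1) : ℝ) * d) :=
      convexHull_min (fun x hx => bary_dist l d hd x hx m (by omega)) (convex_closedBall _ _)
    simp only [sdE]
    apply bdEval_congr
    intro t ht htl
    apply ih (by omega) t (by omega) (fun x hx y hy => hd x (ht.subset hx) y (ht.subset hy))
    intro t' ht' hin hdist
    have hin' : ∀ x ∈ t', x ∈ convexHull ℝ {x | x ∈ l} := fun x hx =>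
      convexHull_mono (fun z hz => ht.subset hz) (hin x hx)
    apply h
    · simp [ht']
    · intro x hx
      rcases List.mem_cons.1 hx with rfl | hx
      · exact bary_mem l hne
      · exact hin' x hx
    · intro x hx y hy
      rcases List.mem_cons.1 hx with rfl | hx <;> rcases List.mem_cons.1 hy with rfl | hy
      · simpa using hr
      · rw [dist_comm]; exact hball (hin' y hy)
      · exact hball (hin' x hx)
      · exact hdist x hx y hy

lemma sdE_iter_local {E : Type*} [NormedAddCommGroup E] [NormedSpace ℝ E] (m k : ℕ)
    (hk : k ≤ m + 1) (N : ℕ)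
    (l : List E) (hl : l.length = k) (d : ℝ) (hd : ∀ x ∈ l, ∀ y ∈ l, dist x y ≤ d) (hd0 : 0 ≤ d)
    (φ ψ : List E → ZMod 2)
    (h : ∀ t : List E, t.length = k → (∀ x ∈ t, x ∈ convexHull ℝ {x | x ∈ l}) →
      (∀ x ∈ t, ∀ y ∈ t, dist x y ≤ (m / (m + 1) : ℝ) ^ N * d) → φ t = ψ t) :
    (sdE k)^[N] φ l = (sdE k)^[N] ψ l := by
  induction N generalizing l d with
  | zero => exact h l hl (fun x hx => subset_convexHull ℝ _ hx) (by simpa using hd)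
  | succ N ih =>
    rw [Function.iterate_succ_apply', Function.iterate_succ_apply']
    apply sdE_local m k hk l hl d hd hd0
    intro t ht hin hdist
    apply ih t ht _ hdist (by positivity)
    intro t' ht' hin' hdist'
    apply h t' ht'
    · intro x hx
      exact convexHull_min (fun z hz => hin z hz) (convex_convexHull ℝ _) (hin' x hx)
    · intro x hx y hy
      refine (hdist' x hx y hy).trans (le_of_eq ?_)
      ring

lemma sdE_iter_bd {E : Type*} [NormedAddCommGroup E] [NormedSpace ℝ E]
    (k N : ℕ) (φ : List E → ZMod 2) (l : List E) (hl : l.length = k + 1) :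
    (sdE (k + 1))^[N] (fun t => bdEval t φ) l = bdEval l ((sdE k)^[N] φ) := by
  induction N generalizing l with
  | zero => rfl
  | succ N ih =>
    rw [Function.iterate_succ_apply', Function.iterate_succ_apply', ← sdE_bd _ _ _ hl]
    have hne : l ≠ [] := by rintro rfl; simp at hl
    -- locality: only lists of the same length matter
    obtain ⟨d, hd0, hd⟩ : ∃ d : ℝ, 0 ≤ d ∧ ∀ x ∈ l, ∀ y ∈ l, dist x y ≤ d := by
      refine ⟨Metric.diam {x | x ∈ l}, Metric.diam_nonneg, fun x hx y hy =>
        Metric.dist_le_diam_of_mem (List.finite_toSet l).isBounded hx hy⟩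
    exact sdE_local k (k + 1) le_rfl l hl d hd hd0 _ _ (fun t ht _ _ => ih t ht)

lemma sdE_iter_neg {E : Type*} [AddCommGroup E] [Module ℝ E] (k N : ℕ)
    (φ : List E → ZMod 2) (l : List E) :
    (sdE k)^[N] (fun t => φ (t.map Neg.neg)) l = (sdE k)^[N] φ (l.map Neg.neg) := by
  induction N generalizing l with
  | zero => rfl
  | succ N ih =>
    rw [Function.iterate_succ_apply', Function.iterate_succ_apply', ← sdE_neg]
    congr 1
    funext t
    exact ih t

lemma sdE_iter_add {E : Type*} [AddCommGroup E] [Module ℝ E] (k N : ℕ)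
    (φ ψ : List E → ZMod 2) :
    (sdE k)^[N] (fun t => φ t + ψ t) = fun l => (sdE k)^[N] φ l + (sdE k)^[N] ψ l := by
  induction N with
  | zero => rfl
  | succ N ih =>
    rw [Function.iterate_succ_apply', ih, sdE_add]
    funext l
    rw [Function.iterate_succ_apply', Function.iterate_succ_apply']

/-! ### The hemisphere chains -/

def hemi {E : Type*} [AddCommGroup E] (e : ℕ → E) : ℕ → (List E → ZMod 2) → ZMod 2
  | 0, φ => φ [e 0]
  | i + 1, φ => hemi e i (fun t => φ (e (i + 1) :: t)) +
      hemi e i (fun t => φ (e (i + 1) :: t.map Neg.neg))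

def Good {E : Type*} [AddCommGroup E] (e : ℕ → E) : ℕ → List E → Prop
  | 0, l => l = [e 0]
  | i + 1, l => ∃ t, Good e i t ∧ (l = e (i + 1) :: t ∨ l = e (i + 1) :: t.map Neg.neg)

section hemi
variable {E : Type*} [AddCommGroup E] (e : ℕ → E)

lemma Good.length {i : ℕ} {l : List E} (h : Good e i l) : l.length = i + 1 := by
  induction i generalizing l with
  | zero => rw [Good] at h; simp [h]
  | succ i ih =>
    obtain ⟨t, ht, rfl | rfl⟩ := h
    · simp [ih ht]
    · simp [ih ht]

lemma hemi_congr (i : ℕ) (φ ψ : List E → ZMod 2) (h : ∀ l, Good e i l → φ l = ψ l) :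
    hemi e i φ = hemi e i ψ := by
  induction i generalizing φ ψ with
  | zero => exact h _ rfl
  | succ i ih =>
    simp only [hemi]
    congr 1
    · exact ih _ _ fun t ht => h _ ⟨t, ht, Or.inl rfl⟩
    · exact ih _ _ fun t ht => h _ ⟨t, ht, Or.inr rfl⟩

lemma hemi_add (i : ℕ) (φ ψ : List E → ZMod 2) :
    hemi e i (fun t => φ t + ψ t) = hemi e i φ + hemi e i ψ := by
  induction i generalizing φ ψ with
  | zero => rfl
  | succ i ih => simp only [hemi]; rw [ih, ih]; ring

lemma hemi_bd (i : ℕ) (φ : List E → ZMod 2) :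
    hemi e (i + 1) (fun t => bdEval t φ) = hemi e i φ + hemi e i (fun t => φ (t.map Neg.neg)) := by
  have key : ∀ (i : ℕ) (φ : List E → ZMod 2),
      hemi e i (fun t => bdEval t φ) + hemi e i (fun t => bdEval (t.map Neg.neg) φ) = 0 ∧
      hemi e (i + 1) (fun t => bdEval t φ)
        = hemi e i φ + hemi e i (fun t => φ (t.map Neg.neg)) := by
    intro i
    induction i with
    | zero =>
      intro φ
      refine ⟨by simp [hemi, bdEval, zmod2_add_self], ?_⟩
      simp only [hemi, bdEval, List.map_cons, List.map_nil, add_zero]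
      linear_combination zmod2_add_self (φ [e 1])
    | succ i ih =>
      intro φ
      have A : hemi e (i + 1) (fun t => bdEval t φ) +
          hemi e (i + 1) (fun t => bdEval (t.map Neg.neg) φ) = 0 := by
        simp only [bdEval_map]
        rw [(ih φ).2, (ih (fun t => φ (t.map Neg.neg))).2]
        have : (fun t : List E => φ ((t.map Neg.neg).map Neg.neg)) = φ := by
          funext t; simp
        rw [this]
        linear_combination zmod2_add_self (hemi e i φ) +
          zmod2_add_self (hemi e i (fun t => φ (t.map Neg.neg)))
      refine ⟨A, ?_⟩
      rw [hemi]
      simp only [bdEval]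
      rw [hemi_add, hemi_add]
      have B : hemi e (i + 1) (fun t => bdEval t (fun t => φ (e (i + 1 + 1) :: t))) +
          hemi e (i + 1) (fun t => bdEval (t.map Neg.neg) (fun t => φ (e (i + 1 + 1) :: t)))
            = 0 := by
        simp only [bdEval_map]
        rw [(ih (fun t => φ (e (i + 1 + 1) :: t))).2,
          (ih (fun t => φ (e (i + 1 + 1) :: t.map Neg.neg))).2]
        have : (fun t : List E => φ (e (i + 1 + 1) :: (t.map Neg.neg).map Neg.neg))
            = fun t => φ (e (i + 1 + 1) :: t) := by
          funext t; simp
        rw [this]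
        linear_combination zmod2_add_self (hemi e i (fun t => φ (e (i + 1 + 1) :: t))) +
          zmod2_add_self (hemi e i (fun t => φ (e (i + 1 + 1) :: t.map Neg.neg)))
      linear_combination B
  exact (key i φ).2

end hemi

/-! ### Borsuk-Ulam -/

lemma cupC_neg {E : Type*} [AddCommGroup E] (ss : List (E → ZMod 2))
    (hs : ∀ s ∈ ss, ∀ x : E, x ≠ 0 → s (-x) = s x + 1) (l : List E) (hl : ∀ x ∈ l, x ≠ 0) :
    cupC ss (l.map Neg.neg) = cupC ss l := by
  induction ss generalizing l with
  | nil => rfl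
  | cons s ss ih =>
    match l, hl with
    | [], _ => rfl
    | [_], _ => rfl
    | x :: y :: l, hl =>
      have h := ih (fun s' h' => hs s' (List.mem_cons_of_mem _ h')) (y :: l)
        (fun z hz => hl z (List.mem_cons_of_mem _ hz))
      have hx := hs s List.mem_cons_self x (hl x (by simp))
      have hy := hs s List.mem_cons_self y (hl y (by simp))
      simp only [List.map_cons, cupC] at h ⊢
      rw [h, hx, hy]
      linear_combination zmod2_add_self 1 * cupC ss (y :: l)

lemma cupP_neg {E : Type*} [AddCommGroup E] (s : E → ZMod 2) (ss : List (E → ZMod 2))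
    (hs : ∀ s' ∈ s :: ss, ∀ x : E, x ≠ 0 → s' (-x) = s' x + 1) (l : List E)
    (hl : ∀ x ∈ l, x ≠ 0) (hn : l ≠ []) :
    cupP s ss l + cupP s ss (l.map Neg.neg) = cupC ss l := by
  match l, hl, hn with
  | x :: l, hl, _ =>
    have h := cupC_neg ss (fun s' h' => hs s' (List.mem_cons_of_mem _ h')) (x :: l) hl
    have hx := hs s List.mem_cons_self x (hl x (by simp))
    simp only [List.map_cons, cupP] at h ⊢
    rw [h, hx]
    linear_combination zmod2_add_self (s x) * cupC ss (x :: l)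

lemma sdE_iter_congr {E : Type*} [NormedAddCommGroup E] [NormedSpace ℝ E] (k N : ℕ)
    (l : List E) (hl : l.length = k) (φ ψ : List E → ZMod 2)
    (h : ∀ t : List E, t.length = k → (∀ x ∈ t, x ∈ convexHull ℝ {x | x ∈ l}) → φ t = ψ t) :
    (sdE k)^[N] φ l = (sdE k)^[N] ψ l :=
  sdE_iter_local k k (by omega) N l hl (Metric.diam {x | x ∈ l})
    (fun _ hx _ hy => Metric.dist_le_diam_of_mem (List.finite_toSet l).isBounded hx hy)
    Metric.diam_nonneg φ ψ (fun t ht h1 _ => h t ht h1)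

lemma hemi_cup {E : Type*} [NormedAddCommGroup E] [NormedSpace ℝ E] (e : ℕ → E) (N m : ℕ)
    (hgood : ∀ i ≤ m, ∀ l, Good e i l → (0 : E) ∉ convexHull ℝ {x | x ∈ l})
    (i : ℕ) (hi : i ≤ m) (ss : List (E → ZMod 2)) (hlen : ss.length = i)
    (hs : ∀ s ∈ ss, ∀ x : E, x ≠ 0 → s (-x) = s x + 1) :
    hemi e i ((sdE (i + 1))^[N] (cupC ss)) = 1 := by
  induction i generalizing ss with
  | zero =>
    have : ss = [] := List.length_eq_zero_iff.1 hlen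
    subst this
    have key : ∀ N : ℕ, ∀ x : E, (sdE 1)^[N] (cupC []) [x] = 1 := by
      intro N
      induction N with
      | zero => intro x; rfl
      | succ N ih =>
        intro x
        rw [Function.iterate_succ_apply']
        have h1 : ∀ φ : List E → ZMod 2, sdE 1 φ [x] = φ [bary [x]] := by
          intro φ; simp [sdE, bdEval]
        rw [h1, ih]
    exact key N (e 0)
  | succ i ih =>
    match ss, hlen with
    | s :: ss, hlen =>
      have hlen' : ss.length = i := by simpa using hlen
      have h0 := ih (by omega) ss hlen' (fun s' h' => hs s' (List.mem_cons_of_mem _ h'))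
      rw [← h0]
      rw [hemi_congr e (i + 1) _ (fun l => bdEval l ((sdE (i + 1))^[N] (cupP s ss))), hemi_bd,
        ← hemi_add]
      · apply hemi_congr
        intro l hl
        have hll := hl.length
        rw [← sdE_iter_neg]
        have := congrFun (sdE_iter_add (i + 1) N (cupP s ss)
          (fun t => cupP s ss (t.map Neg.neg))) l
        rw [← this]
        apply sdE_iter_congr _ _ _ hll
        intro t ht hin
        apply cupP_neg s ss hs t
        · rintro x hx rfl
          exact hgood i (by omega) l hl (hin _ hx)
        · rintro rfl; simp at ht
      · intro l hl
        have hll := hl.length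
        rw [← sdE_iter_bd _ _ _ _ hll]
        apply sdE_iter_congr _ _ _ hll
        intro t ht hin
        rw [cupP_bd]
        omega

/-- standard vectors -/
noncomputable def stdv (m : ℕ) (i : ℕ) : Fin (m + 1) → ℝ := fun j => if (j : ℕ) = i then 1 else 0

lemma good_std (m i : ℕ) (hi : i ≤ m) (l : List (Fin (m + 1) → ℝ)) (hl : Good (stdv m) i l) :
    ∃ σ : Fin (m + 1) → ℝ, (∀ j, |σ j| ≤ 1) ∧ ∀ x ∈ l, ∑ j, σ j * x j = 1 ∧ ‖x‖ ≤ 1 ∧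
      ∀ j : Fin (m + 1), i < j → x j = 0 := by
  have hnorm : ∀ i, ‖stdv m i‖ ≤ 1 := by
    intro i
    rw [pi_norm_le_iff_of_nonneg zero_le_one]
    intro j
    simp only [stdv]
    split_ifs <;> simp
  induction i generalizing l with
  | zero =>
    rw [Good] at hl
    subst hl
    refine ⟨fun _ => 1, by simp, ?_⟩
    intro x hx
    rw [List.mem_singleton] at hx
    subst hx
    refine ⟨?_, hnorm 0, ?_⟩
    · rw [Finset.sum_eq_single (0 : Fin (m + 1))]
      · simp [stdv]
      · intro j _ hj
        have : (j : ℕ) ≠ 0 := fun h => hj (Fin.ext h)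
        simp [stdv, this]
      · simp
    · intro j hj
      have : (j : ℕ) ≠ 0 := by omega
      simp [stdv, this]
  | succ i ih =>
    obtain ⟨t, ht, hl⟩ := hl
    obtain ⟨σ, hσ, hx⟩ := ih (by omega) t ht
    -- reduce the negated case to the positive one
    obtain ⟨t', σ, hσ, hx, rfl⟩ : ∃ (t' : List (Fin (m + 1) → ℝ)) (σ : Fin (m + 1) → ℝ),
        (∀ j, |σ j| ≤ 1) ∧ (∀ x ∈ t', ∑ j, σ j * x j = 1 ∧ ‖x‖ ≤ 1 ∧
          ∀ j : Fin (m + 1), i < j → x j = 0) ∧ l = stdv m (i + 1) :: t' := by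
      rcases hl with rfl | rfl
      · exact ⟨t, σ, hσ, hx, rfl⟩
      · refine ⟨t.map Neg.neg, fun j => - σ j, by simpa using hσ, ?_, rfl⟩
        intro x hx'
        obtain ⟨y, hy, rfl⟩ := List.mem_map.1 hx'
        obtain ⟨h1, h2, h3⟩ := hx y hy
        exact ⟨by simpa using h1, by simpa using h2, fun j hj => by simp [h3 j hj]⟩
    refine ⟨fun j => if (j : ℕ) = i + 1 then 1 else σ j, ?_, ?_⟩
    · intro j
      simp only
      split_ifs
      · simp
      · exact hσ j
    · intro x hx'
      rcases List.mem_cons.1 hx' with rfl | hx'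
      · refine ⟨?_, hnorm _, ?_⟩
        · rw [Finset.sum_eq_single (⟨i + 1, by omega⟩ : Fin (m + 1))]
          · simp [stdv]
          · intro j _ hj
            have : (j : ℕ) ≠ i + 1 := fun h => hj (Fin.ext h)
            simp [stdv, this]
          · simp
        · intro j hj
          have : (j : ℕ) ≠ i + 1 := by omega
          simp [stdv, this]
      · obtain ⟨h1, h2, h3⟩ := hx x hx'
        refine ⟨?_, h2, fun j hj => h3 j (by omega)⟩
        refine Eq.trans ?_ h1
        apply Finset.sum_congr rfl
        intro j _
        simp only
        split_ifs with h
        · rw [h3 j (by omega)]; simp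
        · rfl

lemma good_std_hull (m i : ℕ) (hi : i ≤ m) (l : List (Fin (m + 1) → ℝ)) (hl : Good (stdv m) i l)
    (x : Fin (m + 1) → ℝ) (hx : x ∈ convexHull ℝ {x | x ∈ l}) :
    ‖x‖ ≤ 1 ∧ 1 ≤ (m + 1) * ‖x‖ := by
  obtain ⟨σ, hσ, h⟩ := good_std m i hi l hl
  have hconv : Convex ℝ {x : Fin (m + 1) → ℝ | ∑ j, σ j * x j = 1} := by
    intro x hx y hy a b _ _ hab
    simp only [Set.mem_ofPred_eq] at hx hy ⊢
    have : ∑ j, σ j * (a • x + b • y) j = a * ∑ j, σ j * x j + b * ∑ j, σ j * y j := by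
      rw [Finset.mul_sum, Finset.mul_sum, ← Finset.sum_add_distrib]
      apply Finset.sum_congr rfl
      intro j _
      simp only [Pi.add_apply, Pi.smul_apply, smul_eq_mul]; ring
    rw [this, hx, hy]; simpa using hab
  have h1 : x ∈ Metric.closedBall (0 : Fin (m + 1) → ℝ) 1 :=
    convexHull_min (fun y hy => by simpa using (h y hy).2.1) (convex_closedBall _ _) hx
  have h2 : ∑ j, σ j * x j = 1 := convexHull_min (fun y hy => (h y hy).1) hconv hx
  refine ⟨by simpa using h1, ?_⟩
  calc (1 : ℝ) = ∑ j, σ j * x j := h2.symm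
    _ ≤ ∑ j : Fin (m + 1), ‖x‖ := by
      apply Finset.sum_le_sum
      intro j _
      have h3 := norm_le_pi_norm x j
      rw [Real.norm_eq_abs] at h3
      calc σ j * x j ≤ |σ j * x j| := le_abs_self _
        _ = |σ j| * |x j| := abs_mul _ _
        _ ≤ 1 * ‖x‖ := mul_le_mul (hσ j) h3 (abs_nonneg _) zero_le_one
        _ = ‖x‖ := one_mul _
    _ = (m + 1) * ‖x‖ := by simp

lemma cupC_ne_zero {E : Type*} (ss : List (E → ZMod 2)) (l : List E) (h : cupC ss l ≠ 0) :
    ∀ s ∈ ss, ∃ x ∈ l, ∃ y ∈ l, s x ≠ s y := by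
  induction ss generalizing l with
  | nil => simp
  | cons s ss ih =>
    match l, h with
    | [], h => exact absurd rfl h
    | [_], h => exact absurd rfl h
    | x :: y :: l, h =>
      rw [cupC] at h
      intro s' hs'
      rcases List.mem_cons.1 hs' with rfl | hs'
      · refine ⟨x, by simp, y, by simp, fun hxy => h ?_⟩
        rw [hxy, zmod2_add_self, zero_mul]
      · obtain ⟨a, ha, b, hb, hab⟩ := ih (y :: l) (right_ne_zero_of_mul h) s' hs'
        exact ⟨a, List.mem_cons_of_mem _ ha, b, List.mem_cons_of_mem _ hb, hab⟩

/-- An odd bit function on nonzero vectors. -/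
lemma exists_bit (m : ℕ) : ∃ β : (Fin (m + 1) → ℝ) → ZMod 2, ∀ x, x ≠ 0 → β (-x) = β x + 1 := by
  let pos : (Fin (m + 1) → ℝ) → Prop := fun x => toLex x > toLex 0
  refine ⟨fun x => if pos x then 1 else 0, fun x hx => ?_⟩
  have h1 : pos (-x) ↔ ¬ pos x := by
    have hx' : toLex x ≠ toLex 0 := fun h => hx h
    have : pos (-x) ↔ toLex x < toLex 0 := by
      change toLex 0 < toLex (-x) ↔ _
      change 0 < - toLex x ↔ toLex x < 0
      exact neg_pos
    rw [this]
    change _ ↔ ¬ (toLex 0 < toLex x)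
    exact ⟨fun h h' => lt_asymm h h', fun h => (lt_or_gt_of_ne hx').resolve_right h⟩
  by_cases h : pos x
  · have : ¬ pos (-x) := fun h' => h1.1 h' h
    simp [h, this, zmod2_add_self]
  · have : pos (-x) := h1.2 h
    simp [h, this]

theorem borsuk_ulam_odd (m : ℕ) (f : (Fin (m + 1) → ℝ) → (Fin m → ℝ))
    (hc : ContinuousOn f {0}ᶜ) (hodd : ∀ x, f (-x) = - f x) : ∃ x, x ≠ 0 ∧ f x = 0 := by
  by_contra! hne
  set K : Set (Fin (m + 1) → ℝ) := Metric.closedBall 0 1 ∩ {x | 1 ≤ (m + 1) * ‖x‖} with hK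
  have hKc : IsCompact K := (isCompact_closedBall _ _).inter_right
    (isClosed_le continuous_const (by fun_prop))
  have hK0 : ∀ x ∈ K, x ≠ 0 := by
    rintro x ⟨_, hx⟩ rfl
    simp only [Set.mem_ofPred_eq, norm_zero, mul_zero] at hx
    linarith
  have hcK : ContinuousOn f K := hc.mono fun x hx => hK0 x hx
  obtain ⟨η, hη, hlow⟩ : ∃ η > 0, ∀ x ∈ K, η ≤ ‖f x‖ := by
    by_cases hemp : K.Nonempty
    · obtain ⟨x0, hx0, hmin⟩ := hKc.exists_isMinOn hemp hcK.norm
      exact ⟨‖f x0‖, norm_pos_iff.2 (hne x0 (hK0 x0 hx0)), fun x hx => hmin hx⟩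
    · exact ⟨1, one_pos, fun x hx => absurd ⟨x, hx⟩ hemp⟩
  have huc := hKc.uniformContinuousOn_of_continuous hcK
  rw [Metric.uniformContinuousOn_iff] at huc
  obtain ⟨ρ, hρ, hρ'⟩ := huc (η / 3) (by positivity)
  obtain ⟨β, hβ⟩ := exists_bit m
  let s : Fin m → (Fin (m + 1) → ℝ) → ZMod 2 := fun j x =>
    if 0 < f x j then 1 else if f x j < 0 then 0 else β x
  have hs : ∀ j, ∀ x, x ≠ 0 → s j (-x) = s j x + 1 := by
    intro j x hx
    have h1 : f (-x) j = - f x j := by rw [hodd]; rfl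
    simp only [s, h1]
    rcases lt_trichotomy (f x j) 0 with h | h | h
    · simp [h, h.not_gt]
    · simp [h, hβ x hx]
    · simp [h, h.not_gt, zmod2_add_self]
  have hs' : ∀ j x y, s j x ≠ s j y → |f x j| ≤ |f x j - f y j| := by
    intro j x y hxy
    by_contra! hlt
    apply hxy
    simp only [s]
    rcases lt_trichotomy (f x j) 0 with h | h | h
    · have : f y j < 0 := by
        rw [abs_of_neg h] at hlt
        have := neg_abs_le (f x j - f y j)
        linarith
      simp [h, this, h.not_gt, this.not_gt]
    · rw [h] at hlt; simp at hlt
      exact absurd hlt (not_lt.2 (abs_nonneg _))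
    · have : 0 < f y j := by
        rw [abs_of_pos h] at hlt
        have := le_abs_self (f x j - f y j)
        linarith
      simp [h, this]
  obtain ⟨N, hN⟩ : ∃ N : ℕ, (m / (m + 1) : ℝ) ^ N * 2 < ρ := by
    have hlt : (m / (m + 1) : ℝ) < 1 := by
      rw [div_lt_one (by positivity)]; linarith
    obtain ⟨N, hN⟩ := exists_pow_lt_of_lt_one (half_pos hρ) hlt
    exact ⟨N, by linarith⟩
  have hhull := fun i hi l hl x hx => good_std_hull m i hi l hl x hx
  have h1 := hemi_cup (stdv m) N m
    (fun i hi l hl h0 => by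
      have := (hhull i hi l hl 0 h0).2
      rw [norm_zero, mul_zero] at this
      linarith) m le_rfl (List.ofFn s) (by simp)
    (fun s' h' x hx => by
      obtain ⟨j, rfl⟩ := (List.mem_ofFn' _ _).1 h'
      exact hs j x hx)
  have h2 : hemi (stdv m) m ((sdE (m + 1))^[N] (cupC (List.ofFn s)))
      = hemi (stdv m) m ((sdE (m + 1))^[N] (fun _ => 0)) := by
    apply hemi_congr
    intro l hl
    apply sdE_iter_local m (m + 1) le_rfl N l hl.length 2 _ (by norm_num)
    · intro t ht hin hdist
      by_contra hne0
      have h3 := cupC_ne_zero _ _ hne0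
      have htK : ∀ x ∈ t, x ∈ K := fun x hx => by
        have := hhull m le_rfl l hl x (hin x hx)
        exact ⟨by simpa using this.1, this.2⟩
      have hclose : ∀ x ∈ t, ∀ y ∈ t, ∀ j, |f x j - f y j| < η / 3 := by
        intro x hx y hy j
        have := hρ' x (htK x hx) y (htK y hy) (lt_of_le_of_lt (hdist x hx y hy) hN)
        rw [dist_eq_norm] at this
        exact lt_of_le_of_lt (norm_le_pi_norm (f x - f y) j) this
      obtain ⟨x, hx⟩ : ∃ x, x ∈ t := by
        apply List.exists_mem_of_length_pos; omega
      have hsmall : ‖f x‖ ≤ 2 * η / 3 := by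
        rw [pi_norm_le_iff_of_nonneg (by positivity)]
        intro j
        obtain ⟨y, hy, z, hz, hyz⟩ := h3 (s j) ((List.mem_ofFn' _ _).2 ⟨j, rfl⟩)
        have h4 := hs' j y z hyz
        have h5 := hclose y hy z hz j
        have h6 := hclose x hx y hy j
        rw [Real.norm_eq_abs]
        have : |f x j| ≤ |f x j - f y j| + |f y j| := by
          have := abs_add_le (f x j - f y j) (f y j)
          simpa using this
        linarith
      have := hlow x (htK x hx)
      linarith
    · intro x hx y hy
      have hx' := (hhull m le_rfl l hl x (subset_convexHull ℝ _ hx)).1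
      have hy' := (hhull m le_rfl l hl y (subset_convexHull ℝ _ hy)).1
      rw [dist_eq_norm]
      linarith [norm_sub_le x y]
  have h3 : hemi (stdv m) m ((sdE (m + 1))^[N] (fun _ => 0)) = 0 := by
    have h4 := sdE_iter_add (E := Fin (m + 1) → ℝ) (m + 1) N (fun _ => 0) (fun _ => 0)
    simp only [add_zero] at h4
    rw [h4, hemi_add, zmod2_add_self]
  rw [h2, h3] at h1
  exact zero_ne_one h1

theorem kkm_gap {Y : Type*} [SeminormedAddCommGroup Y] [NormedSpace ℝ Y] (m : ℕ)
    (A : (Fin (m + 1) → ℝ) →L[ℝ] Y) (B : (Fin m → ℝ) →L[ℝ] Y) :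
    ∃ x, x ≠ 0 ∧ ∀ y, ‖A x‖ ≤ ‖A x - B y‖ := by
  by_contra! h
  obtain ⟨g, hg⟩ := exists_continuous_forall_mem_convex_of_local_const
    (X := {x : Fin (m + 1) → ℝ // x ≠ 0}) (E := Fin m → ℝ)
    (t := fun x => {y | ‖A x.1 - B y‖ < ‖A x.1‖})
    (by
      intro x
      have h1 : Convex ℝ (Metric.ball (A x.1) ‖A x.1‖) := convex_ball _ _
      have h2 := h1.linear_preimage B.toLinearMap
      have heq : {y | ‖A x.1 - B y‖ < ‖A x.1‖} =
          B.toLinearMap ⁻¹' (Metric.ball (A x.1) ‖A x.1‖) := by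
        ext y
        change ‖A x.1 - B y‖ < ‖A x.1‖ ↔ dist (B y) (A x.1) < ‖A x.1‖
        rw [dist_eq_norm, norm_sub_rev]
      rw [← heq] at h2
      exact h2)
    (by
      intro x
      obtain ⟨y, hy⟩ := h x.1 x.2
      refine ⟨y, ?_⟩
      have hopen : IsOpen {z : {x : Fin (m + 1) → ℝ // x ≠ 0} | ‖A z.1 - B y‖ < ‖A z.1‖} :=
        isOpen_lt (by fun_prop) (by fun_prop)
      exact hopen.mem_nhds hy)
  have hneg : ∀ x : {x : Fin (m + 1) → ℝ // x ≠ 0}, -x.1 ≠ 0 := fun x => neg_ne_zero.2 x.2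
  let f : (Fin (m + 1) → ℝ) → (Fin m → ℝ) := fun x =>
    if hx : x ≠ 0 then g ⟨x, hx⟩ - g ⟨-x, neg_ne_zero.2 hx⟩ else 0
  obtain ⟨x, hx, hfx⟩ := borsuk_ulam_odd m f
    (by
      rw [continuousOn_iff_continuous_domRestrict]
      have : Set.domRestrict ({0}ᶜ) f = fun x : ({0}ᶜ : Set (Fin (m + 1) → ℝ)) =>
          g ⟨x.1, x.2⟩ - g ⟨-x.1, neg_ne_zero.2 x.2⟩ := by
        funext x
        have hx : x.1 ≠ 0 := x.2
        change f x.1 = _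
        simp [f, hx]
      rw [this]
      refine (g.continuous.comp ?_).sub (g.continuous.comp ?_)
      · exact Continuous.subtype_mk (by fun_prop) _
      · exact Continuous.subtype_mk (by fun_prop) _)
    (by
      intro x
      by_cases hx : x = 0
      · simp [f, hx]
      · simp [f, hx])
  simp only [f, hx, ne_eq, not_false_eq_true, dif_pos] at hfx
  have h1 := hg ⟨x, hx⟩
  have h2 := hg ⟨-x, neg_ne_zero.2 hx⟩
  simp only [Set.mem_ofPred_eq] at h1 h2
  rw [← sub_eq_zero.1 hfx] at h2
  have h3 : A (-x) - B (g ⟨x, hx⟩) = -(A x + B (g ⟨x, hx⟩)) := by rw [map_neg]; abel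
  rw [h3, norm_neg, map_neg, norm_neg] at h2
  have h4 : (2 : ℝ) • A x = (A x - B (g ⟨x, hx⟩)) + (A x + B (g ⟨x, hx⟩)) := by
    rw [two_smul]; abel
  have h5 := norm_add_le (A x - B (g ⟨x, hx⟩)) (A x + B (g ⟨x, hx⟩))
  rw [← h4, norm_smul] at h5
  norm_num at h5
  linarith

/-! ### Gaps -/

section gaps
variable {X : Type*} [NormedAddCommGroup X] [NormedSpace ℂ X]

lemma infDist_eq_mkQ (N : Submodule ℂ X) (x : X) :
    Metric.infDist x (N : Set X) = ‖N.mkQ x‖ :=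
  (QuotientAddGroup.norm_mk (S := N.toAddSubgroup) x).symm

lemma sub_nonempty (N : Submodule ℂ X) : (N : Set X).Nonempty := ⟨0, N.zero_mem⟩

lemma infDist_le_norm (N : Submodule ℂ X) (x : X) : Metric.infDist x (N : Set X) ≤ ‖x‖ := by
  simpa using Metric.infDist_le_dist_of_mem (x := x) N.zero_mem

lemma infDist_le_sub (N : Submodule ℂ X) (x y : X) (hy : y ∈ N) :
    Metric.infDist x (N : Set X) ≤ ‖x - y‖ := by
  simpa [dist_eq_norm] using Metric.infDist_le_dist_of_mem (x := x) hy

lemma infDist_smul' (N : Submodule ℂ X) (c : ℂ) (x : X) :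
    Metric.infDist (c • x) (N : Set X) = ‖c‖ * Metric.infDist x (N : Set X) := by
  rw [infDist_eq_mkQ, infDist_eq_mkQ, map_smul, norm_smul]

lemma gap_bound (M N : Submodule ℂ X) (u : X) (hu : u ∈ M) :
    Metric.infDist u (N : Set X) ≤ gapSub M N * ‖u‖ := by
  by_cases h0 : u = 0
  · subst h0
    simpa using infDist_le_norm N 0
  have hn : (0 : ℝ) < ‖u‖ := norm_pos_iff.2 h0
  have h1 : Metric.infDist (((‖u‖⁻¹ : ℝ) : ℂ) • u) (N : Set X) ≤ gapSub M N := by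
    apply le_csSup
    · refine ⟨1, ?_⟩
      rintro _ ⟨v, ⟨_, hv⟩, rfl⟩
      exact (infDist_le_norm N v).trans hv.le
    · refine ⟨_, ⟨M.smul_mem _ hu, ?_⟩, rfl⟩
      rw [norm_smul, Complex.norm_real, norm_inv, norm_norm, inv_mul_cancel₀ hn.ne']
  rw [infDist_smul', Complex.norm_real, norm_inv, norm_norm, inv_mul_le_iff₀ hn] at h1
  linarith

lemma gap_nonneg (M N : Submodule ℂ X) : 0 ≤ gapSub M N := by
  apply Real.sSup_nonneg
  rintro _ ⟨v, _, rfl⟩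
  exact Metric.infDist_nonneg

lemma gap_le (M N : Submodule ℂ X) (c : ℝ) (hc : 0 ≤ c)
    (h : ∀ u ∈ M, Metric.infDist u (N : Set X) ≤ c * ‖u‖) : gapSub M N ≤ c := by
  apply Real.sSup_le _ hc
  rintro _ ⟨v, ⟨hv, hv1⟩, rfl⟩
  simpa [hv1] using h v hv

lemma exists_of_lt_gap (M N : Submodule ℂ X) (c : ℝ) (hc : 0 ≤ c) (h : c < gapSub M N) :
    ∃ u ∈ M, ‖u‖ = 1 ∧ c < Metric.infDist u (N : Set X) := by
  by_contra! h'
  refine absurd h (not_lt.2 (Real.sSup_le ?_ hc))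
  rintro _ ⟨v, ⟨hv, hv1⟩, rfl⟩
  exact h' v hv hv1

lemma le_minGap (V N : Submodule ℂ X) (hVN : N ⊓ V = ⊥) (c : ℝ) (h1 : V ≤ N → c ≤ 1)
    (h : ∀ v ∈ V, c * ‖v‖ ≤ Metric.infDist v (N : Set X)) : c ≤ minGap V N := by
  unfold minGap
  split_ifs with hle
  · exact h1 hle
  · obtain ⟨w, hw, hwN⟩ := SetLike.not_le_iff_exists.1 hle
    apply le_csInf
    · exact ⟨_, w, ⟨hw, hwN⟩, rfl⟩
    · rintro _ ⟨v, ⟨hv, hvN⟩, rfl⟩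
      have hv0 : v ≠ 0 := by rintro rfl; exact hvN N.zero_mem
      have : (V ⊓ N : Submodule ℂ X) = ⊥ := by rw [inf_comm]; exact hVN
      simp only [this, Submodule.bot_coe, Metric.infDist_singleton, dist_zero_right]
      rw [le_div_iff₀ (norm_pos_iff.2 hv0)]
      exact h v hv

lemma minGap_bound (L S : Submodule ℂ X) (hLS : L ⊓ S = ⊥) (l : X) (hl : l ∈ L) :
    minGap L S * ‖l‖ ≤ Metric.infDist l (S : Set X) := by
  by_cases h0 : l = 0
  · subst h0; simpa using Metric.infDist_nonneg
  have hlS : l ∉ S := fun h => h0 (by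
    have : l ∈ L ⊓ S := ⟨hl, h⟩
    rwa [hLS, Submodule.mem_bot] at this)
  have hle : ¬ L ≤ S := fun h => hlS (h hl)
  unfold minGap
  rw [if_neg hle, ← le_div_iff₀ (norm_pos_iff.2 h0)]
  apply csInf_le
  · refine ⟨0, ?_⟩
    rintro _ ⟨v, _, rfl⟩
    exact div_nonneg Metric.infDist_nonneg Metric.infDist_nonneg
  · refine ⟨l, ⟨hl, hlS⟩, ?_⟩
    simp only [hLS, Submodule.bot_coe, Metric.infDist_singleton, dist_zero_right]

lemma minGap_pos (L S : Submodule ℂ X) (hLc : IsClosed (L : Set X)) [FiniteDimensional ℂ S]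
    (hLS : L ⊓ S = ⊥) : 0 < minGap L S := by
  have : IsClosed (L : Set X) := hLc
  obtain ⟨K, hK, hanti⟩ := LinearMap.exists_antilipschitzWith (L.mkQ ∘ₗ S.subtype) (by
    rw [LinearMap.ker_eq_bot']
    intro s hs
    have h1 : (s : X) ∈ L := by simpa using hs
    have h2 : (s : X) ∈ L ⊓ S := ⟨h1, s.2⟩
    rw [hLS, Submodule.mem_bot] at h2
    exact Subtype.ext h2)
  have hK' : (0 : ℝ) < K := hK
  have hbound : ∀ s ∈ S, ‖s‖ ≤ K * Metric.infDist s (L : Set X) := by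
    intro s hs
    have := hanti.le_mul_dist ⟨s, hs⟩ 0
    rw [map_zero, dist_zero_right, dist_zero_right] at this
    rw [infDist_eq_mkQ]
    exact this
  have hpos : (0 : ℝ) < (1 + (K : ℝ))⁻¹ := by positivity
  refine lt_of_lt_of_le hpos (le_minGap L S (by rw [inf_comm]; exact hLS) _ ?_ ?_)
  · intro _
    exact inv_le_one_of_one_le₀ (by linarith)
  · intro l hl
    rw [Metric.le_infDist (sub_nonempty S)]
    intro s hs
    rw [inv_mul_le_iff₀ (by positivity), dist_eq_norm]
    have h1 := hbound s hs
    have h2 := infDist_le_sub L s l hl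
    have h3 : ‖l‖ ≤ ‖l - s‖ + ‖s‖ := by simpa using norm_add_le (l - s) s
    rw [norm_sub_rev] at h2
    nlinarith

lemma dim_lemma (N V S : Submodule ℂ X) [FiniteDimensional ℂ V] [FiniteDimensional ℂ S]
    (n : ℕ) (hVd : Module.finrank ℂ V = n + 1) (hSd : Module.finrank ℂ S = n)
    (hV : ∀ v ∈ V, v ≠ 0 → 0 < Metric.infDist v (N : Set X)) (c : ℝ) (hc0 : 0 ≤ c) (hc1 : c < 1)
    (h : ∀ x ∈ N ⊔ V, Metric.infDist x ((N ⊔ S : Submodule ℂ X) : Set X) ≤ c * ‖x‖) : False := by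
  have : FiniteDimensional ℝ S := FiniteDimensional.complexToReal S
  have hS2 : Module.finrank ℝ S = 2 * n := by rw [finrank_real_of_complex, hSd]
  have hV2 : 2 * n + 1 ≤ Module.finrank ℝ V := by rw [finrank_real_of_complex, hVd]; omega
  obtain ⟨b, hb⟩ := exists_linearIndependent_of_le_finrank (R := ℝ) hV2
  let bS := Module.finBasisOfFinrankEq ℝ S hS2
  let q : X →ₗ[ℝ] X ⧸ N := N.mkQ.restrictScalars ℝ
  let A0 : (Fin (2 * n + 1) → ℝ) →ₗ[ℝ] V := Fintype.linearCombination ℝ b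
  let B0 : (Fin (2 * n) → ℝ) →ₗ[ℝ] S := bS.equivFun.symm.toLinearMap
  let A := LinearMap.toContinuousLinearMap (q ∘ₗ (V.subtype.restrictScalars ℝ) ∘ₗ A0)
  let B := LinearMap.toContinuousLinearMap (q ∘ₗ (S.subtype.restrictScalars ℝ) ∘ₗ B0)
  obtain ⟨x, hx, hmin⟩ := kkm_gap (2 * n) A B
  set v : X := (A0 x : X) with hv
  have hvV : v ∈ V := (A0 x).2
  have hv0 : v ≠ 0 := by
    intro h0
    apply hx
    apply hb.fintypeLinearCombination_injective
    rw [map_zero]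
    exact Subtype.ext h0
  have hmin' : ∀ s ∈ S, Metric.infDist v (N : Set X) ≤ Metric.infDist (v - s) (N : Set X) := by
    intro s hs
    have h1 := hmin (bS.equivFun ⟨s, hs⟩)
    rw [infDist_eq_mkQ, infDist_eq_mkQ, map_sub]
    have h2 : B (bS.equivFun ⟨s, hs⟩) = N.mkQ s := by
      change N.mkQ ((bS.equivFun.symm (bS.equivFun ⟨s, hs⟩) : S) : X) = _
      rw [LinearEquiv.symm_apply_apply]
    rw [h2] at h1
    exact h1
  have hD := hV v hvV hv0
  set D := Metric.infDist v (N : Set X) with hDdef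
  have hD' : D < D * (2 / (1 + c)) := by
    have : 1 < 2 / (1 + c) := by rw [lt_div_iff₀ (by linarith)]; linarith
    nlinarith
  obtain ⟨y, hy, hyd⟩ := (Metric.infDist_lt_iff (sub_nonempty N)).1 hD'
  rw [dist_eq_norm] at hyd
  have h1 := h (v - y) (Submodule.sub_mem _ (Submodule.mem_sup_right hvV)
    (Submodule.mem_sup_left hy))
  have h2 : c * ‖v - y‖ < D := by
    have h3 : c * ‖v - y‖ ≤ c * (D * (2 / (1 + c))) := by gcongr
    have h4 : c * (D * (2 / (1 + c))) = D * (2 * c / (1 + c)) := by ring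
    have h5 : 2 * c / (1 + c) < 1 := by rw [div_lt_one (by linarith)]; linarith
    nlinarith
  obtain ⟨z, hz, hzd⟩ := (Metric.infDist_lt_iff (sub_nonempty (N ⊔ S))).1 (lt_of_le_of_lt h1 h2)
  obtain ⟨w, hw, s, hs, rfl⟩ := Submodule.mem_sup.1 hz
  rw [dist_eq_norm] at hzd
  have h3 := infDist_le_sub N (v - s) (y + w) (N.add_mem hy hw)
  have h4 : v - s - (y + w) = v - y - (w + s) := by abel
  rw [h4] at h3
  linarith [hmin' s hs]

end gaps


/-- One step of the construction. -/
lemma step_bound {X : Type*} [NormedAddCommGroup X] [NormedSpace ℂ X] (N V : Submodule ℂ X)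
    (a A A' : ℝ) (ha : 0 < a) (hA : 0 < A) (hA' : 0 < A')
    (hV : ∀ v ∈ V, A * ‖v‖ ≤ Metric.infDist v (N : Set X)) (u : X) (hu : ‖u‖ = 1)
    (hua : a ≤ Metric.infDist u ((N ⊔ V : Submodule ℂ X) : Set X))
    (hrec : V = ⊥ ∧ A' = a ∨ A' * ((1 + a) + A) ≤ a * A)
    (v : X) (hv : v ∈ V ⊔ Submodule.span ℂ {u}) :
    A' * ‖v‖ ≤ Metric.infDist v (N : Set X) := by
  obtain ⟨w, hw, z, hz, rfl⟩ := Submodule.mem_sup.1 hv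
  obtain ⟨c, rfl⟩ := Submodule.mem_span_singleton.1 hz
  set D := Metric.infDist (w + c • u) (N : Set X) with hD
  have h1 : a * ‖c‖ ≤ D := by
    have h2 : Metric.infDist (c • u) ((N ⊔ V : Submodule ℂ X) : Set X) ≤ D := by
      rw [hD, Metric.le_infDist (sub_nonempty N)]
      intro y hy
      rw [dist_eq_norm]
      have := infDist_le_sub (N ⊔ V) (c • u) (y - w) (Submodule.sub_mem _
        (Submodule.mem_sup_left hy) (Submodule.mem_sup_right hw))
      have h3 : c • u - (y - w) = w + c • u - y := by abel
      rwa [h3] at this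
    rw [infDist_smul'] at h2
    have := mul_le_mul_of_nonneg_left hua (norm_nonneg c)
    linarith
  have hcu : ‖c • u‖ = ‖c‖ := by rw [norm_smul, hu, mul_one]
  have hnorm : ‖w + c • u‖ ≤ ‖w‖ + ‖c‖ := by rw [← hcu]; exact norm_add_le _ _
  rcases hrec with ⟨hbot, rfl⟩ | hrec
  · have hw0 : w = 0 := by rw [hbot] at hw; simpa using hw
    subst hw0
    rw [zero_add, hcu]
    exact h1
  · have h2 : A * ‖w‖ ≤ D + ‖c‖ := by
      refine (hV w hw).trans ?_
      rw [hD, infDist_eq_mkQ, infDist_eq_mkQ]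
      have h3 : N.mkQ w = N.mkQ (w + c • u) - N.mkQ (c • u) := by rw [map_add]; abel
      rw [h3]
      refine (norm_sub_le _ _).trans ?_
      have h4 := infDist_le_norm N (c • u)
      rw [infDist_eq_mkQ, hcu] at h4
      linarith
    have hD0 : 0 ≤ D := Metric.infDist_nonneg
    have h5 : a * A * (‖w‖ + ‖c‖) ≤ ((1 + a) + A) * D := by
      nlinarith [mul_le_mul_of_nonneg_left h2 ha.le, mul_le_mul_of_nonneg_left h1 hA.le]
    have hpos : 0 < (1 + a) + A := by positivity
    have h6 : A' * ((1 + a) + A) * (‖w‖ + ‖c‖) ≤ ((1 + a) + A) * D :=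
      (mul_le_mul_of_nonneg_right hrec (by positivity)).trans h5
    have h7 : A' * (‖w‖ + ‖c‖) ≤ D := by
      refine le_of_mul_le_mul_left ?_ hpos
      linarith
    exact (mul_le_mul_of_nonneg_left hnorm hA'.le).trans h7

lemma sum_gap {X : Type*} [NormedAddCommGroup X] [NormedSpace ℂ X] (M N V : Submodule ℂ X)
    (hVM : V ≤ M) (A : ℝ) (hA : 0 < A)
    (hV : ∀ v ∈ V, A * ‖v‖ ≤ Metric.infDist v (N : Set X)) :
    gapSub (N ⊔ V) M ≤ min (gapSub N M * (1 + A) / A) 1 := by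
  have hg := gap_nonneg N M
  apply le_min
  · apply gap_le _ _ _ (by positivity)
    intro x hx
    obtain ⟨y, hy, v, hv, rfl⟩ := Submodule.mem_sup.1 hx
    have h1 : Metric.infDist (y + v) (M : Set X) = Metric.infDist y (M : Set X) := by
      rw [infDist_eq_mkQ, infDist_eq_mkQ, map_add]
      have : M.mkQ v = 0 := by simpa using hVM hv
      rw [this, add_zero]
    rw [h1]
    have h2 := gap_bound N M y hy
    have h3 : A * ‖v‖ ≤ ‖y + v‖ := by
      refine (hV v hv).trans ?_
      have := infDist_le_sub N v (-y) (N.neg_mem hy)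
      have h4 : v - -y = y + v := by abel
      rwa [h4] at this
    have h5 : ‖y‖ ≤ ‖y + v‖ + ‖v‖ := by simpa using norm_sub_le (y + v) v
    have h6 : A * ‖y‖ ≤ (1 + A) * ‖y + v‖ := by nlinarith
    have h7 : gapSub N M * (1 + A) / A * ‖y + v‖ = gapSub N M * ((1 + A) * ‖y + v‖ / A) := by ring
    rw [h7]
    refine h2.trans (mul_le_mul_of_nonneg_left ?_ hg)
    rw [le_div_iff₀ hA]
    linarith
  · apply gap_le _ _ _ zero_le_one
    intro x _
    simpa using infDist_le_norm M x

/-- Splitting theorem, part (a): existence of a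
finite-dimensional subspace `V_k` of `M` transversal to `N` with quantitative
gap bounds. -/
theorem splitting_theorem {X : Type*} [NormedAddCommGroup X] [NormedSpace ℂ X]
    [CompleteSpace X] (M N L S : Submodule ℂ X)
    (hMc : IsClosed (M : Set X)) (hNc : IsClosed (N : Set X))
    (hLc : IsClosed (L : Set X)) (hSc : IsClosed (S : Set X))
    (hLS : L ⊓ S = ⊥) (hM : L ⊔ S = M)
    (n : ℕ) (hSfin : FiniteDimensional ℂ S) (hSdim : Module.finrank ℂ S = n)
    (a : ℝ) (ha : a ∈ Set.Ioo (0 : ℝ) (Real.sqrt 2 - 1))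
    (aseq : ℕ → ℝ) (haseq0 : aseq 0 = 1)
    (haseq : ∀ i : ℕ, 1 ≤ i → aseq i = a ^ i / (i * (1 + a) ^ (i - 1)))
    (δseq : ℕ → ℝ) (hδseq0 : δseq 0 = gapSub N M)
    (hδseq : ∀ i : ℕ, 1 ≤ i → δseq i = min (gapSub N M * (1 + aseq i) / aseq i) 1)
    (hcond : (1 + δseq (n + 1)) * (1 + gapSub L N * (minGap L S)⁻¹) < 2) :
    ∃ k ≤ n, ∃ Vk : Submodule ℂ X, Vk ≤ M ∧
      FiniteDimensional ℂ Vk ∧ Module.finrank ℂ Vk = k ∧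
      N ⊓ Vk = ⊥ ∧ aseq k ≤ minGap Vk N ∧
      gapSub M (N ⊔ Vk) ≤ a ∧ gapSub (N ⊔ Vk) M ≤ δseq k := by
  obtain ⟨ha0, _⟩ := ha
  have hApos : ∀ i, 0 < aseq i := by
    intro i
    rcases Nat.eq_zero_or_pos i with rfl | hi
    · rw [haseq0]; exact one_pos
    · rw [haseq i hi]
      have : (0 : ℝ) < i := by exact_mod_cast hi
      positivity
  have hrec : ∀ i, 1 ≤ i → aseq (i + 1) * ((1 + a) + aseq i) ≤ a * aseq i := by
    intro i hi
    obtain ⟨j, rfl⟩ : ∃ j, i = j + 1 := ⟨i - 1, by omega⟩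
    rw [haseq _ hi, haseq _ (by omega)]
    simp only [Nat.add_sub_cancel]
    push_cast
    have hj : (0 : ℝ) < (j : ℝ) + 1 := by positivity
    have hp : a ^ (j + 1) ≤ (1 + a) ^ (j + 1) := by gcongr; linarith
    have hq : (0 : ℝ) < (1 + a) ^ j := by positivity
    have h1 : (1 + a) + a ^ (j + 1) / (((j : ℝ) + 1) * (1 + a) ^ j) ≤
        (((j : ℝ) + 1 + 1) * (1 + a) ^ (j + 1)) / (((j : ℝ) + 1) * (1 + a) ^ j) := by
      rw [le_div_iff₀ (by positivity), add_mul, div_mul_cancel₀ _ (by positivity)]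
      have h2 : (1 + a) * (((j : ℝ) + 1) * (1 + a) ^ j) = ((j : ℝ) + 1) * (1 + a) ^ (j + 1) := by
        rw [pow_succ]; ring
      rw [h2]
      linarith
    refine (mul_le_mul_of_nonneg_left h1 (by positivity)).trans (le_of_eq ?_)
    field_simp
    try ring
  by_contra! hcon
  have hind : ∀ k, k ≤ n + 1 → ∃ V : Submodule ℂ X, V ≤ M ∧ FiniteDimensional ℂ V ∧
      Module.finrank ℂ V = k ∧ ∀ v ∈ V, aseq k * ‖v‖ ≤ Metric.infDist v (N : Set X) := by
    intro k
    induction k with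
    | zero =>
      intro _
      refine ⟨⊥, bot_le, inferInstance, by simp, ?_⟩
      intro v hv
      rw [Submodule.mem_bot] at hv
      subst hv
      simpa using Metric.infDist_nonneg
    | succ k ih =>
      intro hk
      obtain ⟨V, hVM, hVf, hVd, hV⟩ := ih (by omega)
      have hNV : N ⊓ V = ⊥ := by
        rw [eq_bot_iff]
        intro v hv
        have h1 := hV v hv.2
        rw [Metric.infDist_zero_of_mem hv.1] at h1
        have h2 : ‖v‖ ≤ 0 := by
          by_contra! h3
          have := mul_pos (hApos k) h3
          linarith
        simpa using h2
      have hmg : aseq k ≤ minGap V N := by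
        apply le_minGap V N hNV _ _ hV
        intro hle
        have hV0 : V = ⊥ := by rw [← hNV, inf_eq_right.2 hle]
        rw [hV0, finrank_bot] at hVd
        rw [← hVd, haseq0]
      have hgk : gapSub (N ⊔ V) M ≤ δseq k := by
        rcases Nat.eq_zero_or_pos k with rfl | hkpos
        · have hV0 : V = ⊥ := Submodule.finrank_eq_zero.1 hVd
          rw [hV0, sup_bot_eq, hδseq0]
        · rw [hδseq k hkpos]
          exact sum_gap M N V hVM _ (hApos k) hV
      have hgap : a < gapSub M (N ⊔ V) := by
        by_contra! h1
        exact absurd hgk (not_le.2 (hcon k (by omega) V hVM hVf hVd hNV hmg h1))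
      obtain ⟨u, huM, hu1, hua⟩ := exists_of_lt_gap _ _ a ha0.le hgap
      have huV : u ∉ V := by
        intro hu
        rw [Metric.infDist_zero_of_mem (Submodule.mem_sup_right hu : u ∈ N ⊔ V)] at hua
        linarith
      have hu0 : u ≠ 0 := by rintro rfl; exact huV V.zero_mem
      refine ⟨V ⊔ Submodule.span ℂ {u}, sup_le hVM ?_, inferInstance, ?_, ?_⟩
      · rw [Submodule.span_singleton_le_iff_mem]; exact huM
      · have h1 := Submodule.finrank_sup_add_finrank_inf_eq V (Submodule.span ℂ {u})
        have h2 : V ⊓ Submodule.span ℂ {u} = ⊥ := by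
          rw [← disjoint_iff]
          exact (Submodule.disjoint_span_singleton' hu0).2 huV
        rw [h2, finrank_bot, finrank_span_singleton hu0, hVd] at h1
        simpa using h1
      · intro v hv
        apply step_bound N V a (aseq k) (aseq (k + 1)) ha0 (hApos k) (hApos _) hV u hu1 hua.le _ v hv
        rcases Nat.eq_zero_or_pos k with rfl | hkpos
        · left
          refine ⟨Submodule.finrank_eq_zero.1 hVd, ?_⟩
          rw [haseq 1 le_rfl]; simp
        · right
          exact hrec k hkpos
  obtain ⟨V, hVM, hVf, hVd, hV⟩ := hind (n + 1) le_rfl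
  have hsum := sum_gap M N V hVM _ (hApos (n + 1)) hV
  rw [← hδseq (n + 1) (by omega)] at hsum
  have hγ := minGap_pos L S hLc hLS
  set γ := minGap L S with hγdef
  set ε := gapSub L N with hεdef
  set δ' := δseq (n + 1) with hδ'
  have hδ0 : 0 ≤ δ' := (gap_nonneg _ _).trans hsum
  have hε0 : 0 ≤ ε := gap_nonneg _ _
  have hε' : 0 ≤ ε * γ⁻¹ := by positivity
  -- every vector of `M` is close to `N + S`
  have hMNS : ∀ x ∈ M, Metric.infDist x ((N ⊔ S : Submodule ℂ X) : Set X) ≤ ε * γ⁻¹ * ‖x‖ := by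
    intro x hx
    rw [← hM] at hx
    obtain ⟨l, hl, s, hs, rfl⟩ := Submodule.mem_sup.1 hx
    have h1 : Metric.infDist (l + s) ((N ⊔ S : Submodule ℂ X) : Set X)
        ≤ Metric.infDist l (N : Set X) := by
      rw [Metric.le_infDist (sub_nonempty N)]
      intro y hy
      rw [dist_eq_norm]
      have := infDist_le_sub (N ⊔ S) (l + s) (y + s) (Submodule.add_mem _
        (Submodule.mem_sup_left hy) (Submodule.mem_sup_right hs))
      rwa [add_sub_add_right_eq_sub] at this
    have h2 := gap_bound L N l hl
    have h3 := minGap_bound L S hLS l hl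
    have h4 := infDist_le_sub S l (-s) (S.neg_mem hs)
    rw [sub_neg_eq_add] at h4
    have h5 : ‖l‖ ≤ γ⁻¹ * ‖l + s‖ := by
      rw [le_inv_mul_iff₀ hγ]; linarith
    calc _ ≤ ε * ‖l‖ := h1.trans h2
      _ ≤ ε * (γ⁻¹ * ‖l + s‖) := by gcongr
      _ = _ := by ring
  apply dim_lemma N V S n hVd hSdim _ (δ' + (1 + δ') * (ε * γ⁻¹)) (by positivity) (by linarith)
  · intro x hx
    apply le_of_forall_pos_le_add
    intro η hη
    have h1 := gap_bound (N ⊔ V) M x hx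
    have h2 : Metric.infDist x (M : Set X) ≤ δ' * ‖x‖ :=
      h1.trans (mul_le_mul_of_nonneg_right hsum (norm_nonneg _))
    set θ := η / (1 + ε * γ⁻¹) with hθ
    have hθ0 : 0 < θ := by positivity
    obtain ⟨z, hz, hzd⟩ := (Metric.infDist_lt_iff (sub_nonempty M)).1
      (lt_of_le_of_lt h2 (lt_add_of_pos_right _ hθ0))
    have h3 := hMNS z hz
    have h4 := Metric.infDist_le_infDist_add_dist (s := ((N ⊔ S : Submodule ℂ X) : Set X))
      (x := x) (y := z)
    rw [dist_eq_norm] at hzd h4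
    have h5 : ‖z‖ ≤ ‖x‖ + ‖x - z‖ := by simpa using norm_sub_le x (x - z)
    have h6 : ε * γ⁻¹ * ‖z‖ ≤ ε * γ⁻¹ * (‖x‖ + (δ' * ‖x‖ + θ)) := by
      gcongr; linarith
    have h7 : (1 + ε * γ⁻¹) * θ = η := by rw [hθ]; field_simp
    nlinarith
  · intro v hv hv0
    have h1 := hV v hv
    have h2 := mul_pos (hApos (n + 1)) (norm_pos_iff.2 hv0)
    linarith
end

section
/- Let X be a complex Banach space with a bounded symmetric pair (Q,V), let V₀ ⊆ V^Q be a closed linear subspace of X, let h ∈ {1,−1} and c ≥ 0 be real numbers. Let α be a closed linear subspace of V on which hQ is positive semi-definite, and let β be a closed linear subspace of V on which hQ is negative semi-definite with β^{Q|_β} = V₀ and reduced minimum modulus γ(Q|_β) > 0, such that V = α ⊕ β is a Q-orthogonal direct sum decomposition. Then there exists ε > 0 such that for every bounded symmetric pair (R,W) of X and every closed linear subspace W₀ ⊆ W^R with δ̂(V,W) < ε, δ(V₀,W₀) < ε and δ_c(Q,R) < ε, one has m⁺(hR) + dim(W^R/W₀) ≤ dim α. -/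
open scoped Classical

/-- A bounded symmetric pair `(Q, V)` of a Banach space `X`: a closed subspace
`V ⊆ X` together with a bounded Hermitian-symmetric sesquilinear form
`Q : V × V → ℂ` (represented by a total function on `X × X`, constrained only
on `V`). -/
structure BddSymPair (X : Type*) [NormedAddCommGroup X] [NormedSpace ℂ X] where
  V : Submodule ℂ X
  closed : IsClosed (V : Set X)
  Q : X → X → ℂ
  add_left : ∀ x y z : X, x ∈ V → y ∈ V → z ∈ V → Q (x + y) z = Q x z + Q y z
  smul_left : ∀ (c : ℂ) (x z : X), x ∈ V → z ∈ V →
    Q (c • x) z = (starRingEnd ℂ) c * Q x z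
  isSymm : ∀ x y : X, x ∈ V → y ∈ V → Q x y = (starRingEnd ℂ) (Q y x)
  bounded : ∃ C : ℝ, ∀ x y : X, x ∈ V → y ∈ V → ‖Q x y‖ ≤ C * ‖x‖ * ‖y‖

/-- The annihilator `{u ∈ dom | Q(u, v) = 0 for all v ∈ lam}` of `lam` inside
`dom` with respect to the form `Q` of the pair `P` (for `dom, lam ≤ P.V`;
in general the carrier is cut down to `dom ⊓ P.V` and only `v ∈ lam ⊓ P.V`
are tested, so that the sesquilinearity of `Q` applies). -/
def BddSymPair.ann {X : Type*} [NormedAddCommGroup X] [NormedSpace ℂ X]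
    (P : BddSymPair X) (dom lam : Submodule ℂ X) : Submodule ℂ X where
  carrier := {u : X | u ∈ dom ⊓ P.V ∧ ∀ v : X, v ∈ lam → v ∈ P.V → P.Q u v = 0}
  add_mem' := by
    rintro a b ⟨haV, ha⟩ ⟨hbV, hb⟩
    obtain ⟨-, haV2⟩ := Submodule.mem_inf.mp haV
    obtain ⟨-, hbV2⟩ := Submodule.mem_inf.mp hbV
    exact ⟨add_mem haV hbV, fun v hv hv' => by
      rw [P.add_left a b v haV2 hbV2 hv', ha v hv hv', hb v hv hv', add_zero]⟩
  zero_mem' := by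
    refine ⟨zero_mem _, fun v hv hv' => ?_⟩
    have h := P.smul_left 0 0 v (Submodule.zero_mem _) hv'
    simpa using h
  smul_mem' := by
    rintro c a ⟨haV, ha⟩
    obtain ⟨-, haV2⟩ := Submodule.mem_inf.mp haV
    exact ⟨Submodule.smul_mem _ _ haV, fun v hv hv' => by
      rw [P.smul_left c a v haV2 hv', ha v hv hv', mul_zero]⟩

/-- The reduced minimum modulus `γ(Q|_β)` of the restriction of the form of
`P` to `β`: the infimum of `|Q(x,x)| / dist(x, β^{Q|_β})²` over
`x ∈ β ∖ β^{Q|_β}`. -/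
noncomputable def redMin {X : Type*} [NormedAddCommGroup X] [NormedSpace ℂ X]
    (P : BddSymPair X) (β : Submodule ℂ X) : ℝ :=
  sInf ((fun x => ‖P.Q x x‖ / (Metric.infDist x ((P.ann β β : Submodule ℂ X) : Set X)) ^ 2) ''
    {x : X | x ∈ β ∧ x ∉ P.ann β β})

/-- The `c`-gap `δ_c(Q, R)` between two bounded symmetric pairs. -/
noncomputable def cGap {X : Type*} [NormedAddCommGroup X] [NormedSpace ℂ X]
    (P R : BddSymPair X) (c : ℝ) : ℝ :=
  sInf {d : ℝ | 0 ≤ d ∧ ∀ x y u v : X, x ∈ P.V → y ∈ P.V → u ∈ R.V → v ∈ R.V →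
    ‖P.Q x y - R.Q u v‖ ≤ d * ((‖u‖ + ‖x‖) * (‖v‖ + ‖y‖)) +
      c * ((‖u‖ + ‖x‖) * ‖v - y‖ + ‖u - x‖ * (‖v‖ + ‖y‖))}

/-- The Morse positive index `m⁺(h·Q)` of a bounded symmetric pair: the
supremum of the dimensions of the subspaces of `V` on which `h·Q` is positive
definite. -/
noncomputable def morsePos {X : Type*} [NormedAddCommGroup X] [NormedSpace ℂ X]
    (P : BddSymPair X) (h : ℝ) : Cardinal :=
  sSup {c : Cardinal | ∃ γ : Submodule ℂ X, γ ≤ P.V ∧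
    (∀ x ∈ γ, x ≠ 0 → 0 < h * (P.Q x x).re) ∧ c = Module.rank ℂ ↥γ}

universe u

theorem aux_riesz_family {M : Type*} [NormedAddCommGroup M] [NormedSpace ℂ M] (n : ℕ) :
    (n : Cardinal) ≤ Module.rank ℂ M →
      ∃ u : Fin n → M, (∀ i, ‖u i‖ < 1) ∧
        ∀ t : Fin n → ℂ, (1 / 8 : ℝ) ^ n * ∑ i, ‖t i‖ ≤ ‖∑ i, t i • u i‖ := by
  induction n with
  | zero => intro _; exact ⟨fun i => i.elim0, fun i => i.elim0, fun t => by simp⟩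
  | succ n ih =>
    intro hn
    obtain ⟨u, hu, hut⟩ := ih (le_trans (by exact_mod_cast Nat.le_succ n) hn)
    set F : Submodule ℂ M := Submodule.span ℂ (Set.range u) with hF
    have hFfin : FiniteDimensional ℂ F := FiniteDimensional.span_of_finite ℂ (Set.finite_range u)
    have hFc : IsClosed (F : Set M) := F.closed_of_finiteDimensional
    have hFne : ∃ x : M, x ∉ F := by
      by_contra hcon
      push Not at hcon
      have htop : F = ⊤ := by rw [eq_top_iff]; intro x _; exact hcon x
      have h1 : Module.rank ℂ F = Module.rank ℂ M := by rw [htop, rank_top]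
      have h2 : Module.rank ℂ F ≤ n := by
        rw [← Module.finrank_eq_rank]
        have := finrank_range_le_card (R := ℂ) u
        rw [Fintype.card_fin] at this
        exact_mod_cast this
      have h3 : ((n + 1 : ℕ) : Cardinal) ≤ n := hn.trans (h1 ▸ h2)
      have h4 : n + 1 ≤ n := by exact_mod_cast h3
      omega
    obtain ⟨x₀, hx₀, hr⟩ := riesz_lemma hFc hFne (r := 1 / 2) (by norm_num)
    have hx₀0 : x₀ ≠ 0 := fun h0 => hx₀ (h0 ▸ F.zero_mem)
    have hnx : 0 < ‖x₀‖ := norm_pos_iff.mpr hx₀0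
    set w : M := ((1 / (2 * ‖x₀‖) : ℝ) : ℂ) • x₀ with hw
    have hwn : ‖w‖ = 1 / 2 := by
      rw [hw, norm_smul, Complex.norm_real, Real.norm_of_nonneg (by positivity)]
      field_simp
    have hwd : ∀ (s : ℂ), ∀ y ∈ F, ‖s‖ / 4 ≤ ‖y + s • w‖ := by
      intro s y hy
      by_cases hs : s = 0
      · simp [hs]
      have hk : s * ((1 / (2 * ‖x₀‖) : ℝ) : ℂ) ≠ 0 := by
        apply mul_ne_zero hs
        exact_mod_cast (by positivity : (1 / (2 * ‖x₀‖) : ℝ) ≠ 0)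
      set k := s * ((1 / (2 * ‖x₀‖) : ℝ) : ℂ) with hkd
      have h1 := hr (-(k⁻¹ • y)) (F.neg_mem (F.smul_mem _ hy))
      have h2 : y + s • w = k • (x₀ - -(k⁻¹ • y)) := by
        rw [sub_neg_eq_add, smul_add, smul_inv_smul₀ hk, hw, smul_smul, add_comm]
      have hkn : ‖k‖ = ‖s‖ * (1 / (2 * ‖x₀‖)) := by
        rw [hkd, norm_mul, Complex.norm_real, Real.norm_of_nonneg (by positivity)]
      rw [h2, norm_smul]
      calc ‖s‖ / 4 = ‖k‖ * (1 / 2 * ‖x₀‖) := by rw [hkn]; field_simp; norm_num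
        _ ≤ _ := by gcongr
    refine ⟨Fin.snoc u w, ?_, ?_⟩
    · intro i
      refine Fin.lastCases ?_ (fun j => ?_) i
      · simp [hwn]; norm_num
      · simpa using hu j
    · intro t
      rw [Fin.sum_univ_castSucc, Fin.sum_univ_castSucc]
      simp only [Fin.snoc_castSucc, Fin.snoc_last]
      set y := ∑ i : Fin n, t i.castSucc • u i with hy
      have hyF : y ∈ F := F.sum_mem fun i _ => F.smul_mem _ (Submodule.subset_span ⟨i, rfl⟩)
      have h1 := hut (fun i => t i.castSucc)
      rw [← hy] at h1
      set T := ∑ i : Fin n, ‖t i.castSucc‖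
      have hT : 0 ≤ T := Finset.sum_nonneg fun i _ => norm_nonneg _
      have h2 := hwd (t (Fin.last n)) y hyF
      set s := t (Fin.last n)
      have h3 : ‖y‖ ≤ ‖y + s • w‖ + ‖s‖ / 2 := by
        have : ‖s • w‖ = ‖s‖ / 2 := by rw [norm_smul, hwn]; ring
        rw [← this]
        have := norm_sub_le (y + s • w) (s • w)
        simpa using this
      have hη : (1 / 8 : ℝ) ^ n ≤ 1 := pow_le_one₀ (by norm_num) (by norm_num)
      have hη0 : 0 < (1 / 8 : ℝ) ^ n := by positivity
      rw [pow_succ]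
      set η := (1 / 8 : ℝ) ^ n
      have : η * ‖s‖ ≤ ‖s‖ := mul_le_of_le_one_left (norm_nonneg _) hη
      have : 0 ≤ η * T := by positivity
      nlinarith

theorem aux_continuum_le_rank {E : Type*} [NormedAddCommGroup E] [NormedSpace ℂ E]
    [CompleteSpace E] (hE : ¬ FiniteDimensional ℂ E) : Cardinal.continuum ≤ Module.rank ℂ E := by
  obtain ⟨p, hp, hpr⟩ := exists_seq_of_forall_finset_exists
    (fun p : E × (E →L[ℂ] ℂ) => ‖p.1‖ ≤ 1 ∧ p.2 p.1 ≠ 0) (fun p q => p.2 q.1 = 0) (by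
      intro s _
      let L : E →ₗ[ℂ] (s → ℂ) := LinearMap.pi fun q => (q.1.2 : E →ₗ[ℂ] ℂ)
      have hL : ¬ Function.Injective L := fun hi => hE (Module.Finite.of_injective L hi)
      rw [← LinearMap.ker_eq_bot, Submodule.eq_bot_iff] at hL
      push Not at hL
      obtain ⟨y, hy, hy0⟩ := hL
      have hny : (‖y‖ : ℂ) ≠ 0 := by simpa using hy0
      obtain ⟨g, -, hg⟩ := exists_dual_vector ℂ y (norm_ne_zero_iff.mpr hy0)
      refine ⟨(((‖y‖ : ℂ)⁻¹) • y, g), ⟨?_, ?_⟩, ?_⟩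
      · simp [norm_smul, hy0]
      · simp [hg, hy0]
      · intro q hq
        have : L y ⟨q, hq⟩ = 0 := by rw [LinearMap.mem_ker.mp hy]; rfl
        have h' : q.2 y = 0 := this
        simp [h'])
  let v : Set.Ioo (0 : ℝ) 1 → E := fun t => ∑' n : ℕ, ((t : ℝ) : ℂ) ^ n • (p n).1
  have hsum : ∀ t : Set.Ioo (0 : ℝ) 1, Summable fun n : ℕ => ((t : ℝ) : ℂ) ^ n • (p n).1 := by
    intro t
    refine Summable.of_norm_bounded (summable_geometric_of_lt_one t.2.1.le t.2.2) fun n => ?_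
    rw [norm_smul, norm_pow, Complex.norm_real, Real.norm_of_nonneg t.2.1.le]
    exact mul_le_of_le_one_right (pow_nonneg t.2.1.le n) (hp n).1
  have hv : LinearIndependent ℂ v := by
    rw [linearIndependent_iff']
    intro s g hg
    have hS : HasSum (fun n : ℕ => (∑ i ∈ s, g i * ((i : ℝ) : ℂ) ^ n) • (p n).1) 0 := by
      rw [← hg]
      have := hasSum_sum (s := s) (fun i _ => ((hsum i).hasSum).const_smul (g i))
      refine this.congr_fun ?_ |> fun h => h
      intro n
      simp [Finset.sum_smul, smul_smul]
    have ha : ∀ n : ℕ, ∑ i ∈ s, g i * ((i : ℝ) : ℂ) ^ n = 0 := by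
      intro n
      induction n using Nat.strong_induction_on with
      | _ n ih =>
        have h1 := hS.mapL (p n).2
        have h2 := hasSum_single (f := fun m : ℕ => (p n).2 ((∑ i ∈ s, g i * ((i : ℝ) : ℂ) ^ m) • (p m).1)) n (by
          intro m hm
          rcases lt_or_gt_of_ne hm with hm | hm
          · simp [ih m hm]
          · simp [hpr n m hm])
        have h3 := h1.unique h2
        simp only [map_zero, map_smul, smul_eq_mul] at h3
        exact (mul_eq_zero.mp h3.symm).resolve_right (hp n).2
    have hinj : Function.Injective
        (fun t : Set.Ioo (0 : ℝ) 1 => (powersHom ℂ ((t : ℝ) : ℂ))) := by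
      intro a b hab
      have := (powersHom ℂ).injective hab
      exact Subtype.ext (by exact_mod_cast this)
    have hli := (linearIndependent_monoidHom (Multiplicative ℕ) ℂ).comp _ hinj
    rw [linearIndependent_iff'] at hli
    refine hli s g ?_
    ext n
    have := ha n.toAdd
    simpa [Finset.sum_apply] using this
  have := hv.cardinal_lift_le_rank
  rw [Cardinal.mk_Ioo_real (by norm_num)] at this
  simpa using this

theorem aux_rank_le_of_separated {E M : Type u} [NormedAddCommGroup E] [NormedSpace ℂ E]
    [CompleteSpace E] [NormedAddCommGroup M] [NormedSpace ℂ M]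
    (hE : ¬ FiniteDimensional ℂ E) (f : M → E) (K κ : ℝ) (hκ : 0 < κ)
    (hfK : ∀ m, ‖m‖ < 1 → ‖f m‖ ≤ K)
    (hfκ : ∀ m m', ‖m‖ < 1 → ‖m'‖ < 1 → 1 / 4 ≤ ‖m - m'‖ → κ ≤ ‖f m - f m'‖) :
    Module.rank ℂ M ≤ Module.rank ℂ E := by
  have hK0 : 0 ≤ K := (norm_nonneg _).trans (hfK 0 (by simp))
  -- a maximal separated set
  obtain ⟨D, hDmax⟩ := zorn_subset
    {D : Set M | (∀ d ∈ D, ‖d‖ < 1) ∧ ∀ d ∈ D, ∀ d' ∈ D, d ≠ d' → 1 / 4 ≤ ‖d - d'‖} (by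
      intro C hC hchain
      refine ⟨⋃₀ C, ⟨?_, ?_⟩, fun s hs => Set.subset_sUnion_of_mem hs⟩
      · rintro d ⟨s, hs, hd⟩
        exact (hC hs).1 d hd
      · rintro d ⟨s, hs, hd⟩ d' ⟨s', hs', hd'⟩ hne
        rcases hchain.total hs hs' with hss | hss
        · exact (hC hs').2 d (hss hd) d' hd' hne
        · exact (hC hs).2 d hd d' (hss hd') hne)
  obtain ⟨⟨hD1, hD2⟩, hDm⟩ := hDmax
  have hnear : ∀ v : M, ‖v‖ < 1 → ∃ d ∈ D, ‖v - d‖ < 1 / 4 := by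
    intro v hv
    by_contra hcon
    push Not at hcon
    have hvD : v ∉ D := fun hvD => by have := hcon v hvD; simp at this; linarith
    have : insert v D ⊆ D := hDm (y := insert v D) ⟨by
        rintro d (rfl | hd)
        · exact hv
        · exact hD1 d hd, by
        rintro d (rfl | hd) d' (rfl | hd') hne
        · exact absurd rfl hne
        · exact hcon d' hd'
        · rw [norm_sub_rev]; exact hcon d hd
        · exact hD2 d hd d' hd' hne⟩ (Set.subset_insert v D)
    exact hvD (this (Set.mem_insert v D))
  let B := {v : M // ‖v‖ < 1}
  choose dd hddD hdd using hnear
  let nxt : B → B := fun v => ⟨(4 : ℂ) • (v.1 - dd v.1 v.2), by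
    rw [norm_smul]
    have := hdd v.1 v.2
    simp
    linarith⟩
  let code : B → ℕ → D := fun v k => ⟨dd (nxt^[k] v).1 (nxt^[k] v).2, hddD _ _⟩
  have hcode : Function.Injective code := by
    intro v w hvw
    have h1 : ∀ k : ℕ, ((4 : ℂ) ^ k) • (v.1 - w.1) = (nxt^[k] v).1 - (nxt^[k] w).1 := by
      intro k
      induction k with
      | zero => simp
      | succ k ih =>
        have h2 : dd (nxt^[k] v).1 (nxt^[k] v).2 = dd (nxt^[k] w).1 (nxt^[k] w).2 :=
          congrArg Subtype.val (congrFun hvw k)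
        rw [Function.iterate_succ_apply', Function.iterate_succ_apply', pow_succ', mul_smul, ih]
        change _ = (4 : ℂ) • (_ - _) - (4 : ℂ) • (_ - _)
        rw [h2, ← smul_sub]
        congr 1
        abel
    have h2 : ∀ k : ℕ, (4 : ℝ) ^ k * ‖v.1 - w.1‖ ≤ 2 := by
      intro k
      have h3 := congrArg norm (h1 k)
      rw [norm_smul, norm_pow] at h3
      have h4 := norm_sub_le (nxt^[k] v).1 (nxt^[k] w).1
      have := (nxt^[k] v).2
      have := (nxt^[k] w).2
      have h5 : ‖(4 : ℂ)‖ = 4 := by simp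
      rw [h5] at h3
      linarith
    apply Subtype.ext
    by_contra hne
    have hpos : 0 < ‖v.1 - w.1‖ := norm_pos_iff.mpr (sub_ne_zero.mpr hne)
    obtain ⟨k, hk⟩ := pow_unbounded_of_one_lt (2 / ‖v.1 - w.1‖) (by norm_num : (1 : ℝ) < 4)
    rw [div_lt_iff₀ hpos] at hk
    linarith [h2 k]
  -- sequences in D embed into E
  obtain ⟨r, hr0, hr1, hr2⟩ : ∃ r : ℝ, 0 < r ∧ r ≤ 1 / 2 ∧ 4 * K * r < κ := by
    refine ⟨min (1 / 2) (κ / (4 * K + 1) / 2), by positivity, min_le_left _ _, ?_⟩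
    have h1 : min (1 / 2) (κ / (4 * K + 1) / 2) ≤ κ / (4 * K + 1) / 2 := min_le_right _ _
    have h2 : 4 * K * (κ / (4 * K + 1) / 2) < κ := by
      have : κ / (4 * K + 1) * (4 * K + 1) = κ := by field_simp
      have : 0 < κ / (4 * K + 1) := by positivity
      nlinarith
    exact lt_of_le_of_lt (mul_le_mul_of_nonneg_left h1 (by positivity)) h2
  have hrc : ‖(r : ℂ)‖ = r := by rw [Complex.norm_real, Real.norm_of_nonneg hr0.le]
  have hbd : ∀ (s : ℕ → D) (k : ℕ), ‖(r : ℂ) ^ k • f (s k)‖ ≤ (1 / 2 : ℝ) ^ k * K := by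
    intro s k
    rw [norm_smul, norm_pow, hrc]
    gcongr
    exact hfK _ (hD1 _ (s k).2)
  have hgs : HasSum (fun k : ℕ => (1 / 2 : ℝ) ^ k * K) (2 * K) := by
    have := (hasSum_geometric_two).mul_right K
    exact this
  have hsm : ∀ s : ℕ → D, Summable fun k => (r : ℂ) ^ k • f (s k) := fun s =>
    Summable.of_norm_bounded hgs.summable (hbd s)
  let Φ : (ℕ → D) → E := fun s => ∑' k, (r : ℂ) ^ k • f (s k)
  have hΦn : ∀ s, ‖Φ s‖ ≤ 2 * K := fun s => tsum_of_norm_bounded hgs (hbd s)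
  have hΦr : ∀ s : ℕ → D, Φ s = f (s 0) + (r : ℂ) • Φ (fun k => s (k + 1)) := by
    intro s
    change ∑' k, (r : ℂ) ^ k • f (s k) = _
    rw [(hsm s).tsum_eq_zero_add]
    simp only [pow_zero, one_smul]
    congr 1
    rw [← (hsm fun k => s (k + 1)).tsum_const_smul]
    refine tsum_congr fun k => ?_
    rw [pow_succ', mul_smul]
  have hstep : ∀ s s' : ℕ → D, Φ s = Φ s' →
      s 0 = s' 0 ∧ Φ (fun k => s (k + 1)) = Φ (fun k => s' (k + 1)) := by
    intro s s' hss
    have h1 := hss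
    rw [hΦr s, hΦr s'] at h1
    have h0 : s 0 = s' 0 := by
      by_contra hne
      have h2 := hfκ _ _ (hD1 _ (s 0).2) (hD1 _ (s' 0).2)
        (hD2 _ (s 0).2 _ (s' 0).2 (fun h => hne (Subtype.ext h)))
      have h3 : f (s 0) - f (s' 0) =
          (r : ℂ) • (Φ (fun k => s' (k + 1)) - Φ (fun k => s (k + 1))) := by
        rw [smul_sub, sub_eq_sub_iff_add_eq_add, h1, add_comm]
      rw [h3, norm_smul, hrc] at h2
      have h4 := norm_sub_le (Φ (fun k => s' (k + 1))) (Φ (fun k => s (k + 1)))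
      have h5 := hΦn (fun k => s' (k + 1))
      have h6 := hΦn (fun k => s (k + 1))
      nlinarith
    refine ⟨h0, ?_⟩
    rw [h0] at h1
    have h2 := add_left_cancel h1
    exact smul_right_injective E (by exact_mod_cast hr0.ne' : (r : ℂ) ≠ 0) h2
  have hΦ : Function.Injective Φ := by
    intro s s' hss
    have : ∀ k : ℕ, ∀ s s' : ℕ → D, Φ s = Φ s' → s k = s' k := by
      intro k
      induction k with
      | zero => intro s s' h; exact (hstep s s' h).1
      | succ k ih => intro s s' h; exact ih _ _ (hstep s s' h).2
    exact funext fun k => this k s s' hss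
  have hB : Cardinal.mk B ≤ Cardinal.mk E := Cardinal.mk_le_of_injective (hΦ.comp hcode)
  have hBM : Cardinal.mk B = Cardinal.mk M := by
    have := cardinal_eq_of_mem_nhds_zero ℂ (Metric.ball_mem_nhds (0 : M) one_pos)
    rw [← this]
    refine Cardinal.mk_congr (Equiv.subtypeEquivRight fun v => ?_)
    simp
  have hEr : Cardinal.mk E ≤ Module.rank ℂ E := by
    have hcont := aux_continuum_le_rank hE
    let b := Module.Basis.ofVectorSpace ℂ E
    have hb := b.mk_eq_rank''
    rw [Cardinal.mk_congr b.repr.toEquiv]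
    have hinf : Infinite (Module.Basis.ofVectorSpaceIndex ℂ E) := by
      rw [Cardinal.infinite_iff, hb]
      exact Cardinal.aleph0_le_continuum.trans hcont
    rw [Cardinal.mk_finsupp_lift_of_infinite, hb]
    simpa [Cardinal.mk_complex] using hcont
  calc Module.rank ℂ M ≤ Cardinal.mk M := rank_le_card ℂ M
    _ ≤ _ := hBM ▸ hB
    _ ≤ _ := hEr

theorem aux_infDist_le_gap {X : Type*} [NormedAddCommGroup X] [NormedSpace ℂ X]
    (M N : Submodule ℂ X) {u : X} (hu : u ∈ M) :
    Metric.infDist u (N : Set X) ≤ gapSub M N * ‖u‖ := by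
  by_cases h0 : u = 0
  · subst h0
    rw [Metric.infDist_zero_of_mem N.zero_mem]; simp
  have hn : 0 < ‖u‖ := norm_pos_iff.mpr h0
  set w : X := ((‖u‖⁻¹ : ℝ) : ℂ) • u with hw
  have hwM : w ∈ M := M.smul_mem _ hu
  have hwn : ‖w‖ = 1 := by
    rw [hw, norm_smul, Complex.norm_real, Real.norm_of_nonneg (by positivity)]
    field_simp
  have hle : Metric.infDist w (N : Set X) ≤ gapSub M N := by
    apply le_csSup
    · refine ⟨1, ?_⟩
      rintro _ ⟨v, ⟨_, hv⟩, rfl⟩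
      have := Metric.infDist_le_dist_of_mem (x := v) N.zero_mem
      simpa [hv] using this
    · exact ⟨w, ⟨hwM, hwn⟩, rfl⟩
  refine le_of_forall_pos_le_add fun e he => ?_
  have h1 : Metric.infDist w (N : Set X) < gapSub M N + e / ‖u‖ := by
    have : 0 < e / ‖u‖ := by positivity
    linarith
  obtain ⟨z, hz, hzd⟩ := (Metric.infDist_lt_iff ⟨0, N.zero_mem⟩).mp h1
  have h2 : u = ((‖u‖ : ℝ) : ℂ) • w := by
    rw [hw, smul_smul, ← Complex.ofReal_mul, mul_inv_cancel₀ hn.ne']; simp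
  have h3 := Metric.infDist_le_dist_of_mem (x := u) (N.smul_mem ((‖u‖ : ℝ) : ℂ) hz)
  refine h3.trans ?_
  have h4 : dist u (((‖u‖ : ℝ) : ℂ) • z) = ‖u‖ * dist w z := by
    conv_lhs => rw [h2]
    rw [dist_eq_norm, dist_eq_norm]
    have h5 : ‖((‖u‖ : ℝ) : ℂ) • w‖ = ‖u‖ := by rw [← h2]
    rw [h5, ← smul_sub, norm_smul, Complex.norm_real, Real.norm_of_nonneg hn.le]
  rw [h4]
  calc ‖u‖ * dist w z ≤ ‖u‖ * (gapSub M N + e / ‖u‖) := by gcongr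
    _ = _ := by field_simp

theorem aux_cGap {X : Type*} [NormedAddCommGroup X] [NormedSpace ℂ X]
    (P R : BddSymPair X) (c ε : ℝ) (hc : 0 ≤ c) (hε : cGap P R c < ε) :
    ∀ x y u v : X, x ∈ P.V → y ∈ P.V → u ∈ R.V → v ∈ R.V →
    ‖P.Q x y - R.Q u v‖ ≤ ε * ((‖u‖ + ‖x‖) * (‖v‖ + ‖y‖)) +
      c * ((‖u‖ + ‖x‖) * ‖v - y‖ + ‖u - x‖ * (‖v‖ + ‖y‖)) := by
  have hne : {d : ℝ | 0 ≤ d ∧ ∀ x y u v : X, x ∈ P.V → y ∈ P.V → u ∈ R.V → v ∈ R.V →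
    ‖P.Q x y - R.Q u v‖ ≤ d * ((‖u‖ + ‖x‖) * (‖v‖ + ‖y‖)) +
      c * ((‖u‖ + ‖x‖) * ‖v - y‖ + ‖u - x‖ * (‖v‖ + ‖y‖))}.Nonempty := by
    obtain ⟨C₁, h₁⟩ := P.bounded
    obtain ⟨C₂, h₂⟩ := R.bounded
    refine ⟨|C₁| + |C₂|, by positivity, fun x y u v hx hy hu hv => ?_⟩
    have a1 := h₁ x y hx hy
    have a2 := h₂ u v hu hv
    have a3 := norm_sub_le (P.Q x y) (R.Q u v)
    have a4 : C₁ * ‖x‖ * ‖y‖ ≤ |C₁| * ((‖u‖ + ‖x‖) * (‖v‖ + ‖y‖)) := by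
      rw [mul_assoc]
      have : ‖x‖ * ‖y‖ ≤ (‖u‖ + ‖x‖) * (‖v‖ + ‖y‖) := by
        gcongr <;> simp
      calc C₁ * (‖x‖ * ‖y‖) ≤ |C₁| * (‖x‖ * ‖y‖) := by gcongr; exact le_abs_self _
        _ ≤ _ := by gcongr
    have a5 : C₂ * ‖u‖ * ‖v‖ ≤ |C₂| * ((‖u‖ + ‖x‖) * (‖v‖ + ‖y‖)) := by
      rw [mul_assoc]
      have : ‖u‖ * ‖v‖ ≤ (‖u‖ + ‖x‖) * (‖v‖ + ‖y‖) := by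
        gcongr <;> simp
      calc C₂ * (‖u‖ * ‖v‖) ≤ |C₂| * (‖u‖ * ‖v‖) := by gcongr; exact le_abs_self _
        _ ≤ _ := by gcongr
    have a6 : 0 ≤ c * ((‖u‖ + ‖x‖) * ‖v - y‖ + ‖u - x‖ * (‖v‖ + ‖y‖)) := by positivity
    linarith
  obtain ⟨d, ⟨_, hd⟩, hdε⟩ := exists_lt_of_csInf_lt hne hε
  intro x y u v hx hy hu hv
  refine (hd x y u v hx hy hu hv).trans ?_
  gcongr

theorem aux_redMin {X : Type*} [NormedAddCommGroup X] [NormedSpace ℂ X]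
    (P : BddSymPair X) (β V₀ : Submodule ℂ X) (hV₀c : IsClosed (V₀ : Set X))
    (hβann : P.ann β β = V₀) {b : X} (hb : b ∈ β) :
    redMin P β * (Metric.infDist b (V₀ : Set X)) ^ 2 ≤ ‖P.Q b b‖ := by
  by_cases hbV : b ∈ V₀
  · rw [Metric.infDist_zero_of_mem hbV]; simp
  have hpos : 0 < Metric.infDist b (V₀ : Set X) :=
    (hV₀c.notMem_iff_infDist_pos ⟨0, V₀.zero_mem⟩).mp hbV
  rw [← le_div_iff₀ (by positivity)]
  apply csInf_le
  · refine ⟨0, ?_⟩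
    rintro _ ⟨x, _, rfl⟩
    positivity
  · refine ⟨b, ⟨hb, by rw [hβann]; exact hbV⟩, ?_⟩
    simp only [hβann]

theorem aux_projection {X : Type*} [NormedAddCommGroup X] [NormedSpace ℂ X] [CompleteSpace X]
    (V α β : Submodule ℂ X) (hV : IsClosed (V : Set X))
    (hαc : IsClosed (α : Set X)) (hβc : IsClosed (β : Set X))
    (hinf : α ⊓ β = ⊥) (hsup : α ⊔ β = V) :
    ∃ π : V →L[ℂ] α, ∀ x : V, (x : X) - (π x : X) ∈ β := by
  have := hV.completeSpace_coe
  have := hαc.completeSpace_coe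
  have := hβc.completeSpace_coe
  have hαV : α ≤ V := hsup ▸ le_sup_left
  have hβV : β ≤ V := hsup ▸ le_sup_right
  let T : (α × β) →L[ℂ] V := (α.subtypeL.coprod β.subtypeL).codRestrict V (by
    rintro ⟨a, b⟩
    simpa using V.add_mem (hαV a.2) (hβV b.2))
  have hT : ∀ p, ((T p : V) : X) = p.1 + p.2 := fun p => by simp [T]
  have hinj : T.ker = ⊥ := by
    rw [Submodule.eq_bot_iff]
    rintro ⟨a, b⟩ hab
    have h0 : (a : X) + b = 0 := by
      have := hT (a, b)
      rw [show T (a, b) = 0 from hab] at this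
      simpa using this.symm
    have ha : (a : X) ∈ α ⊓ β := ⟨a.2, by
      rw [eq_neg_of_add_eq_zero_left h0]; exact β.neg_mem b.2⟩
    rw [hinf, Submodule.mem_bot] at ha
    rw [ha, zero_add] at h0
    ext <;> simp [ha, h0]
  have hsurj : T.range = ⊤ := by
    rw [eq_top_iff]
    rintro ⟨x, hx⟩ -
    rw [← hsup] at hx
    obtain ⟨a, ha, b, hb, rfl⟩ := Submodule.mem_sup.mp hx
    exact ⟨(⟨a, ha⟩, ⟨b, hb⟩), Subtype.ext (hT _)⟩
  let e := ContinuousLinearEquiv.ofBijective T hinj hsurj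
  refine ⟨(ContinuousLinearMap.fst ℂ α β).comp (e.symm : V →L[ℂ] α × β), fun x => ?_⟩
  have h1 : T (e.symm x) = x := ContinuousLinearEquiv.ofBijective_apply_symm_apply T hinj hsurj x
  have h2 := hT (e.symm x)
  rw [h1] at h2
  have h3 : (x : X) - (e.symm x).1 = (e.symm x).2 := by rw [h2]; abel
  simp only [ContinuousLinearMap.comp_apply, ContinuousLinearMap.coe_fst']
  exact h3 ▸ (e.symm x).2.2

/-- The main estimate. -/
theorem aux_key {X : Type*} [NormedAddCommGroup X] [NormedSpace ℂ X] (P : BddSymPair X)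
    (V₀ : Submodule ℂ X) (hV₀c : IsClosed (V₀ : Set X))
    (h : ℝ) (hh : h = 1 ∨ h = -1) (c : ℝ) (hc : 0 ≤ c)
    (α β : Submodule ℂ X) (hαV : α ≤ P.V) (hβV : β ≤ P.V)
    (hβneg : ∀ x ∈ β, h * (P.Q x x).re ≤ 0)
    (hβann : P.ann β β = V₀)
    (hβred : 0 < redMin P β)
    (horth : ∀ x ∈ α, ∀ y ∈ β, P.Q x y = 0) (η : ℝ) (hη : 0 < η) :
    ∃ ε > (0 : ℝ), ε ≤ 1 ∧ ∃ κ > (0 : ℝ), ∀ (R : BddSymPair X) (W₀ : Submodule ℂ X),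
      gapSub V₀ W₀ < ε → cGap P R c < ε → ∀ u ∈ R.V, 0 ≤ h * (R.Q u u).re → ‖u‖ ≤ 1 →
      ∀ x ∈ P.V, ‖x - u‖ ≤ ε → ∀ a ∈ α, x - a ∈ β → ‖a‖ < κ →
      Metric.infDist u (W₀ : Set X) < η := by
  obtain ⟨C₀, hC₀⟩ := P.bounded
  set C := |C₀| + 1 with hCdef
  have hC : 0 < C := by positivity
  have hCb : ∀ x ∈ P.V, ‖P.Q x x‖ ≤ C * ‖x‖ ^ 2 := by
    intro x hx
    have h1 := hC₀ x x hx hx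
    have h2 : C₀ ≤ C := (le_abs_self _).trans (by linarith)
    nlinarith [sq_nonneg ‖x‖]
  set g := redMin P β with hg
  set τ := min (η / 4) 1 with hτ
  have hτ0 : 0 < τ := by positivity
  have hτ1 : τ ≤ 1 := min_le_right _ _
  have hτη : τ ≤ η / 4 := min_le_left _ _
  set κ := min (min (η / 4) 1) (g * τ ^ 2 / (2 * C)) with hκ
  have hκ0 : 0 < κ := by positivity
  have hκ1 : κ ≤ 1 := (min_le_left _ _).trans (min_le_right _ _)
  have hκη : κ ≤ η / 4 := (min_le_left _ _).trans (min_le_left _ _)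
  have hκC : C * κ ≤ g * τ ^ 2 / 2 := by
    have h1 : κ ≤ g * τ ^ 2 / (2 * C) := min_le_right _ _
    calc C * κ ≤ C * (g * τ ^ 2 / (2 * C)) := by gcongr
      _ = _ := by field_simp
  set ε := min (min (η / 20) 1) (g * τ ^ 2 / (2 * (9 + 6 * c))) with hε
  have hε0 : 0 < ε := by positivity
  have hε1 : ε ≤ 1 := (min_le_left _ _).trans (min_le_right _ _)
  have hεη : ε ≤ η / 20 := (min_le_left _ _).trans (min_le_left _ _)
  have hεg : (9 + 6 * c) * ε ≤ g * τ ^ 2 / 2 := by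
    have h1 : ε ≤ g * τ ^ 2 / (2 * (9 + 6 * c)) := min_le_right _ _
    calc (9 + 6 * c) * ε ≤ (9 + 6 * c) * (g * τ ^ 2 / (2 * (9 + 6 * c))) := by gcongr
      _ = _ := by field_simp
  refine ⟨ε, hε0, hε1, κ, hκ0, ?_⟩
  intro R W₀ hgap hcg u huV huR hu1 x hxV hxu a ha hb haκ
  set b := x - a with hbdef
  have hx2 : ‖x‖ ≤ 2 := by
    have := norm_add_le (x - u) u
    rw [sub_add_cancel] at this
    linarith
  have hab : x = a + b := by rw [hbdef]; abel
  have haV := hαV ha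
  have hbV := hβV hb
  have h1 := aux_cGap P R c ε hc hcg x x u u hxV hxV huV huV
  have h2 : ‖P.Q x x - R.Q u u‖ ≤ (9 + 6 * c) * ε := by
    refine h1.trans ?_
    have e1 : ‖u‖ + ‖x‖ ≤ 3 := by linarith
    have e0 : 0 ≤ ‖u‖ + ‖x‖ := by positivity
    have e2 : ‖u - x‖ ≤ ε := by rw [norm_sub_rev]; exact hxu
    have e3 : (‖u‖ + ‖x‖) * (‖u‖ + ‖x‖) ≤ 3 * 3 := by gcongr
    have e4 : (‖u‖ + ‖x‖) * ‖u - x‖ ≤ 3 * ε := by gcongr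
    have e5 : ‖u - x‖ * (‖u‖ + ‖x‖) ≤ 3 * ε := by linarith
    calc _ ≤ ε * (3 * 3) + c * (3 * ε + 3 * ε) := by gcongr
      _ = _ := by ring
  have habs : ∀ z : ℂ, |h * z.re| ≤ ‖z‖ := by
    intro z
    have : |h| = 1 := by rcases hh with rfl | rfl <;> simp
    rw [abs_mul, this, one_mul]
    exact Complex.abs_re_le_norm z
  have h3 : -((9 + 6 * c) * ε) ≤ h * (P.Q x x).re := by
    have h4 := (abs_le.mp ((habs _).trans h2)).1
    rw [Complex.sub_re, mul_sub] at h4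
    linarith
  have hQ : P.Q x x = P.Q a a + P.Q b b := by
    have hab0 := horth a ha b hb
    have hba0 : P.Q b a = 0 := by rw [P.isSymm b a hbV haV, hab0, map_zero]
    have hxa : P.Q a x = P.Q a a := by
      rw [P.isSymm a x haV hxV, hab, P.add_left a b a haV hbV haV, hba0, add_zero,
        ← P.isSymm a a haV haV]
    have hxb : P.Q b x = P.Q b b := by
      rw [P.isSymm b x hbV hxV, hab, P.add_left a b b haV hbV hbV, hab0, zero_add,
        ← P.isSymm b b hbV hbV]
    have : P.Q x x = P.Q (a + b) x := by rw [← hab]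
    rw [this, P.add_left a b x haV hbV hxV, hxa, hxb]
  have hbn : ‖P.Q b b‖ = -(h * (P.Q b b).re) := by
    have him : (P.Q b b).im = 0 := Complex.conj_eq_iff_im.mp (P.isSymm b b hbV hbV).symm
    have h5 : P.Q b b = ((P.Q b b).re : ℂ) := Complex.ext (by simp) (by simp [him])
    rw [← abs_of_nonpos (hβneg b hb), abs_mul]
    have : |h| = 1 := by rcases hh with rfl | rfl <;> simp
    rw [this, one_mul]
    conv_lhs => rw [h5]
    rw [Complex.norm_real, Real.norm_eq_abs]
  have han : h * (P.Q a a).re < C * κ := by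
    calc h * (P.Q a a).re ≤ ‖P.Q a a‖ := (le_abs_self _).trans (habs _)
      _ ≤ C * ‖a‖ ^ 2 := hCb a haV
      _ < C * κ := by
        have : ‖a‖ ^ 2 < κ := by nlinarith [norm_nonneg a]
        gcongr
  rw [hQ, Complex.add_re, mul_add] at h3
  have h6 := aux_redMin P β V₀ hV₀c hβann hb
  rw [← hg] at h6
  have h7 : g * (Metric.infDist b (V₀ : Set X)) ^ 2 < g * τ ^ 2 := by linarith
  have h8 : Metric.infDist b (V₀ : Set X) < τ :=
    lt_of_pow_lt_pow_left₀ 2 hτ0.le (lt_of_mul_lt_mul_left h7 hβred.le)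
  obtain ⟨v, hv, hvd⟩ := (Metric.infDist_lt_iff ⟨0, V₀.zero_mem⟩).mp h8
  rw [dist_eq_norm] at hvd
  have hvn : ‖v‖ ≤ 4 := by
    have e1 : ‖v‖ ≤ ‖b‖ + ‖b - v‖ := by
      have := norm_sub_le b (b - v); simpa using this
    have e2 : ‖b‖ ≤ ‖x‖ + ‖a‖ := norm_sub_le x a
    linarith
  have h9 := aux_infDist_le_gap V₀ W₀ hv
  have h10 : Metric.infDist v (W₀ : Set X) ≤ ε * 4 := by
    refine h9.trans ?_
    calc gapSub V₀ W₀ * ‖v‖ ≤ ε * ‖v‖ := by gcongr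
      _ ≤ ε * 4 := by gcongr
  have h11 : Metric.infDist u (W₀ : Set X) ≤ Metric.infDist v (W₀ : Set X) + dist u v :=
    Metric.infDist_le_infDist_add_dist
  have h12 : dist u v ≤ ‖x - u‖ + ‖a‖ + ‖b - v‖ := by
    rw [dist_eq_norm]
    have : u - v = -(x - u) + a + (b - v) := by rw [hbdef]; abel
    rw [this]
    refine (norm_add_le _ _).trans ?_
    have := norm_add_le (-(x - u)) a
    rw [norm_neg] at this
    linarith
  linarith

/-- A dimension comparison: linear approximation version. -/
theorem aux_rank_le {X M : Type u} [NormedAddCommGroup X] [NormedSpace ℂ X]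
    [NormedAddCommGroup M] [NormedSpace ℂ M] (V α L W₀ : Submodule ℂ X)
    (hαc : CompleteSpace α) (π : V →L[ℂ] α) (ε κ : ℝ) (hε1 : ε ≤ 1) (hκ : 0 < κ)
    (j : M →ₗ[ℂ] X ⧸ W₀) (hj : ∀ m, ‖j m‖ = ‖m‖)
    (hlift : ∀ m : M, ‖m‖ < 1 → ∃ u ∈ L, ‖u‖ < 1 ∧ W₀.mkQ u = j m)
    (happ : ∀ u ∈ L, ‖u‖ < 1 → ∃ x : V, ‖(x : X) - u‖ ≤ ε)
    (hkey : ∀ u ∈ L, ‖u‖ ≤ 1 → ∀ x : V, ‖(x : X) - u‖ ≤ ε →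
      (if FiniteDimensional ℂ α then (1 / 8 : ℝ) ^ (Module.finrank ℂ α + 1) else 1 / 8)
        ≤ ‖W₀.mkQ u‖ → κ ≤ ‖π x‖) :
    Module.rank ℂ M ≤ Module.rank ℂ α := by
  have hf : ∀ m : M, ∃ (u : X) (x : V), ‖m‖ < 1 →
      u ∈ L ∧ ‖u‖ < 1 ∧ W₀.mkQ u = j m ∧ ‖(x : X) - u‖ ≤ ε := by
    intro m
    by_cases hm : ‖m‖ < 1
    · obtain ⟨u, hu, hu1, hum⟩ := hlift m hm
      obtain ⟨x, hx⟩ := happ u hu hu1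
      exact ⟨u, x, fun _ => ⟨hu, hu1, hum, hx⟩⟩
    · exact ⟨0, 0, fun h => absurd h hm⟩
  choose U Y hUY using hf
  by_cases hfin : FiniteDimensional ℂ α
  · rw [if_pos hfin] at hkey
    by_contra hcon
    push Not at hcon
    set n := Module.finrank ℂ α with hn
    rw [← Module.finrank_eq_rank, ← hn] at hcon
    have hn1 : ((n + 1 : ℕ) : Cardinal) ≤ Module.rank ℂ M := by
      have := Order.succ_le_of_lt hcon
      simpa using this
    obtain ⟨u, hu1, hut⟩ := aux_riesz_family (n + 1) hn1
    have hli : ¬ LinearIndependent ℂ (fun i => π (Y (u i))) := by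
      intro hli
      have := hli.fintype_card_le_finrank
      rw [Fintype.card_fin, ← hn] at this
      omega
    obtain ⟨g, hg, i₀, hi₀⟩ := Fintype.not_linearIndependent_iff.mp hli
    set s := ∑ i, ‖g i‖ with hs
    have hs0 : 0 < s :=
      Finset.sum_pos' (fun i _ => norm_nonneg _) ⟨i₀, Finset.mem_univ _, norm_pos_iff.mpr hi₀⟩
    let t : Fin (n + 1) → ℂ := fun i => ((s⁻¹ : ℝ) : ℂ) * g i
    have htn : ∀ i, ‖t i‖ = s⁻¹ * ‖g i‖ := fun i => by
      simp only [t]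
      rw [norm_mul, Complex.norm_real, Real.norm_of_nonneg (by positivity)]
    have ht1 : ∑ i, ‖t i‖ = 1 := by
      simp only [htn]
      rw [← Finset.mul_sum, ← hs, inv_mul_cancel₀ hs0.ne']
    have hπ : π (∑ i, t i • Y (u i)) = 0 := by
      rw [map_sum]
      simp only [map_smul, t, mul_smul]
      rw [← Finset.smul_sum, hg, smul_zero]
    have hb : ∀ (B : ℝ) (z : Fin (n + 1) → X), (∀ i, ‖z i‖ ≤ B) → ‖∑ i, t i • z i‖ ≤ B := by
      intro B z hz
      calc ‖∑ i, t i • z i‖ ≤ ∑ i, ‖t i‖ * B := by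
            refine norm_sum_le_of_le _ fun i _ => ?_
            rw [norm_smul]
            gcongr
            exact hz i
        _ = B := by rw [← Finset.sum_mul, ht1, one_mul]
    have h1 := hkey (∑ i, t i • U (u i))
      (L.sum_mem fun i _ => L.smul_mem _ (hUY _ (hu1 i)).1)
      (hb 1 _ fun i => (hUY _ (hu1 i)).2.1.le) (∑ i, t i • Y (u i)) (by
        have : ((∑ i, t i • Y (u i) : V) : X) - ∑ i, t i • U (u i)
            = ∑ i, t i • ((Y (u i) : X) - U (u i)) := by
          simp [smul_sub, Finset.sum_sub_distrib]
        rw [this]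
        exact hb ε _ fun i => (hUY _ (hu1 i)).2.2.2) (by
        have : W₀.mkQ (∑ i, t i • U (u i)) = j (∑ i, t i • u i) := by
          rw [map_sum, map_sum]
          refine Finset.sum_congr rfl fun i _ => ?_
          rw [map_smul, map_smul, (hUY _ (hu1 i)).2.2.1]
        rw [this, hj]
        have := hut t
        rwa [ht1, mul_one] at this)
    rw [hπ, norm_zero] at h1
    linarith
  · rw [if_neg hfin] at hkey
    refine aux_rank_le_of_separated hfin (fun m => π (Y m)) (‖π‖ * 2) κ hκ ?_ ?_
    · intro m hm
      obtain ⟨_, h1, _, h2⟩ := hUY m hm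
      refine (π.le_opNorm _).trans ?_
      gcongr
      have h3 := norm_add_le ((Y m : X) - U m) (U m)
      rw [sub_add_cancel] at h3
      rw [Submodule.coe_norm]
      linarith
    · intro m m' hm hm' hmm
      obtain ⟨a1, a2, a3, a4⟩ := hUY m hm
      obtain ⟨b1, b2, b3, b4⟩ := hUY m' hm'
      have hhalf : ‖(1 / 2 : ℂ)‖ = 1 / 2 := by simp
      have h1 := hkey ((1 / 2 : ℂ) • (U m - U m')) (L.smul_mem _ (L.sub_mem a1 b1)) (by
        rw [norm_smul, hhalf]
        have := norm_sub_le (U m) (U m')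
        linarith) ((1 / 2 : ℂ) • (Y m - Y m')) (by
        have : (((1 / 2 : ℂ) • (Y m - Y m') : V) : X) - (1 / 2 : ℂ) • (U m - U m')
            = (1 / 2 : ℂ) • (((Y m : X) - U m) - ((Y m' : X) - U m')) := by
          rw [Submodule.coe_smul, Submodule.coe_sub, ← smul_sub]
          congr 1
          abel
        rw [this, norm_smul, hhalf]
        have := norm_sub_le ((Y m : X) - U m) ((Y m' : X) - U m')
        linarith) (by
        have : W₀.mkQ ((1 / 2 : ℂ) • (U m - U m')) = j ((1 / 2 : ℂ) • (m - m')) := by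
          rw [map_smul, map_smul, map_sub, map_sub, a3, b3]
        rw [this, hj, norm_smul, hhalf]
        linarith)
      rw [map_smul, map_sub, norm_smul, hhalf] at h1
      have := norm_nonneg (π (Y m) - π (Y m'))
      linarith

theorem aux_main {X : Type u} [NormedAddCommGroup X]
    [NormedSpace ℂ X] [CompleteSpace X] (P : BddSymPair X)
    (V₀ : Submodule ℂ X) (hV₀c : IsClosed (V₀ : Set X))
    (h : ℝ) (hh : h = 1 ∨ h = -1) (c : ℝ) (hc : 0 ≤ c)
    (α β : Submodule ℂ X)
    (hαc : IsClosed (α : Set X)) (hβc : IsClosed (β : Set X))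
    (hαV : α ≤ P.V) (hβV : β ≤ P.V)
    (hβneg : ∀ x ∈ β, h * (P.Q x x).re ≤ 0)
    (hβann : P.ann β β = V₀)
    (hβred : 0 < redMin P β)
    (hinf : α ⊓ β = ⊥) (hsup : α ⊔ β = P.V)
    (horth : ∀ x ∈ α, ∀ y ∈ β, P.Q x y = 0) :
    ∃ ε > (0 : ℝ), ∀ (R : BddSymPair X) (W₀ : Submodule ℂ X),
      IsClosed (W₀ : Set X) → W₀ ≤ R.ann R.V R.V →
      hatGap P.V R.V < ε → gapSub V₀ W₀ < ε → cGap P R c < ε →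
      ∀ γ : Submodule ℂ X, γ ≤ R.V → (∀ x ∈ γ, x ≠ 0 → 0 < h * (R.Q x x).re) →
      Module.rank ℂ γ + quotRank W₀ (R.ann R.V R.V) ≤ Module.rank ℂ ↥α := by
  obtain ⟨π, hπ⟩ := aux_projection P.V α β P.closed hαc hβc hinf hsup
  obtain ⟨ε, hε0, hε1, κ, hκ, hkey⟩ := aux_key P V₀ hV₀c h hh c hc α β hαV hβV hβneg hβann hβred
    horth (if FiniteDimensional ℂ α then (1 / 8 : ℝ) ^ (Module.finrank ℂ α + 1) else 1 / 8)
    (by split_ifs <;> positivity)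
  refine ⟨ε, hε0, ?_⟩
  intro R W₀ hW₀c hW₀ hgap hgap₀ hcg γ hγV hγ
  set B := R.ann R.V R.V with hB
  have hBV : B ≤ R.V := fun x hx => hx.1.2
  have hB0 : ∀ x ∈ B, ∀ y ∈ R.V, R.Q x y = 0 := fun x hx y hy => hx.2 y hy hy
  have hB0' : ∀ x ∈ B, ∀ y ∈ R.V, R.Q y x = 0 := fun x hx y hy => by
    rw [R.isSymm y x hy (hBV hx), hB0 x hx y hy, map_zero]
  have hγB : ∀ x ∈ γ, x ∈ B → x = 0 := by
    intro x hx hxB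
    by_contra hne
    have h1 := hγ x hx hne
    rw [hB0 x hxB x (hγV hx)] at h1
    simp at h1
  have hLV : γ ⊔ B ≤ R.V := sup_le hγV hBV
  have hLpos : ∀ u ∈ γ ⊔ B, 0 ≤ h * (R.Q u u).re := by
    intro u hu
    have huV := hLV hu
    obtain ⟨g, hg, w, hw, rfl⟩ := Submodule.mem_sup.mp hu
    have hgV := hγV hg
    have hwV := hBV hw
    have h1 : R.Q (g + w) (g + w) = R.Q g g := by
      rw [R.add_left g w _ hgV hwV huV, hB0 w hw _ huV, add_zero, R.isSymm g _ hgV huV,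
        R.add_left g w g hgV hwV hgV, hB0 w hw g hgV, add_zero, ← R.isSymm g g hgV hgV]
    rw [h1]
    by_cases hg0 : g = 0
    · rw [hg0, hB0 0 B.zero_mem 0 R.V.zero_mem]; simp
    · exact (hγ g hg hg0).le
  have := hW₀c
  have hαcs : CompleteSpace α := hαc.completeSpace_coe
  let q : (B ⧸ W₀.comap B.subtype) →ₗ[ℂ] X ⧸ W₀ :=
    Submodule.mapQ (W₀.comap B.subtype) W₀ B.subtype le_rfl
  let Φ : (γ × (B ⧸ W₀.comap B.subtype)) →ₗ[ℂ] X ⧸ W₀ :=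
    LinearMap.coprod (W₀.mkQ.comp γ.subtype) q
  have hΦ : ∀ (g : γ) (w : B), Φ (g, Submodule.Quotient.mk w) = W₀.mkQ ((g : X) + w) := by
    intro g w
    simp [Φ, q]
  have hΦinj : Function.Injective Φ := by
    rw [← LinearMap.ker_eq_bot, Submodule.eq_bot_iff]
    rintro ⟨g, w'⟩ hgw
    obtain ⟨w, rfl⟩ := Submodule.Quotient.mk_surjective _ w'
    rw [LinearMap.mem_ker, hΦ] at hgw
    have h1 : (g : X) + w ∈ W₀ := (Submodule.Quotient.mk_eq_zero W₀).mp hgw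
    have h2 : (g : X) ∈ B := by
      have := B.sub_mem (hW₀ h1) w.2
      simpa using this
    have h3 := hγB g g.2 h2
    have h4 : g = 0 := Subtype.ext h3
    rw [h3, zero_add] at h1
    have h5 : (Submodule.Quotient.mk w : B ⧸ W₀.comap B.subtype) = 0 := by
      rw [Submodule.Quotient.mk_eq_zero]; exact h1
    rw [h4, h5]
    rfl
  have hrank : Module.rank ℂ γ + quotRank W₀ B = Module.rank ℂ (LinearMap.range Φ) := by
    rw [rank_range_of_injective Φ hΦinj, rank_prod']
    rfl
  rw [hrank]
  refine aux_rank_le P.V α (γ ⊔ B) W₀ hαcs π ε κ hε1 hκ (LinearMap.range Φ).subtype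
    (fun m => rfl) ?_ ?_ ?_
  · rintro ⟨m, ⟨g, w'⟩, rfl⟩ hm
    obtain ⟨w, rfl⟩ := Submodule.Quotient.mk_surjective _ w'
    obtain ⟨u, hu, hun⟩ := Submodule.Quotient.norm_mk_lt (Φ (g, Submodule.Quotient.mk w))
      (sub_pos.mpr hm)
    refine ⟨u, ?_, ?_, hu⟩
    · rw [hΦ] at hu
      have h1 : u - ((g : X) + w) ∈ W₀ := (Submodule.Quotient.eq W₀).mp hu
      have h2 : u = (g : X) + ((w : X) + (u - ((g : X) + w))) := by abel
      rw [h2]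
      exact Submodule.add_mem_sup g.2 (B.add_mem w.2 (hW₀ h1))
    · have : ‖(⟨Φ (g, Submodule.Quotient.mk w), ⟨_, rfl⟩⟩ : LinearMap.range Φ)‖
        = ‖Φ (g, Submodule.Quotient.mk w)‖ := rfl
      rw [this] at hun
      linarith
  · intro u hu hu1
    have h1 := aux_infDist_le_gap R.V P.V (hLV hu)
    have h2 : gapSub R.V P.V < ε := (le_max_right _ _).trans_lt hgap
    have h3 : Metric.infDist u (P.V : Set X) < ε := by
      by_cases hu0 : ‖u‖ = 0
      · rw [hu0, mul_zero] at h1; linarith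
      · have : 0 < ‖u‖ := lt_of_le_of_ne (norm_nonneg _) (Ne.symm hu0)
        nlinarith
    obtain ⟨x, hx, hxd⟩ := (Metric.infDist_lt_iff ⟨0, P.V.zero_mem⟩).mp h3
    refine ⟨⟨x, hx⟩, ?_⟩
    rw [dist_comm, dist_eq_norm] at hxd
    exact hxd.le
  · intro u hu hu1 x hxu hη
    by_contra hcon
    push Not at hcon
    have h1 := hkey R W₀ hgap₀ hcg u (hLV hu) (hLpos u hu) hu1 x x.2 hxu (π x) (π x).2 (hπ x)
      (by simpa using hcon)
    have h2 : ‖W₀.mkQ u‖ = Metric.infDist u (W₀ : Set X) :=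
      QuotientAddGroup.norm_mk (S := W₀.toAddSubgroup) u
    rw [h2] at hη
    linarith

/-- Perturbed augmented Morse index: with `V = α ⊕ β` a
`Q`-orthogonal decomposition, `hQ` positive semi-definite on `α`, `hQ`
negative semi-definite on `β` with `β^{Q|_β} = V₀` and `γ(Q|_β) > 0`, for
every bounded symmetric pair `(R, W)` and closed `W₀ ⊆ W^R` with `δ̂(V,W)`,
`δ(V₀,W₀)` and `δ_c(Q,R)` sufficiently small one has
`m⁺(hR) + dim(W^R/W₀) ≤ dim α`. -/
theorem perturbed_augmented_morse_index {X : Type*} [NormedAddCommGroup X]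
    [NormedSpace ℂ X] [CompleteSpace X] (P : BddSymPair X)
    (V₀ : Submodule ℂ X) (hV₀c : IsClosed (V₀ : Set X))
    (hV₀ : V₀ ≤ P.ann P.V P.V)
    (h : ℝ) (hh : h = 1 ∨ h = -1) (c : ℝ) (hc : 0 ≤ c)
    (α β : Submodule ℂ X)
    (hαc : IsClosed (α : Set X)) (hβc : IsClosed (β : Set X))
    (hαV : α ≤ P.V) (hβV : β ≤ P.V)
    (hαpos : ∀ x ∈ α, 0 ≤ h * (P.Q x x).re)
    (hβneg : ∀ x ∈ β, h * (P.Q x x).re ≤ 0)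
    (hβann : P.ann β β = V₀)
    (hβred : 0 < redMin P β)
    (hinf : α ⊓ β = ⊥) (hsup : α ⊔ β = P.V)
    (horth : ∀ x ∈ α, ∀ y ∈ β, P.Q x y = 0) :
    ∃ ε > (0 : ℝ), ∀ (R : BddSymPair X) (W₀ : Submodule ℂ X),
      IsClosed (W₀ : Set X) → W₀ ≤ R.ann R.V R.V →
      hatGap P.V R.V < ε → gapSub V₀ W₀ < ε → cGap P R c < ε →
      morsePos R h + quotRank W₀ (R.ann R.V R.V) ≤ Module.rank ℂ ↥α := by
  obtain ⟨ε, hε, H⟩ := aux_main P V₀ hV₀c h hh c hc α β hαc hβc hαV hβV hβneg hβann hβred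
    hinf hsup horth
  refine ⟨ε, hε, fun R W₀ hW₀c hW₀ h1 h2 h3 => ?_⟩
  have H' := H R W₀ hW₀c hW₀ h1 h2 h3
  have hbdd : BddAbove {c : Cardinal | ∃ γ : Submodule ℂ X, γ ≤ R.V ∧
      (∀ x ∈ γ, x ≠ 0 → 0 < h * (R.Q x x).re) ∧ c = Module.rank ℂ ↥γ} := by
    refine ⟨Module.rank ℂ ↥α, ?_⟩
    rintro _ ⟨γ, hγ, hγp, rfl⟩
    exact le_self_add.trans (H' γ hγ hγp)
  have hne : {c : Cardinal | ∃ γ : Submodule ℂ X, γ ≤ R.V ∧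
      (∀ x ∈ γ, x ≠ 0 → 0 < h * (R.Q x x).re) ∧ c = Module.rank ℂ ↥γ}.Nonempty :=
    ⟨_, ⊥, bot_le, fun x hx hx0 => absurd ((Submodule.mem_bot ℂ).mp hx) hx0, rfl⟩
  unfold morsePos
  rw [sSup_eq_iSup']
  have := hne.to_subtype
  rw [Cardinal.ciSup_add _ (by rwa [Subtype.range_coe])]
  refine ciSup_le' ?_
  rintro ⟨_, γ, hγ, hγp, rfl⟩
  exact H' γ hγ hγp
end
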